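/- arXiv:2507.05697 — 2 statements merged into one kernel-verified Lean document; each statement's English description precedes it below -/
import Mathlib

section
/- Let ε>0 be a constant, let 0 < p = p(n) ≤ (2^{-7/2} − ε)·n^{-1/2}, and let H ~ H_{n,p} be the 2-dimensional Linial–Meshulam random complex. Then with high probability there is no tree T ⊂ K_n of diameter at most n^{1/12−ε} such that T triadically activates K_n in H. -/
namespace WSat

variable {V : Type} [Fintype V] [DecidableEq V]

/-- The edges of the triangle recorded in an activation step `(a, b, c)`:
the step activates the edge `{a, b}` using the triangle `{a, b, c}`. -/
def triEdges (st : V × V × V) : Set (Sym2 V) :=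
  {s(st.1, st.2.1), s(st.1, st.2.2), s(st.2.1, st.2.2)}

/-- The graph `H ∪ Δ₁ ∪ ⋯ ∪ Δ_s`. -/
def afterGraph (H : SimpleGraph V) (steps : List (V × V × V)) : SimpleGraph V :=
  H ⊔ SimpleGraph.fromEdgeSet {e | ∃ st ∈ steps, e ∈ triEdges st}

/-- `(H; Δ₁, …, Δ_s)` is a (`K₃`-bootstrap) activation process: at each step `i`, the
step `(a, b, c)` adds the new edge `{a, b}` (not present before), which forms the triangle
`{a, b, c}` together with the two previously present edges `{a, c}` and `{b, c}`. -/
def IsValidProcess (H : SimpleGraph V) (steps : List (V × V × V)) : Prop :=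
  ∀ (i : ℕ) (hi : i < steps.length),
    (steps.get ⟨i, hi⟩).1 ≠ (steps.get ⟨i, hi⟩).2.1 ∧
    ¬ (afterGraph H (steps.take i)).Adj (steps.get ⟨i, hi⟩).1 (steps.get ⟨i, hi⟩).2.1 ∧
    (afterGraph H (steps.take i)).Adj (steps.get ⟨i, hi⟩).1 (steps.get ⟨i, hi⟩).2.2 ∧
    (afterGraph H (steps.take i)).Adj (steps.get ⟨i, hi⟩).2.1 (steps.get ⟨i, hi⟩).2.2

open scoped Classical in
/-- The probability that the 2-dimensional Linial–Meshulam random complex `H_{n,p}`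
(identified with its random set of triangular faces; its 1-skeleton is `K_n` and each of
the `n.choose 3` triangles is included independently with probability `p`) belongs to the
set `A`. -/
noncomputable def lmProb (n : ℕ) (p : ℝ)
    (A : Set (Finset {t : Finset (Fin n) // t.card = 3})) : ℝ :=
  ∑ F : Finset {t : Finset (Fin n) // t.card = 3},
    if F ∈ A then p ^ F.card * (1 - p) ^ (n.choose 3 - F.card) else 0

/-- `(H; steps)` is a valid triadic activation process in the 2-complex whose 1-skeleton
is `K_n` and whose set of faces is `F`: each step adds a new edge `{a, b}` which belongs
to a triangle `{a, b, c} ∈ F` whose other two edges are already present. -/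
def IsValidTriadicProcess {n : ℕ} (F : Finset {t : Finset (Fin n) // t.card = 3})
    (H : SimpleGraph (Fin n)) (steps : List (Fin n × Fin n × Fin n)) : Prop :=
  ∀ (i : ℕ) (hi : i < steps.length),
    ¬ (afterGraph H (steps.take i)).Adj (steps.get ⟨i, hi⟩).1 (steps.get ⟨i, hi⟩).2.1 ∧
    (afterGraph H (steps.take i)).Adj (steps.get ⟨i, hi⟩).1 (steps.get ⟨i, hi⟩).2.2 ∧
    (afterGraph H (steps.take i)).Adj (steps.get ⟨i, hi⟩).2.1 (steps.get ⟨i, hi⟩).2.2 ∧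
    ∃ t ∈ F, (t : Finset (Fin n)) =
      {(steps.get ⟨i, hi⟩).1, (steps.get ⟨i, hi⟩).2.1, (steps.get ⟨i, hi⟩).2.2}


section
variable {W : Type} [DecidableEq W]

/-! ### Mod 2 chains -/

open scoped Classical in
/-- mod 2 incidence between a set of vertices and an edge -/
noncomputable def inc (t : Finset W) (f : Sym2 W) : ZMod 2 :=
  if ¬ f.IsDiag ∧ ∀ x ∈ f, x ∈ t then 1 else 0

/-- indicator of an edge -/
def ind (a b : W) (f : Sym2 W) : ZMod 2 := if s(a, b) = f then 1 else 0

/-- indicator of an edge, zero on loops -/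
def ind0 (a b : W) (f : Sym2 W) : ZMod 2 := if a = b then 0 else ind a b f

/-- mod 2 boundary -/
noncomputable def bd (S : Finset (Finset W)) (f : Sym2 W) : ZMod 2 := ∑ t ∈ S, inc t f

lemma ind_comm (a b : W) (f : Sym2 W) : ind a b f = ind b a f := by
  unfold ind; rw [Sym2.eq_swap]

lemma inc_tri {a b c : W} (hab : a ≠ b) (hac : a ≠ c) (hbc : b ≠ c) (f : Sym2 W) :
    inc {a, b, c} f = ind a b f + ind a c f + ind b c f := by
  induction f with
  | _ x y =>
  simp only [inc, ind, Sym2.mk_isDiag_iff, Sym2.mem_iff, Finset.mem_insert,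
    Finset.mem_singleton, forall_eq_or_imp, forall_eq, Sym2.eq_iff]
  by_cases hxa : x = a <;> by_cases hxb : x = b <;> by_cases hxc : x = c <;>
  by_cases hya : y = a <;> by_cases hyb : y = b <;> by_cases hyc : y = c <;>
  simp_all [eq_comm]

lemma sum_ind_mul [Fintype W] (a b : W) (φ : Sym2 W → ZMod 2) :
    ∑ f, ind a b f * φ f = φ s(a, b) := by
  simp [ind]

/-- coboundary of a function -/
def cob (g : W → ZMod 2) : Sym2 W → ZMod 2 :=
  Sym2.lift ⟨fun a b => g a + g b, fun _ _ => add_comm _ _⟩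

@[simp] lemma cob_mk (g : W → ZMod 2) (a b : W) : cob g s(a, b) = g a + g b := rfl

lemma pairing [Fintype W] (S : Finset (Finset W)) (hS : ∀ t ∈ S, t.card = 3) (g : W → ZMod 2) :
    ∑ f, bd S f * cob g f = 0 := by
  unfold bd
  simp_rw [Finset.sum_mul]
  rw [Finset.sum_comm]
  refine Finset.sum_eq_zero fun t ht => ?_
  obtain ⟨a, b, c, hab, hac, hbc, rfl⟩ := Finset.card_eq_three.mp (hS t ht)
  simp_rw [inc_tri hab hac hbc, add_mul, Finset.sum_add_distrib, sum_ind_mul, cob_mk]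
  generalize g a = x; generalize g b = y; generalize g c = z
  revert x y z; decide

lemma bd_symmDiff (S U : Finset (Finset W)) (f : Sym2 W) :
    bd (symmDiff S U) f = bd S f + bd U f := by
  unfold bd
  have h1 : ∑ t ∈ S, inc t f = ∑ t ∈ S \ U, inc t f + ∑ t ∈ S ∩ U, inc t f := by
    rw [add_comm]; exact (Finset.sum_inter_add_sum_sdiff S U _).symm
  have h2 : ∑ t ∈ U, inc t f = ∑ t ∈ U \ S, inc t f + ∑ t ∈ S ∩ U, inc t f := by
    rw [add_comm, Finset.inter_comm]; exact (Finset.sum_inter_add_sum_sdiff U S _).symm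
  rw [h1, h2, symmDiff_def, Finset.sup_eq_union, Finset.sum_union disjoint_sdiff_sdiff]
  generalize ∑ t ∈ S \ U, inc t f = x
  generalize ∑ t ∈ U \ S, inc t f = y
  generalize ∑ t ∈ S ∩ U, inc t f = z
  revert x y z; decide

/-! ### Polygons -/

/-- triangles of the polygon -/
def tris : W → W → BinaryTree W → List (Finset W)
  | _, _, .nil => []
  | u, v, .node x l r => {u, v, x} :: (tris u x l ++ tris x v r)

/-- inorder labels -/
def inord : BinaryTree W → List W
  | .nil => []
  | .node x l r => inord l ++ x :: inord r

/-- mod 2 sum of the edges of a walk -/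
def wsum : W → List W → Sym2 W → ZMod 2
  | _, [], _ => 0
  | u, v :: l, f => ind0 u v f + wsum v l f

/-- sides of the polygon -/
def sides : W → W → BinaryTree W → List (Sym2 W)
  | u, v, .nil => [s(u, v)]
  | u, v, .node x l r => sides u x l ++ sides x v r

lemma wsum_append (u x : W) (l m : List W) (f : Sym2 W) :
    wsum u (l ++ x :: m) f = wsum u (l ++ [x]) f + wsum x m f := by
  induction l generalizing u with
  | nil => simp [wsum]
  | cons a l ih => simp [wsum, ih, add_assoc]

lemma wsum_eq_zero (u v : W) (t : BinaryTree W) (f : Sym2 W) (h : f ∉ sides u v t) :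
    wsum u (inord t ++ [v]) f = 0 := by
  induction t generalizing u v with
  | nil =>
    simp only [sides, List.mem_singleton] at h
    simp [inord, wsum, ind0, ind, Ne.symm h]
  | node x l r ihl ihr =>
    simp only [sides, List.mem_append, not_or] at h
    rw [inord, List.append_assoc, List.cons_append, wsum_append, ihl _ _ h.1, ihr _ _ h.2, add_zero]

lemma length_tris (u v : W) (t : BinaryTree W) : (tris u v t).length = t.numNodes := by
  induction t generalizing u v with
  | nil => rfl
  | node x l r ihl ihr => simp [tris, ihl, ihr]

lemma length_inord (t : BinaryTree W) : (inord t).length = t.numNodes := by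
  induction t with
  | nil => rfl
  | node x l r ihl ihr => simp [inord, ihl, ihr]; omega

lemma card3 {u v x : W} (h : ({u, v, x} : Finset W).card = 3) : u ≠ v ∧ u ≠ x ∧ v ≠ x := by
  refine ⟨?_, ?_, ?_⟩ <;> rintro rfl
  · have := Finset.card_le_two (a := u) (b := x); simp at h; omega
  · have := Finset.card_le_two (a := u) (b := v)
    rw [show ({u, v, u} : Finset W) = {u, v} by ext; simp; tauto] at h; omega
  · have := Finset.card_le_two (a := u) (b := v); simp at h; omega

lemma bd_tris (u v : W) (huv : u ≠ v) (t : BinaryTree W) (h : ∀ s ∈ tris u v t, s.card = 3)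
    (f : Sym2 W) :
    ((tris u v t).map (fun s => inc s f)).sum = ind u v f + wsum u (inord t ++ [v]) f := by
  induction t generalizing u v with
  | nil =>
    simp only [tris, inord, wsum, ind0, huv, List.map_nil, List.sum_nil, List.nil_append, if_false,
      add_zero]
    generalize ind u v f = x
    revert x; decide
  | node x l r ihl ihr =>
    simp only [tris, List.mem_cons, List.mem_append] at h
    obtain ⟨h1, h2, h3⟩ := card3 (h _ (Or.inl rfl))
    rw [tris, List.map_cons, List.map_append, List.sum_cons, List.sum_append, inc_tri h1 h2 h3,
      ihl u x h2 (fun s hs => h s (Or.inr (Or.inl hs))),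
      ihr x v h3.symm (fun s hs => h s (Or.inr (Or.inr hs))), inord, List.append_assoc,
      List.cons_append, wsum_append u x (inord l) (inord r ++ [v]), ind_comm x v]
    generalize ind u v f = a; generalize ind u x f = b; generalize ind v x f = c
    generalize wsum u (inord l ++ [x]) f = d; generalize wsum x (inord r ++ [v]) f = e
    revert a b c d e; decide

lemma attach (u v : W) (t : BinaryTree W) (f : Sym2 W) (hf : f ∈ sides u v t) (D : Finset W)
    (hD : D.card = 3) (hi : inc D f ≠ 0) :
    ∃ t' : BinaryTree W, (tris u v t').Perm (D :: tris u v t) := by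
  induction t generalizing u v with
  | nil =>
    simp only [sides, List.mem_singleton] at hf
    subst hf
    simp only [inc, Sym2.mk_isDiag_iff, Sym2.mem_iff, forall_eq_or_imp, forall_eq, ne_eq,
      ite_eq_right_iff, one_ne_zero, imp_false, not_not] at hi
    obtain ⟨huv, hu, hv⟩ := hi
    have hc : ((D.erase u).erase v).card = 1 := by
      rw [Finset.card_erase_of_mem (by simp [hv, Ne.symm huv]), Finset.card_erase_of_mem hu, hD]
    obtain ⟨x, hx⟩ := Finset.card_eq_one.mp hc
    refine ⟨.node x .nil .nil, ?_⟩
    have : D = {u, v, x} := by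
      rw [← Finset.insert_erase hu, ← Finset.insert_erase (s := D.erase u) (a := v)
        (by simp [hv, Ne.symm huv]), hx]
    simp [tris, this]
  | node x l r ihl ihr =>
    simp only [sides, List.mem_append] at hf
    rcases hf with hf | hf
    · obtain ⟨l', hl'⟩ := ihl u x hf
      refine ⟨.node x l' r, ?_⟩
      simp only [tris]
      refine ((hl'.append_right _).cons _).trans ?_
      exact List.Perm.swap _ _ _
    · obtain ⟨r', hr'⟩ := ihr x v hf
      refine ⟨.node x l r', ?_⟩
      simp only [tris]
      refine ((hr'.append_left _).cons _).trans ?_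
      refine (List.perm_middle.cons _).trans ?_
      exact List.Perm.swap _ _ _

lemma bd_toFinset (l : List (Finset W)) (h : l.Nodup) (f : Sym2 W) :
    bd l.toFinset f = (l.map (fun s => inc s f)).sum := by
  unfold bd
  rw [List.sum_toFinset _ h]

theorem exists_polygon (S : Finset (Finset W)) (hS : ∀ t ∈ S, t.card = 3) (u v : W) (huv : u ≠ v)
    (γ : Sym2 W → ZMod 2) (hγ : ∀ f, bd S f = γ f) (he : γ s(u, v) = 1)
    (simp' : ∀ C ⊆ S, (∀ f, γ f = 0 → bd C f = 0) → bd C s(u, v) = 0 → ∀ f, bd C f = 0)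
    (hmin : ∀ U ⊆ S, (∀ f, bd U f = γ f) → U = S) :
    ∃ t : BinaryTree W, (tris u v t).Nodup ∧ (tris u v t).toFinset = S := by
  have key : ∀ j, j ≤ S.card → ∃ t : BinaryTree W, (tris u v t).Nodup ∧
      (tris u v t).toFinset ⊆ S ∧ (tris u v t).length = j := by
    intro j
    induction j with
    | zero => intro _; exact ⟨.nil, by simp [tris], by simp [tris], by simp [tris]⟩
    | succ j ih =>
      intro hj
      obtain ⟨t, hnd, hsub, hlen⟩ := ih (by omega)
      set U := (tris u v t).toFinset with hU
      have hUc : U.card = j := by rw [hU, List.toFinset_card_of_nodup hnd, hlen]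
      have hbU : ∀ f, bd U f = ind u v f + wsum u (inord t ++ [v]) f := by
        intro f
        rw [hU, bd_toFinset _ hnd, bd_tris u v huv]
        intro s hs
        exact hS s (hsub (List.mem_toFinset.mpr hs))
      have hadd : ∀ f, γ f = bd U f + bd (S \ U) f := by
        intro f
        rw [← hγ, bd, bd, bd, add_comm, Finset.sum_sdiff hsub]
      by_cases hex : ∃ f ∈ sides u v t, ∃ D ∈ S \ U, inc D f ≠ 0
      · obtain ⟨f, hf, D, hDm, hi⟩ := hex
        obtain ⟨hDS, hDU⟩ := Finset.mem_sdiff.mp hDm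
        obtain ⟨t', ht'⟩ := attach u v t f hf D (hS D hDS) hi
        refine ⟨t', ?_, ?_, ?_⟩
        · rw [ht'.nodup_iff, List.nodup_cons]
          exact ⟨fun h => hDU (List.mem_toFinset.mpr h), hnd⟩
        · intro s hs
          rw [List.mem_toFinset, ht'.mem_iff, List.mem_cons] at hs
          rcases hs with rfl | hs
          · exact hDS
          · exact hsub (List.mem_toFinset.mpr hs)
        · rw [ht'.length_eq, List.length_cons, hlen]
      · exfalso
        push Not at hex
        have hside : ∀ f ∈ sides u v t, bd (S \ U) f = 0 := fun f hf =>
          Finset.sum_eq_zero fun D hD => hex f hf D hD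
        have hCe : bd (S \ U) s(u, v) = 0 := by
          by_cases hs : s(u, v) ∈ sides u v t
          · exact hside _ hs
          · have h1 := hadd s(u, v)
            rw [hbU, wsum_eq_zero _ _ _ _ hs, he] at h1
            simp only [ind, if_true, add_zero] at h1
            simpa using h1
        have hC0 := simp' (S \ U) Finset.sdiff_subset (by
          intro f hf0
          by_cases hs : f ∈ sides u v t
          · exact hside _ hs
          · by_cases hfe : s(u, v) = f
            · rw [← hfe]; exact hCe
            · have h1 := hadd f
              rw [hbU, wsum_eq_zero _ _ _ _ hs, hf0] at h1
              simp only [ind, hfe, if_false, add_zero, zero_add] at h1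
              exact h1.symm) hCe
        have := hmin U hsub (fun f => by rw [hadd f, hC0 f, add_zero])
        rw [this] at hUc
        omega
  obtain ⟨t, h1, h2, h3⟩ := key S.card le_rfl
  refine ⟨t, h1, Finset.eq_of_subset_of_card_le h2 ?_⟩
  rw [List.toFinset_card_of_nodup h1, h3]

end

section
variable {W : Type} [DecidableEq W] [Fintype W]

/-- a polygon with distinct triangles all lying in `F` -/
def Good (F : Finset (Finset W)) (u v : W) (t : BinaryTree W) : Prop :=
  (tris u v t).Nodup ∧ ∀ s ∈ tris u v t, s ∈ F

/-- number of edges traversed an odd number of times -/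
def oddCard (u : W) (l : List W) : ℕ :=
  (Finset.univ.filter (fun f : Sym2 W => wsum u l f ≠ 0)).card

lemma zmod2_add_self (x : ZMod 2) : x + x = 0 := by revert x; decide

lemma polygon_of_fill (F : Finset (Finset W)) (hF : ∀ t ∈ F, t.card = 3) (u v : W) (huv : u ≠ v)
    (γ : Sym2 W → ZMod 2) (he : γ s(u, v) = 1)
    (simp' : ∀ C ⊆ F, (∀ f, γ f = 0 → bd C f = 0) → bd C s(u, v) = 0 → ∀ f, bd C f = 0)
    (S : Finset (Finset W)) (hS : S ⊆ F) (hγ : ∀ f, bd S f = γ f) :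
    ∃ t, Good F u v t ∧ t.numNodes ≤ S.card ∧
      (∀ f, bd (tris u v t).toFinset f = γ f) ∧
      ∀ f, wsum u (inord t ++ [v]) f = γ f + ind u v f := by
  classical
  obtain ⟨S', hS'm, hS'min⟩ := Finset.exists_min_image
    (F.powerset.filter (fun S => ∀ f, bd S f = γ f)) Finset.card
    ⟨S, by simp [hS]; exact hγ⟩
  simp only [Finset.mem_filter, Finset.mem_powerset] at hS'm hS'min
  obtain ⟨t, h1, h2⟩ := exists_polygon S' (fun t ht => hF t (hS'm.1 ht)) u v huv γ hS'm.2 he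
    (fun C hC => simp' C (hC.trans hS'm.1))
    (fun U hU hb => Finset.eq_of_subset_of_card_le hU (hS'min U ⟨hU.trans hS'm.1, hb⟩))
  have h3 : ∀ s ∈ tris u v t, s ∈ F := fun s hs => hS'm.1 (by
    rw [← h2]; exact List.mem_toFinset.mpr hs)
  refine ⟨t, ⟨h1, h3⟩, ?_, ?_, ?_⟩
  · rw [← length_tris u v t, ← List.toFinset_card_of_nodup h1, h2]
    exact hS'min S ⟨hS, hγ⟩
  · rw [h2]; exact hS'm.2
  · intro f
    have := bd_tris u v huv t (fun s hs => hF s (h3 s hs)) f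
    rw [← bd_toFinset _ h1, h2, hS'm.2] at this
    rw [this]
    generalize ind u v f = x
    generalize wsum u (inord t ++ [v]) f = y
    revert x y; decide

lemma exists_cut (T : SimpleGraph W) (hT : T.IsAcyclic) (f : Sym2 W) (hf : f ∈ T.edgeSet) :
    ∃ g : W → ZMod 2, ∀ a b, T.Adj a b → g a + g b = ind a b f := by
  classical
  induction f with
  | _ x y =>
  have hb := (SimpleGraph.isAcyclic_iff_forall_isBridge.mp hT) hf
  rw [SimpleGraph.isBridge_iff] at hb
  refine ⟨fun w => if (T.deleteEdges {s(x, y)}).Reachable x w then 1 else 0, ?_⟩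
  intro a b hab
  by_cases hEq : s(a, b) = s(x, y)
  · have hxx : (T.deleteEdges {s(x, y)}).Reachable x x := SimpleGraph.Reachable.refl _
    rcases Sym2.eq_iff.mp hEq with ⟨rfl, rfl⟩ | ⟨rfl, rfl⟩
    · simp [ind, hb]
    · beta_reduce
      rw [ind, if_pos hEq, if_neg hb, if_pos hxx, zero_add]
  · have hadj : (T.deleteEdges {s(x, y)}).Adj a b := by
      rw [SimpleGraph.deleteEdges_adj]; exact ⟨hab, by simpa using hEq⟩
    have hiff : (T.deleteEdges {s(x, y)}).Reachable x a ↔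
        (T.deleteEdges {s(x, y)}).Reachable x b :=
      ⟨fun h => h.trans hadj.reachable, fun h => h.trans hadj.symm.reachable⟩
    simp only [hiff, ind, hEq, if_false]
    exact zmod2_add_self _

open scoped Classical in
/-- the fundamental cycle -/
noncomputable def tau (T : SimpleGraph W) (g : Sym2 W → W → ZMod 2) (a b : W) (f : Sym2 W) :
    ZMod 2 := ind a b f + if f ∈ T.edgeSet then g f a + g f b else 0

/-- fillability of the fundamental cycle -/
def Fill (F : Finset (Finset W)) (T : SimpleGraph W) (g : Sym2 W → W → ZMod 2) (m : ℕ)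
    (a b : W) : Prop := ∃ S ⊆ F, S.card ≤ m ∧ ∀ f, bd S f = tau T g a b f

lemma tau_comm (T : SimpleGraph W) (g : Sym2 W → W → ZMod 2) (a b : W) (f : Sym2 W) :
    tau T g a b f = tau T g b a f := by
  unfold tau; rw [ind_comm, add_comm (g f a)]

lemma Fill.symm {F : Finset (Finset W)} {T : SimpleGraph W} {g : Sym2 W → W → ZMod 2} {m : ℕ}
    {a b : W} (h : Fill F T g m a b) : Fill F T g m b a := by
  obtain ⟨S, h1, h2, h3⟩ := h
  exact ⟨S, h1, h2, fun f => by rw [h3, tau_comm]⟩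

lemma tau_add (T : SimpleGraph W) (g : Sym2 W → W → ZMod 2) {a b c : W} (hab : a ≠ b)
    (hac : a ≠ c) (hbc : b ≠ c) (f : Sym2 W) :
    tau T g a c f + tau T g b c f + tau T g a b f = inc {a, b, c} f := by
  rw [inc_tri hab hac hbc, tau, tau, tau]
  generalize ind a b f = x; generalize ind a c f = y; generalize ind b c f = z
  split_ifs
  · generalize g f a = p; generalize g f b = q; generalize g f c = r
    revert x y z p q r; decide
  · revert x y z; decide

lemma Fill.of_adj (F : Finset (Finset W)) (T : SimpleGraph W) (g : Sym2 W → W → ZMod 2)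
    (hg : ∀ f ∈ T.edgeSet, ∀ a b, T.Adj a b → g f a + g f b = ind a b f) (m : ℕ) {a b : W}
    (hab : T.Adj a b) : Fill F T g m a b := by
  refine ⟨∅, by simp, by simp, fun f => ?_⟩
  simp only [bd, Finset.sum_empty, tau]
  by_cases hf : f ∈ T.edgeSet
  · rw [if_pos hf, hg f hf a b hab, zmod2_add_self]
  · rw [if_neg hf, add_zero, ind, if_neg]
    rintro rfl
    exact hf hab

lemma cut_walk (T : SimpleGraph W) (g : Sym2 W → W → ZMod 2)
    (hg : ∀ f ∈ T.edgeSet, ∀ a b, T.Adj a b → g f a + g f b = ind a b f)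
    {a b : W} (w : T.Walk a b) (f : Sym2 W) (hf : f ∈ T.edgeSet) (h : f ∉ w.edges) :
    g f a + g f b = 0 := by
  induction w with
  | nil => exact zmod2_add_self _
  | cons hadj w ih =>
    simp only [SimpleGraph.Walk.edges_cons, List.mem_cons, not_or] at h
    have h1 := ih h.2
    have h2 := hg f hf _ _ hadj
    rw [ind, if_neg (Ne.symm h.1)] at h2
    rename_i x y z
    clear ih h hf
    generalize g f x = p at *; generalize g f y = q at *; generalize g f z = r at *
    revert p q r; decide

lemma card_cut (T : SimpleGraph W) (hT : T.Connected) (g : Sym2 W → W → ZMod 2)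
    (hg : ∀ f ∈ T.edgeSet, ∀ a b, T.Adj a b → g f a + g f b = ind a b f) (a b : W)
    (φ : Sym2 W → ZMod 2) (hφ : ∀ f, φ f = tau T g a b f + ind a b f) :
    (Finset.univ.filter (fun f : Sym2 W => φ f ≠ 0)).card ≤ T.dist a b := by
  classical
  obtain ⟨w, hw⟩ := (hT a b).exists_walk_length_eq_dist
  rw [← hw, ← SimpleGraph.Walk.length_edges]
  refine le_trans (Finset.card_le_card (t := w.edges.toFinset) ?_) (List.toFinset_card_le _)
  intro f hf
  simp only [Finset.mem_filter, Finset.mem_univ, true_and, hφ, tau] at hf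
  rw [List.mem_toFinset]
  by_contra hn
  apply hf
  by_cases hfT : f ∈ T.edgeSet
  · rw [if_pos hfT, cut_walk T g hg w f hfT hn, add_zero, zmod2_add_self]
  · rw [if_neg hfT, add_zero, zmod2_add_self]

lemma fill_step (F : Finset (Finset W)) (hF : ∀ t ∈ F, t.card = 3) (T : SimpleGraph W)
    (hT : T.Connected) (g : Sym2 W → W → ZMod 2)
    (hg : ∀ f ∈ T.edgeSet, ∀ a b, T.Adj a b → g f a + g f b = ind a b f)
    (D L : ℕ) (hD : ∀ a b, T.dist a b ≤ D)
    (no2 : ∀ u v t, Good F u v t → L < t.numNodes → t.numNodes ≤ 2 * L + 1 →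
      oddCard u (inord t ++ [v]) ≤ D → False)
    {a b c : W} (hac : Fill F T g L a c) (hbc : Fill F T g L b c)
    (hΔ : {a, b, c} ∈ F) (hnab : ¬ T.Adj a b) : Fill F T g L a b := by
  obtain ⟨n1, n2, n3⟩ := card3 (hF _ hΔ)
  obtain ⟨S1, h11, h12, h13⟩ := hac
  obtain ⟨S2, h21, h22, h23⟩ := hbc
  have hcard : ∀ A B : Finset (Finset W), (symmDiff A B).card ≤ A.card + B.card := by
    intro A B
    refine (Finset.card_le_card (t := A ∪ B) ?_).trans (Finset.card_union_le _ _)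
    intro x hx
    rw [Finset.mem_symmDiff] at hx
    rw [Finset.mem_union]
    tauto
  have hsub : ∀ A B : Finset (Finset W), A ⊆ F → B ⊆ F → symmDiff A B ⊆ F := by
    intro A B hA hB x hx
    rw [Finset.mem_symmDiff] at hx
    rcases hx with hx | hx
    · exact hA hx.1
    · exact hB hx.1
  have hSb : ∀ f, bd (symmDiff (symmDiff S1 S2) {{a, b, c}}) f = tau T g a b f := by
    intro f
    rw [bd_symmDiff, bd_symmDiff, h13, h23]
    have : bd {{a, b, c}} f = inc {a, b, c} f := by simp [bd]
    rw [this, ← tau_add T g n1 n2 n3]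
    generalize tau T g a c f = x; generalize tau T g b c f = y; generalize tau T g a b f = z
    revert x y z; decide
  have hne : s(a, b) ∉ T.edgeSet := hnab
  obtain ⟨t, ht1, ht2, ht3, ht4⟩ := polygon_of_fill F hF a b n1 (tau T g a b)
    (by simp [tau, ind, hnab])
    (by
      intro C hC h0 h1 f
      have hsupp : ∀ f', bd C f' ≠ 0 → f' ∈ T.edgeSet := by
        intro f' hf'
        by_contra hcon
        by_cases hfe : s(a, b) = f'
        · rw [hfe] at h1; exact hf' h1
        · exact hf' (h0 f' (by simp only [tau, if_neg hcon, ind, if_neg hfe, add_zero]))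
      by_contra hf
      have hfT := hsupp f hf
      have hp := pairing C (fun t ht => hF t (hC ht)) (g f)
      have : ∑ f', bd C f' * cob (g f) f' = bd C f := by
        rw [Finset.sum_eq_single f]
        · induction f with
          | _ x y => rw [cob_mk, hg _ hfT x y hfT]; simp [ind]
        · intro f' _ hne
          by_cases hz : bd C f' = 0
          · rw [hz, zero_mul]
          · have hf'T := hsupp f' hz
            induction f' with
            | _ x y => rw [cob_mk, hg _ hfT x y hf'T]; simp [ind, hne]
        · simp
      exact hf (this.symm.trans hp))
    _ (hsub _ _ (hsub _ _ h11 h21) (by simpa using hΔ)) hSb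
  have hk : t.numNodes ≤ 2 * L + 1 := by
    refine ht2.trans ((hcard _ _).trans ?_)
    have := hcard S1 S2
    rw [Finset.card_singleton]; omega
  have hodd : oddCard a (inord t ++ [b]) ≤ D :=
    (card_cut T hT g hg a b _ ht4).trans (hD a b)
  have hL : t.numNodes ≤ L := by
    by_contra hcon
    exact no2 a b t ht1 (by omega) hk hodd
  refine ⟨(tris a b t).toFinset, fun s hs => ht1.2 s (List.mem_toFinset.mp hs), ?_, ht3⟩
  rw [List.toFinset_card_of_nodup ht1.1, length_tris]; exact hL

lemma fill_triple (F : Finset (Finset W)) (hF : ∀ t ∈ F, t.card = 3) (T : SimpleGraph W)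
    (g : Sym2 W → W → ZMod 2) (L : ℕ) (hall : ∀ a b, a ≠ b → Fill F T g L a b)
    (u v y : W) (huv : u ≠ v) (huy : u ≠ y) (hvy : v ≠ y) :
    ∃ t, Good F u v t ∧ t.numNodes ≤ 3 * L ∧
      ∀ f, wsum u (inord t ++ [v]) f = ind u y f + ind v y f := by
  obtain ⟨S1, h11, h12, h13⟩ := hall u y huy
  obtain ⟨S2, h21, h22, h23⟩ := hall v y hvy
  obtain ⟨S3, h31, h32, h33⟩ := hall u v huv
  have hcard : ∀ A B : Finset (Finset W), (symmDiff A B).card ≤ A.card + B.card := by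
    intro A B
    refine (Finset.card_le_card (t := A ∪ B) ?_).trans (Finset.card_union_le _ _)
    intro x hx
    rw [Finset.mem_symmDiff] at hx
    rw [Finset.mem_union]
    tauto
  have hsub : ∀ A B : Finset (Finset W), A ⊆ F → B ⊆ F → symmDiff A B ⊆ F := by
    intro A B hA hB x hx
    rw [Finset.mem_symmDiff] at hx
    rcases hx with hx | hx
    · exact hA hx.1
    · exact hB hx.1
  have e1 : s(u, y) ≠ s(u, v) := by simp [huv, huy, hvy, hvy.symm]
  have e2 : s(v, y) ≠ s(u, v) := by simp [huv, huv.symm, huy, hvy, hvy.symm, huy.symm]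
  have e3 : s(u, y) ≠ s(v, y) := by simp [huv, huv.symm, huy, hvy, hvy.symm, huy.symm]
  obtain ⟨t, ht1, ht2, ht3, ht4⟩ := polygon_of_fill F hF u v huv (inc {u, v, y})
    (by rw [inc_tri huv huy hvy]; simp [ind, e1, e2])
    (by
      intro C hC h0 h1 f
      have hsupp : ∀ f', f' ≠ s(u, y) → f' ≠ s(v, y) → bd C f' = 0 := by
        intro f' n1 n2
        by_cases n3 : f' = s(u, v)
        · rw [n3]; exact h1
        · apply h0
          rw [inc_tri huv huy hvy, ind, ind, ind, if_neg (Ne.symm n1), if_neg (Ne.symm n2),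
            if_neg (Ne.symm n3)]; rfl
      have hu : bd C s(u, y) = 0 := by
        have hp := pairing C (fun t ht => hF t (hC ht)) (fun w => if w = u then 1 else 0)
        rw [Finset.sum_eq_single s(u, y)] at hp
        · simpa [huy.symm] using hp
        · intro f' _ hne
          by_cases n2 : f' = s(v, y)
          · rw [n2]; simp [huv.symm, huy.symm]
          · rw [hsupp f' hne n2, zero_mul]
        · simp
      have hv : bd C s(v, y) = 0 := by
        have hp := pairing C (fun t ht => hF t (hC ht)) (fun w => if w = v then 1 else 0)
        rw [Finset.sum_eq_single s(v, y)] at hp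
        · simpa [hvy.symm] using hp
        · intro f' _ hne
          by_cases n2 : f' = s(u, y)
          · rw [n2]; simp [huv, hvy.symm]
          · rw [hsupp f' n2 hne, zero_mul]
        · simp
      by_cases n1 : f = s(u, y)
      · rw [n1, hu]
      · by_cases n2 : f = s(v, y)
        · rw [n2, hv]
        · exact hsupp f n1 n2)
    (symmDiff (symmDiff S1 S2) S3) (hsub _ _ (hsub _ _ h11 h21) h31) (by
      intro f
      rw [bd_symmDiff, bd_symmDiff, h13, h23, h33, tau_add T g huv huy hvy])
  refine ⟨t, ht1, ?_, ?_⟩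
  · refine ht2.trans ((hcard _ _).trans ?_)
    have := hcard S1 S2
    omega
  · intro f
    rw [ht4, inc_tri huv huy hvy]
    generalize ind u v f = a; generalize ind u y f = b; generalize ind v y f = c
    revert a b c; decide

end

/-- the deterministic dichotomy -/
theorem dichotomy {n : ℕ} (F : Finset {t : Finset (Fin n) // t.card = 3})
    (T : SimpleGraph (Fin n)) (hT : T.IsTree) (D L : ℕ) (hD : ∀ a b, T.dist a b ≤ D)
    (steps : List (Fin n × Fin n × Fin n)) (hsteps : IsValidTriadicProcess F T steps)
    (htop : afterGraph T steps = ⊤) (F' : Finset (Finset (Fin n)))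
    (hF' : F' = F.map ⟨Subtype.val, Subtype.val_injective⟩) :
    (∃ u v t, Good F' u v t ∧ L < t.numNodes ∧ t.numNodes ≤ 2 * L + 1 ∧
      oddCard u (inord t ++ [v]) ≤ D) ∨
    (∀ u v y : Fin n, u ≠ v → u ≠ y → v ≠ y → ∃ t, Good F' u v t ∧ t.numNodes ≤ 3 * L ∧
      ∀ f, wsum u (inord t ++ [v]) f = ind u y f + ind v y f) := by
  classical
  by_cases no2 : ∃ u v t, Good F' u v t ∧ L < t.numNodes ∧ t.numNodes ≤ 2 * L + 1 ∧
      oddCard u (inord t ++ [v]) ≤ D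
  · exact Or.inl no2
  right
  have hF3 : ∀ t ∈ F', t.card = 3 := by
    intro t ht
    rw [hF', Finset.mem_map] at ht
    obtain ⟨s, _, rfl⟩ := ht
    exact s.2
  have hcut : ∀ f : Sym2 (Fin n), ∃ g : Fin n → ZMod 2, f ∈ T.edgeSet →
      ∀ a b, T.Adj a b → g a + g b = ind a b f := by
    intro f
    by_cases hf : f ∈ T.edgeSet
    · obtain ⟨g, hg⟩ := exists_cut T hT.isAcyclic f hf
      exact ⟨g, fun _ => hg⟩
    · exact ⟨0, fun h => absurd h hf⟩
  choose g hg using hcut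
  have hall : ∀ i, i ≤ steps.length → ∀ a b, (afterGraph T (steps.take i)).Adj a b →
      Fill F' T g L a b := by
    intro i
    induction i with
    | zero =>
      intro _ a b hab
      simp only [afterGraph, List.take_zero, List.not_mem_nil, false_and, exists_false,
        Set.setOf_false, SimpleGraph.fromEdgeSet_empty, sup_bot_eq] at hab
      exact Fill.of_adj F' T g hg L hab
    | succ i ih =>
      intro hi a b hab
      have ih := ih (by omega)
      obtain ⟨h1, h2, h3, t, htF, ht⟩ := hsteps i (by omega)
      set st := steps.get ⟨i, by omega⟩ with hst
      have hΔ : ({st.1, st.2.1, st.2.2} : Finset (Fin n)) ∈ F' := by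
        rw [hF', Finset.mem_map]
        exact ⟨t, htF, ht⟩
      have hnT : ¬ T.Adj st.1 st.2.1 := fun h => h1 (by
        rw [afterGraph, SimpleGraph.sup_adj]; exact Or.inl h)
      have hnew := fill_step F' hF3 T hT.connected g hg D L hD
        (fun u v t a b c d => no2 ⟨u, v, t, a, b, c, d⟩) (ih _ _ h2) (ih _ _ h3) hΔ hnT
      have htake : steps.take (i + 1) = steps.take i ++ [st] := by
        rw [List.take_succ_eq_append_getElem (by omega)]; rfl
      rw [htake, afterGraph, SimpleGraph.sup_adj, SimpleGraph.fromEdgeSet_adj] at hab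
      rcases hab with hab | ⟨⟨st', hst', hmem⟩, hne⟩
      · exact Fill.of_adj F' T g hg L hab
      · rcases List.mem_append.mp hst' with hst' | hst'
        · apply ih
          rw [afterGraph, SimpleGraph.sup_adj, SimpleGraph.fromEdgeSet_adj]
          exact Or.inr ⟨⟨st', hst', hmem⟩, hne⟩
        · rw [List.mem_singleton] at hst'
          subst hst'
          simp only [triEdges, Set.mem_insert_iff, Set.mem_singleton_iff, Sym2.eq_iff] at hmem
          rcases hmem with (⟨e1, e2⟩ | ⟨e1, e2⟩) | (⟨e1, e2⟩ | ⟨e1, e2⟩) | (⟨e1, e2⟩ | ⟨e1, e2⟩)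
          · rw [e1, e2]; exact hnew
          · rw [e1, e2]; exact hnew.symm
          · rw [e1, e2]; exact ih _ _ h2
          · rw [e1, e2]; exact (ih _ _ h2).symm
          · rw [e1, e2]; exact ih _ _ h3
          · rw [e1, e2]; exact (ih _ _ h3).symm
  intro u v y huv huy hvy
  refine fill_triple F' hF3 T g L ?_ u v y huv huy hvy
  intro a b hab
  refine hall steps.length le_rfl a b ?_
  rw [List.take_length, htop]
  exact hab


section
variable {W : Type} [DecidableEq W] [Fintype W]

/-! ### Counting walks -/

/-- toggle an edge -/
def stp (O : Finset (Sym2 W)) (u v : W) : Finset (Sym2 W) :=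
  if u = v then O else if s(u, v) ∈ O then O.erase s(u, v) else insert s(u, v) O

/-- the set of edges traversed an odd number of times after a walk -/
def run (O : Finset (Sym2 W)) : W → List W → Finset (Sym2 W)
  | _, [] => O
  | u, v :: l => run (stp O u v) v l

/-- the last vertex of a walk -/
def lastv : W → List W → W
  | u, [] => u
  | _, v :: l => lastv v l

lemma mem_run (O : Finset (Sym2 W)) (u : W) (l : List W) (f : Sym2 W) :
    (if f ∈ run O u l then (1 : ZMod 2) else 0) = (if f ∈ O then 1 else 0) + wsum u l f := by
  induction l generalizing O u with
  | nil =>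
    rw [wsum, add_zero]
    by_cases h : f ∈ O
    · rw [if_pos h, if_pos (by simpa [run] using h)]
    · rw [if_neg h, if_neg (by simpa [run] using h)]
  | cons v l ih =>
    rw [run, ih, wsum, ← add_assoc]
    congr 1
    unfold stp ind0 ind
    by_cases huv : u = v
    · simp [huv]
    · by_cases hm : s(u, v) ∈ O
      · by_cases hf : s(u, v) = f
        · subst hf; simp [huv, hm]; decide
        · simp [huv, hm, hf, Ne.symm hf]
      · by_cases hf : s(u, v) = f
        · subst hf; simp [huv, hm]
        · simp [huv, hm, hf, Ne.symm hf]

lemma card_run (u : W) (l : List W) : (run ∅ u l).card = oddCard u l := by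
  unfold oddCard
  congr 1
  ext f
  have := mem_run ∅ u l f
  simp only [Finset.notMem_empty, if_false, zero_add] at this
  simp only [Finset.mem_filter, Finset.mem_univ, true_and, ← this]
  by_cases h : f ∈ run ∅ u l <;> simp [h]

/-- degree -/
def dg (O : Finset (Sym2 W)) (v : W) : ℕ :=
  (Finset.univ.filter (fun x => x ≠ v ∧ s(v, x) ∈ O)).card

/-- corrected degree -/
def M (r : W) (O : Finset (Sym2 W)) (u v : W) : ℕ :=
  dg O v + (if v = r then 1 else 0) + (if v = u then 1 else 0)

/-- double factorials -/
def hh : ℕ → ℕ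
  | 0 => 1
  | 1 => 1
  | m + 2 => (m + 1) * hh m

lemma hh_pos : ∀ m, 0 < hh m
  | 0 => by simp [hh]
  | 1 => by simp [hh]
  | m + 2 => by have := hh_pos m; simp only [hh]; positivity

/-- the potential -/
noncomputable def Z (r : W) (s : ℝ) (O : Finset (Sym2 W)) (u : W) : ℝ :=
  s ^ O.card * ∏ v, (hh (M r O u v) : ℝ)

lemma dg_insert (O : Finset (Sym2 W)) {u v : W} (huv : u ≠ v) (hm : s(u, v) ∉ O) (w : W) :
    dg (insert s(u, v) O) w = dg O w + (if w = u then 1 else 0) + (if w = v then 1 else 0) := by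
  unfold dg
  by_cases hwu : w = u
  · subst hwu
    rw [if_pos rfl, if_neg huv, add_zero]
    rw [← Finset.card_insert_of_notMem (a := v) (by simp [hm])]
    congr 1
    ext x
    simp only [Finset.mem_filter, Finset.mem_univ, true_and, Finset.mem_insert, Sym2.eq_iff]
    constructor
    · rintro ⟨h1, (⟨_, rfl⟩ | ⟨rfl, rfl⟩) | h2⟩
      · exact Or.inl rfl
      · exact Or.inl rfl
      · exact Or.inr ⟨h1, h2⟩
    · rintro (rfl | ⟨h1, h2⟩)
      · exact ⟨huv.symm, by simp⟩
      · exact ⟨h1, Or.inr h2⟩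
  · by_cases hwv : w = v
    · subst hwv
      rw [if_pos rfl, if_neg hwu, add_zero]
      rw [← Finset.card_insert_of_notMem (a := u) (by rw [Sym2.eq_swap] at hm; simp [hm])]
      congr 1
      ext x
      simp only [Finset.mem_filter, Finset.mem_univ, true_and, Finset.mem_insert, Sym2.eq_iff]
      constructor
      · rintro ⟨h1, (⟨h3, rfl⟩ | ⟨_, rfl⟩) | h2⟩
        · exact absurd rfl h1
        · exact Or.inl rfl
        · exact Or.inr ⟨h1, h2⟩
      · rintro (rfl | ⟨h1, h2⟩)
        · exact ⟨huv, by simp⟩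
        · exact ⟨h1, Or.inr h2⟩
    · rw [if_neg hwu, if_neg hwv, add_zero, add_zero]
      congr 1
      ext x
      simp [hwu, hwv]

lemma M_insert (r : W) (O : Finset (Sym2 W)) {u v : W} (huv : u ≠ v) (hm : s(u, v) ∉ O) (w : W) :
    M r (insert s(u, v) O) v w = M r O u w + if w = v then 2 else 0 := by
  unfold M
  rw [dg_insert O huv hm]
  split_ifs <;> omega

lemma M_erase (r : W) (O : Finset (Sym2 W)) {u v : W} (huv : u ≠ v) (hm : s(u, v) ∈ O) (w : W) :
    M r O u w = M r (O.erase s(u, v)) v w + if w = u then 2 else 0 := by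
  unfold M
  have := dg_insert (O.erase s(u, v)) huv (by simp) w
  rw [Finset.insert_erase hm] at this
  rw [this]
  split_ifs <;> omega

lemma prod_hh (m m' : W → ℕ) (v : W) (h : ∀ w, m' w = m w + if w = v then 2 else 0) :
    ∏ w, (hh (m' w) : ℝ) = (m v + 1) * ∏ w, (hh (m w) : ℝ) := by
  rw [← Finset.mul_prod_erase Finset.univ _ (Finset.mem_univ v),
    ← Finset.mul_prod_erase Finset.univ (fun w => (hh (m w) : ℝ)) (Finset.mem_univ v), h v,
    if_pos rfl, hh, ← mul_assoc]
  push_cast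
  congr 1
  refine Finset.prod_congr rfl fun w hw => ?_
  rw [h w, if_neg (Finset.ne_of_mem_erase hw), add_zero]

lemma Z_pos (r : W) {s : ℝ} (hs : 0 < s) (O : Finset (Sym2 W)) (u : W) : 0 < Z r s O u := by
  unfold Z
  refine mul_pos (pow_pos hs _) (Finset.prod_pos fun v _ => ?_)
  exact_mod_cast hh_pos _

lemma le_Z (r : W) {s : ℝ} (hs : 0 < s) (O : Finset (Sym2 W)) (u : W) : s ^ O.card ≤ Z r s O u := by
  unfold Z
  refine le_mul_of_one_le_right (pow_pos hs _).le ?_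
  have : (1 : ℕ) ≤ ∏ v, hh (M r O u v) :=
    Finset.one_le_prod' fun v _ => hh_pos _
  exact_mod_cast this

lemma Z_open (r : W) (s : ℝ) (O : Finset (Sym2 W)) {u v : W} (huv : u ≠ v) (hm : s(u, v) ∉ O) :
    Z r s (insert s(u, v) O) v = s * (M r O u v + 1) * Z r s O u := by
  unfold Z
  rw [prod_hh _ _ v (M_insert r O huv hm), Finset.card_insert_of_notMem hm, pow_succ]
  ring

lemma Z_close (r : W) {s : ℝ} (hs : 0 < s) (O : Finset (Sym2 W)) {u v : W} (huv : u ≠ v)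
    (hm : s(u, v) ∈ O) :
    Z r s (O.erase s(u, v)) v ≤ Z r s O u * s⁻¹ * (dg O u : ℝ)⁻¹ := by
  have h1 : 0 < dg O u := by
    unfold dg
    exact Finset.card_pos.mpr ⟨v, by simp [hm, huv.symm]⟩
  have h2 : dg O u ≤ M r (O.erase s(u, v)) v u + 1 := by
    have := M_erase r O huv hm u
    rw [if_pos rfl] at this
    unfold M at this ⊢
    rw [if_pos rfl] at this
    omega
  have hZ : Z r s O u = s * (M r (O.erase s(u, v)) v u + 1) * Z r s (O.erase s(u, v)) v := by
    unfold Z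
    rw [prod_hh _ _ u (M_erase r O huv hm)]
    nth_rewrite 1 [← Finset.insert_erase hm]
    rw [Finset.card_insert_of_notMem (by simp), pow_succ]
    ring
  have hpos := Z_pos r hs (O.erase s(u, v)) v
  have h1' : (0 : ℝ) < dg O u := by exact_mod_cast h1
  have h2' : (dg O u : ℝ) ≤ M r (O.erase s(u, v)) v u + 1 := by exact_mod_cast h2
  rw [hZ, ← div_eq_mul_inv, le_div_iff₀ h1']
  rw [show s * ((M r (O.erase s(u, v)) v u : ℝ) + 1) * Z r s (O.erase s(u, v)) v * s⁻¹ =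
    Z r s (O.erase s(u, v)) v * ((M r (O.erase s(u, v)) v u : ℝ) + 1) by field_simp]
  exact mul_le_mul_of_nonneg_left h2' hpos.le

lemma Z_step (r : W) {s : ℝ} (hs : 0 < s) (O : Finset (Sym2 W)) (u : W) :
    ∑ v, Z r s (stp O u v) v ≤
      (1 + s * (Fintype.card W + ∑ v, (M r O u v : ℝ)) + s⁻¹) * Z r s O u := by
  have hZ := Z_pos r hs O u
  have hterm : ∀ v, Z r s (stp O u v) v ≤ (if v = u then Z r s O u else 0)
      + s * (M r O u v + 1) * Z r s O u
      + (if v ≠ u ∧ s(u, v) ∈ O then Z r s O u * s⁻¹ * (dg O u : ℝ)⁻¹ else 0) := by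
    intro v
    have p1 : 0 ≤ s * (M r O u v + 1) * Z r s O u := by positivity
    have p2 : 0 ≤ Z r s O u * s⁻¹ * (dg O u : ℝ)⁻¹ := by positivity
    unfold stp
    by_cases huv : u = v
    · subst huv
      simp only [if_true, ne_eq, not_true, false_and, if_false, add_zero]
      linarith
    · rw [if_neg huv, if_neg (Ne.symm huv)]
      by_cases hm : s(u, v) ∈ O
      · rw [if_pos hm, if_pos ⟨Ne.symm huv, hm⟩]
        have := Z_close r hs O huv hm
        linarith
      · rw [if_neg hm, if_neg (fun h => hm h.2), Z_open r s O huv hm]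
        linarith
  refine (Finset.sum_le_sum fun v _ => hterm v).trans ?_
  rw [Finset.sum_add_distrib, Finset.sum_add_distrib, ← Finset.sum_filter, ← Finset.sum_filter,
    Finset.sum_const, Finset.sum_const]
  have hd : (Finset.univ.filter (fun x => x ≠ u ∧ s(u, x) ∈ O)).card = dg O u := rfl
  rw [hd]
  have h1 : (Finset.univ.filter (fun x => x = u)).card = 1 := by
    rw [Finset.filter_eq']; simp
  rw [h1, ← Finset.sum_mul, ← Finset.mul_sum, Finset.sum_add_distrib, Finset.sum_const,
    Finset.card_univ]
  simp only [nsmul_eq_mul, Nat.cast_one, one_mul, mul_one]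
  have h2 : (dg O u : ℝ) * (Z r s O u * s⁻¹ * (dg O u : ℝ)⁻¹) ≤ s⁻¹ * Z r s O u := by
    by_cases h0 : (dg O u : ℝ) = 0
    · rw [h0]; simp; positivity
    · apply le_of_eq; field_simp
  nlinarith

lemma sum_M_stp (r : W) (O : Finset (Sym2 W)) (u v : W) :
    ∑ w, M r (stp O u v) v w ≤ ∑ w, M r O u w + 2 := by
  unfold stp
  by_cases huv : u = v
  · subst huv; simp
  · rw [if_neg huv]
    by_cases hm : s(u, v) ∈ O
    · rw [if_pos hm]
      have : ∑ w, M r (O.erase s(u, v)) v w ≤ ∑ w, M r O u w :=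
        Finset.sum_le_sum fun w _ => by rw [M_erase r O huv hm w]; omega
      omega
    · rw [if_neg hm]
      simp_rw [M_insert r O huv hm]
      rw [Finset.sum_add_distrib]
      simp

/-- all lists of a given length -/
def lists (W : Type) [DecidableEq W] [Fintype W] : ℕ → Finset (List W)
  | 0 => {[]}
  | j + 1 => (Finset.univ ×ˢ lists W j).image (fun p : W × List W => p.1 :: p.2)

lemma mem_lists (j : ℕ) (l : List W) : l ∈ lists W j ↔ l.length = j := by
  induction j generalizing l with
  | zero => simp [lists]
  | succ j ih =>
    cases l with
    | nil => simp [lists]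
    | cons a l => simp [lists, ih]

lemma sum_lists (j : ℕ) (φ : List W → ℝ) :
    ∑ l ∈ lists W (j + 1), φ l = ∑ v, ∑ l ∈ lists W j, φ (v :: l) := by
  rw [lists, Finset.sum_image, Finset.sum_product]
  rintro ⟨a, l⟩ _ ⟨b, m⟩ _ h
  simpa using h

lemma walk_sum (r : W) {s : ℝ} (hs : 0 < s) (B : ℕ) (j : ℕ) :
    ∀ (O : Finset (Sym2 W)) (u : W), (∑ w, M r O u w) + 2 * j ≤ B →
    ∑ l ∈ lists W j, Z r s (run O u l) (lastv u l) ≤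
      (1 + s * (Fintype.card W + B) + s⁻¹) ^ j * Z r s O u := by
  induction j with
  | zero => intro O u _; simp [lists, run, lastv]
  | succ j ih =>
    intro O u hB
    set K := (1 + s * ((Fintype.card W : ℝ) + B) + s⁻¹) with hK
    have hK0 : 0 ≤ K := by positivity
    rw [sum_lists]
    simp only [run, lastv]
    calc ∑ v, ∑ l ∈ lists W j, Z r s (run (stp O u v) v l) (lastv v l)
        ≤ ∑ v, K ^ j * Z r s (stp O u v) v := by
          refine Finset.sum_le_sum fun v _ => ih _ _ ?_
          have := sum_M_stp r O u v
          omega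
      _ = K ^ j * ∑ v, Z r s (stp O u v) v := by rw [Finset.mul_sum]
      _ ≤ K ^ j * (K * Z r s O u) := by
          refine mul_le_mul_of_nonneg_left ((Z_step r hs O u).trans ?_) (pow_nonneg hK0 _)
          refine mul_le_mul_of_nonneg_right ?_ (Z_pos r hs O u).le
          have : (∑ v, (M r O u v : ℝ)) ≤ B := by
            have h : ∑ v, M r O u v ≤ B := by omega
            exact_mod_cast h
          rw [hK]
          have := mul_le_mul_of_nonneg_left this hs.le
          nlinarith
      _ = K ^ (j + 1) * Z r s O u := by rw [pow_succ]; ring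

lemma walk_count (r : W) {s : ℝ} (hs : 0 < s) (hs1 : s ≤ 1) (j D : ℕ) :
    (((lists W j).filter (fun l => oddCard r l ≤ D)).card : ℝ) * s ^ D ≤
      (1 + s * (Fintype.card W + (2 + 2 * j)) + s⁻¹) ^ j := by
  have hdg : ∀ w : W, dg ∅ w = 0 := by intro w; simp [dg]
  have hM : ∑ w, M r ∅ r w = 2 := by
    simp [M, hdg, Finset.sum_add_distrib]
  have hZ0 : Z r s ∅ r = 1 := by
    unfold Z
    rw [Finset.card_empty, pow_zero, one_mul]
    refine Finset.prod_eq_one fun w _ => ?_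
    unfold M
    rw [hdg]
    by_cases h : w = r <;> simp [h, hh]
  have := walk_sum r hs (2 + 2 * j) j ∅ r (by rw [hM])
  rw [hZ0, mul_one] at this
  push_cast at this
  refine le_trans ?_ this
  rw [← nsmul_eq_mul, ← Finset.sum_const]
  refine (Finset.sum_le_sum ?_).trans (Finset.sum_le_sum_of_subset_of_nonneg
    (Finset.filter_subset (fun l => oddCard r l ≤ D) _) fun l _ _ => (Z_pos r hs _ _).le)
  intro l hl
  rw [Finset.mem_filter] at hl
  refine le_trans ?_ (le_Z r hs _ _)
  rw [card_run]
  exact pow_le_pow_of_le_one hs.le hs1 hl.2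

/-! ### Counting polygons -/

lemma tree_inj : ∀ (t t' : BinaryTree W), t.map (fun _ => ()) = t'.map (fun _ => ()) →
    inord t = inord t' → t = t'
  | .nil, .nil, _, _ => rfl
  | .nil, .node _ _ _, h, _ => by simp [BinaryTree.map] at h
  | .node _ _ _, .nil, h, _ => by simp [BinaryTree.map] at h
  | .node x l r, .node x' l' r', h, h' => by
    simp only [BinaryTree.map, BinaryTree.node.injEq, true_and] at h
    have hn : ∀ t : BinaryTree W, (t.map (fun _ => ())).numNodes = t.numNodes := by
      intro t
      induction t with
      | nil => rfl
      | node a b c hb hc => simp [BinaryTree.map, hb, hc]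
    have hlen : (inord l).length = (inord l').length := by
      rw [length_inord, length_inord, ← hn, h.1, hn]
    simp only [inord] at h'
    obtain ⟨h1, h2⟩ := List.append_inj h' hlen
    rw [List.cons.injEq] at h2
    rw [tree_inj l l' h.1 h1, tree_inj r r' h.2 h2.2, h2.1]

lemma numNodes_map (t : BinaryTree W) : (t.map (fun _ => ())).numNodes = t.numNodes := by
  induction t with
  | nil => rfl
  | node a b c hb hc => simp [BinaryTree.map, hb, hc]

/-- encoding of polygons -/
def enc (p : BinaryTree W × W) : BinaryTree Unit × List W :=
  (p.1.map (fun _ => ()), inord p.1 ++ [p.2])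

lemma enc_inj : Function.Injective (enc (W := W)) := by
  rintro ⟨t, v⟩ ⟨t', v'⟩ h
  simp only [enc, Prod.mk.injEq] at h
  obtain ⟨h1, h2⟩ := h
  have h3 := List.append_inj' h2 rfl
  rw [tree_inj t t' h1 h3.1]
  simpa using h3.2

/-- polygons with `k` triangles rooted at `u` -/
noncomputable def polys (u : W) (k D : ℕ) : Finset (BinaryTree W × W) :=
  (BinaryTree.treesOfNumNodesEq k ×ˢ
    (lists W (k + 1)).filter (fun l => oddCard u l ≤ D)).preimage enc enc_inj.injOn

lemma mem_polys (u : W) (k D : ℕ) (t : BinaryTree W) (v : W) :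
    (t, v) ∈ polys u k D ↔ t.numNodes = k ∧ oddCard u (inord t ++ [v]) ≤ D := by
  simp only [polys, Finset.mem_preimage, enc, Finset.mem_product, Finset.mem_filter, mem_lists,
    BinaryTree.mem_treesOfNumNodesEq, numNodes_map, List.length_append, length_inord,
    List.length_singleton]
  constructor
  · rintro ⟨h1, h2, h3⟩; exact ⟨h1, h3⟩
  · rintro ⟨h1, h3⟩; exact ⟨h1, by omega, h3⟩

lemma card_polys (u : W) (k D : ℕ) (R : ℝ) (hR : 1 ≤ R) (hRn : R ^ 2 = Fintype.card W)
    (hk : 2 + 2 * ((k : ℝ) + 1) + R ≤ R ^ 2 / 2) :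
    ((polys u k D).card : ℝ) ≤ 4 ^ k * R ^ D * (5 / 2 * R) ^ (k + 1) := by
  have hR0 : 0 < R := by linarith
  have h1 : (polys u k D).card ≤ (BinaryTree.treesOfNumNodesEq k ×ˢ
      (lists W (k + 1)).filter (fun l => oddCard u l ≤ D)).card := by
    refine Finset.card_le_card_of_injOn enc ?_ enc_inj.injOn
    intro p hp
    exact Finset.mem_preimage.mp hp
  rw [Finset.card_product, BinaryTree.treesOfNumNodesEq_card_eq_catalan] at h1
  have hcat : catalan k ≤ 4 ^ k := by
    rw [catalan_eq_centralBinom_div]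
    exact (Nat.div_le_self _ _).trans (Nat.centralBinom_le_four_pow k)
  have h2 := walk_count u (s := R⁻¹) (by positivity) (inv_le_one_of_one_le₀ hR) (k + 1) D
  rw [← hRn, inv_inv, inv_pow, ← div_eq_mul_inv, div_le_iff₀ (by positivity)] at h2
  have hK : (1 + R⁻¹ * (R ^ 2 + (2 + 2 * ((k + 1 : ℕ) : ℝ))) + R) ≤ 5 / 2 * R := by
    have : R⁻¹ * (2 + 2 * ((k : ℝ) + 1) + R) ≤ R⁻¹ * (R ^ 2 / 2) :=
      mul_le_mul_of_nonneg_left hk (by positivity)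
    have e1 : R⁻¹ * (R ^ 2 / 2) = R / 2 := by field_simp
    have e2 : R⁻¹ * (2 + 2 * ((k : ℝ) + 1) + R) = R⁻¹ * (2 + 2 * ((k : ℝ) + 1)) + 1 := by
      field_simp
    have e3 : R⁻¹ * (R ^ 2 + (2 + 2 * ((k + 1 : ℕ) : ℝ))) = R + R⁻¹ * (2 + 2 * ((k : ℝ) + 1)) := by
      push_cast; field_simp
    rw [e3]; linarith
  have h3 : ((((lists W (k + 1)).filter (fun l => oddCard u l ≤ D)).card : ℕ) : ℝ) ≤
      (5 / 2 * R) ^ (k + 1) * R ^ D := by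
    refine h2.trans (mul_le_mul_of_nonneg_right ?_ (by positivity))
    exact pow_le_pow_left₀ (by positivity) hK _
  calc ((polys u k D).card : ℝ)
      ≤ (catalan k : ℝ) * (((lists W (k + 1)).filter (fun l => oddCard u l ≤ D)).card : ℕ) := by
        exact_mod_cast h1
    _ ≤ 4 ^ k * ((5 / 2 * R) ^ (k + 1) * R ^ D) := by
        refine mul_le_mul ?_ h3 (by positivity) (by positivity)
        exact_mod_cast hcat
    _ = _ := by ring

end


/-! ### Probability estimates -/

/-- the weight of a complex -/
noncomputable def wt (n : ℕ) (p : ℝ) (F : Finset {t : Finset (Fin n) // t.card = 3}) : ℝ :=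
  p ^ F.card * (1 - p) ^ (n.choose 3 - F.card)

/-- underlying family of triangles -/
def und {n : ℕ} (F : Finset {t : Finset (Fin n) // t.card = 3}) : Finset (Finset (Fin n)) :=
  F.map ⟨Subtype.val, Subtype.val_injective⟩

lemma card_tri (n : ℕ) : Fintype.card {t : Finset (Fin n) // t.card = 3} = n.choose 3 := by
  rw [Fintype.card_finset_len, Fintype.card_fin]

lemma wt_nonneg {n : ℕ} {p : ℝ} (h0 : 0 ≤ p) (h1 : p ≤ 1)
    (F : Finset {t : Finset (Fin n) // t.card = 3}) : 0 ≤ wt n p F := by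
  have : 0 ≤ 1 - p := by linarith
  unfold wt; positivity

lemma sum_wt_subset {n : ℕ} (p : ℝ) (U : Finset {t : Finset (Fin n) // t.card = 3}) :
    (∑ F : Finset {t : Finset (Fin n) // t.card = 3}, if U ⊆ F then wt n p F else 0)
      = p ^ U.card := by
  have h := Finset.prod_add (fun _ : {t : Finset (Fin n) // t.card = 3} => p)
    (fun i => if i ∈ U then 0 else 1 - p) Finset.univ
  rw [Finset.powerset_univ] at h
  have e1 : ∏ i : {t : Finset (Fin n) // t.card = 3}, (p + if i ∈ U then 0 else 1 - p)
      = p ^ U.card := by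
    have : ∀ i : {t : Finset (Fin n) // t.card = 3}, (p + if i ∈ U then 0 else 1 - p)
        = if i ∈ U then p else 1 := by
      intro i; split_ifs <;> ring
    simp [this]
  rw [← e1, h]
  refine Finset.sum_congr rfl fun F _ => ?_
  rw [Finset.prod_const]
  split_ifs with hU
  · unfold wt
    congr 1
    have : ∀ i ∈ Finset.univ \ F, (if i ∈ U then (0 : ℝ) else 1 - p) = 1 - p := by
      intro i hi
      rw [if_neg]
      intro hiU
      exact (Finset.mem_sdiff.mp hi).2 (hU hiU)
    rw [Finset.prod_congr rfl this, Finset.prod_const, ← Finset.compl_eq_univ_sdiff,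
      Finset.card_compl, card_tri]
  · rw [Finset.not_subset] at hU
    obtain ⟨i, hi, hiF⟩ := hU
    rw [Finset.prod_eq_zero (i := i) (by simp [hiF]) (by simp [hi]), mul_zero]

lemma sum_wt {n : ℕ} (p : ℝ) :
    (∑ F : Finset {t : Finset (Fin n) // t.card = 3}, wt n p F) = 1 := by
  have := sum_wt_subset (n := n) p ∅
  simpa using this

open scoped Classical in
lemma sum_wt_good {n : ℕ} {p : ℝ} (h0 : 0 ≤ p) (h1 : p ≤ 1) (u v : Fin n)
    (t : BinaryTree (Fin n)) :
    (∑ F : Finset {t : Finset (Fin n) // t.card = 3},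
      if Good (und F) u v t then wt n p F else 0) ≤ p ^ t.numNodes := by
  by_cases hex : ∃ F : Finset {t : Finset (Fin n) // t.card = 3}, Good (und F) u v t
  · obtain ⟨F0, hnd, hF0⟩ := hex
    have h3 : ∀ s ∈ tris u v t, s.card = 3 := by
      intro s hs
      have := hF0 s hs
      simp only [und, Finset.mem_map, Function.Embedding.coeFn_mk] at this
      obtain ⟨a, _, rfl⟩ := this
      exact a.2
    set U : Finset {t : Finset (Fin n) // t.card = 3} :=
      Finset.univ.filter (fun s => s.1 ∈ tris u v t) with hU
    have hUc : U.card = t.numNodes := by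
      rw [← length_tris u v t, ← List.toFinset_card_of_nodup hnd]
      rw [← Finset.card_map ⟨Subtype.val, Subtype.val_injective⟩]
      congr 1
      ext s
      simp only [hU, Finset.mem_map, Finset.mem_filter, Finset.mem_univ, true_and,
        Function.Embedding.coeFn_mk, List.mem_toFinset]
      constructor
      · rintro ⟨a, ha, rfl⟩; exact ha
      · intro hs; exact ⟨⟨s, h3 s hs⟩, hs, rfl⟩
    rw [← hUc, ← sum_wt_subset p U]
    refine Finset.sum_le_sum fun F _ => ?_
    by_cases hg : Good (und F) u v t
    · rw [if_pos hg, if_pos]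
      intro s hs
      have h4 := hg.2 s.1 (Finset.mem_filter.mp hs).2
      simp only [und, Finset.mem_map, Function.Embedding.coeFn_mk] at h4
      obtain ⟨a, ha, has⟩ := h4
      rwa [← Subtype.ext has]
    · rw [if_neg hg]
      split_ifs
      · exact wt_nonneg h0 h1 F
      · exact le_refl _
  · push Not at hex
    simp only [hex, if_false, Finset.sum_const_zero]
    positivity

open scoped Classical in
/-- number of good polygons with at most `D` odd edges -/
noncomputable def cnt {n : ℕ} (F : Finset {t : Finset (Fin n) // t.card = 3}) (u : Fin n)
    (S : Finset ℕ) (D : ℕ) : ℝ :=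
  ∑ k ∈ S, ∑ q ∈ polys u k D, if Good (und F) u q.2 q.1 then 1 else 0

lemma cnt_nonneg {n : ℕ} (F : Finset {t : Finset (Fin n) // t.card = 3}) (u : Fin n)
    (S : Finset ℕ) (D : ℕ) : 0 ≤ cnt F u S D := by
  unfold cnt
  exact Finset.sum_nonneg fun _ _ => Finset.sum_nonneg fun _ _ => by split_ifs <;> norm_num

lemma exp_cnt {n : ℕ} {p : ℝ} (h0 : 0 ≤ p) (h1 : p ≤ 1) (u : Fin n) (S : Finset ℕ) (D : ℕ) :
    (∑ F : Finset {t : Finset (Fin n) // t.card = 3}, wt n p F * cnt F u S D)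
      ≤ ∑ k ∈ S, ((polys u k D).card : ℝ) * p ^ k := by
  classical
  unfold cnt
  simp_rw [Finset.mul_sum]
  rw [Finset.sum_comm]
  refine Finset.sum_le_sum fun k _ => ?_
  rw [Finset.sum_comm, ← nsmul_eq_mul]
  refine Finset.sum_le_card_nsmul _ _ _ fun q hq => ?_
  have hk := ((mem_polys u k D q.1 q.2).mp hq).1
  refine le_trans (le_of_eq ?_) (hk ▸ sum_wt_good h0 h1 u q.2 q.1)
  refine Finset.sum_congr rfl fun F _ => ?_
  split_ifs <;> simp

lemma cnt_ge_one {n : ℕ} (F : Finset {t : Finset (Fin n) // t.card = 3}) (u v : Fin n)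
    (S : Finset ℕ) (D : ℕ) (t : BinaryTree (Fin n)) (hg : Good (und F) u v t)
    (hS : t.numNodes ∈ S) (hD : oddCard u (inord t ++ [v]) ≤ D) : 1 ≤ cnt F u S D := by
  classical
  unfold cnt
  have hnn : ∀ k, ∀ q ∈ polys u k D, (0 : ℝ) ≤ if Good (und F) u q.2 q.1 then 1 else 0 :=
    fun k q _ => by split_ifs <;> norm_num
  refine le_trans ?_ (Finset.single_le_sum (f := fun k => ∑ q ∈ polys u k D,
    if Good (und F) u q.2 q.1 then (1 : ℝ) else 0)
    (fun k _ => Finset.sum_nonneg (hnn k)) hS)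
  refine le_trans ?_ (Finset.single_le_sum (f := fun q =>
    if Good (und F) u q.2 q.1 then (1 : ℝ) else 0) (hnn _)
    ((mem_polys u t.numNodes D t v).mpr ⟨rfl, hD⟩))
  simp [hg]

lemma ind_pair_inj {n : ℕ} {u v y y' : Fin n} (huv : u ≠ v) (h1 : u ≠ y) (h2 : v ≠ y) (h1' : u ≠ y')
    (h : ∀ f, ind u y f + ind v y f = ind u y' f + ind v y' f) : y = y' := by
  by_contra hne
  have := h s(u, y)
  unfold ind at this
  simp [huv, Ne.symm huv, h1, h2, h1', Ne.symm hne, hne, Ne.symm h1, Ne.symm h1'] at this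

lemma oddCard_le_two {n : ℕ} {u v y : Fin n} (l : List (Fin n))
    (h : ∀ f, wsum u l f = ind u y f + ind v y f) : oddCard u l ≤ 2 := by
  unfold oddCard
  refine le_trans (Finset.card_le_card (t := {s(u, y), s(v, y)}) ?_) Finset.card_le_two
  intro f hf
  simp only [Finset.mem_filter, Finset.mem_univ, true_and, h] at hf
  by_contra hn
  simp only [Finset.mem_insert, Finset.mem_singleton, not_or] at hn
  apply hf
  unfold ind
  simp [Ne.symm hn.1, Ne.symm hn.2]

lemma cnt_ge_pairs {n : ℕ} (F : Finset {t : Finset (Fin n) // t.card = 3}) (u : Fin n) (K : ℕ)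
    (h : ∀ v y, u ≠ v → u ≠ y → v ≠ y → ∃ t, Good (und F) u v t ∧ t.numNodes ≤ K ∧
      ∀ f, wsum u (inord t ++ [v]) f = ind u y f + ind v y f) :
    ((n : ℝ) - 1) * ((n : ℝ) - 2) ≤ cnt F u (Finset.range (K + 1)) 2 := by
  classical
  set P : Finset (Fin n × Fin n) := (Finset.univ.erase u).offDiag with hP
  have hPm : ∀ x ∈ P, u ≠ x.1 ∧ u ≠ x.2 ∧ x.1 ≠ x.2 := by
    intro x hx
    simp only [hP, Finset.mem_offDiag, Finset.mem_erase, Finset.mem_univ, and_true] at hx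
    exact ⟨hx.1.symm, hx.2.1.symm, hx.2.2⟩
  have hn : 1 ≤ n := by have := u.2; omega
  have hPc : (P.card : ℝ) = ((n : ℝ) - 1) * ((n : ℝ) - 2) := by
    rw [hP, Finset.offDiag_card, Finset.card_erase_of_mem (Finset.mem_univ _), Finset.card_univ,
      Fintype.card_fin, Nat.cast_sub (Nat.le_mul_self _), Nat.cast_mul, Nat.cast_sub hn]
    push_cast; ring
  have hch : ∀ x : Fin n × Fin n, ∃ t, x ∈ P → Good (und F) u x.1 t ∧ t.numNodes ≤ K ∧
      ∀ f, wsum u (inord t ++ [x.1]) f = ind u x.2 f + ind x.1 x.2 f := by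
    intro x
    by_cases hx : x ∈ P
    · obtain ⟨a, b, c⟩ := hPm x hx
      obtain ⟨t, ht⟩ := h x.1 x.2 a b c
      exact ⟨t, fun _ => ht⟩
    · exact ⟨BinaryTree.nil, fun h => absurd h hx⟩
  choose τ hτ using hch
  have hcnt : cnt F u (Finset.range (K + 1)) 2 =
      ((((Finset.range (K + 1)).sigma (fun k => (polys u k 2).filter
        (fun q => Good (und F) u q.2 q.1))).card : ℕ) : ℝ) := by
    unfold cnt
    rw [Finset.card_sigma]
    push_cast
    refine Finset.sum_congr rfl fun k _ => ?_
    rw [Finset.sum_boole]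
  rw [← hPc, hcnt]
  refine Nat.cast_le.mpr (Finset.card_le_card_of_injOn
    (fun x => (⟨(τ x).numNodes, (τ x, x.1)⟩ : Σ _ : ℕ, BinaryTree (Fin n) × Fin n)) ?_ ?_)
  · intro x hx
    obtain ⟨g1, g2, g3⟩ := hτ x hx
    simp only [Finset.mem_coe, Finset.mem_sigma, Finset.mem_range, Finset.mem_filter, mem_polys]
    exact ⟨by omega, ⟨trivial, oddCard_le_two _ g3⟩, g1⟩
  · intro x hx x' hx' he
    have he2 : (τ x, x.1) = (τ x', x'.1) := by
      simp only [Sigma.mk.injEq] at he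
      exact eq_of_heq he.2
    simp only [Prod.mk.injEq] at he2
    obtain ⟨e1, e2⟩ := he2
    obtain ⟨_, _, g3⟩ := hτ x hx
    obtain ⟨_, _, g3'⟩ := hτ x' hx'
    obtain ⟨a, b, c⟩ := hPm x hx
    obtain ⟨a', b', c'⟩ := hPm x' hx'
    refine Prod.ext e2 (ind_pair_inj a b c b' fun f => ?_)
    rw [← g3 f, e1, e2, g3' f]

lemma prob_bound {n : ℕ} (hn : 3 ≤ n) {p : ℝ} (h0 : 0 ≤ p) (h1 : p ≤ 1) (d : ℝ) (hd : 0 ≤ d)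
    (L : ℕ) (B1 B2 : ℝ)
    (hB2 : ∀ u : Fin n,
      ∑ k ∈ Finset.Ioc L (2 * L + 1), ((polys u k ⌊d⌋₊).card : ℝ) * p ^ k ≤ B2)
    (hB1 : ∀ u : Fin n,
      ∑ k ∈ Finset.range (3 * L + 1), ((polys u k 2).card : ℝ) * p ^ k ≤ B1) :
    1 - (n * B2 + B1 / (((n : ℝ) - 1) * ((n : ℝ) - 2))) ≤
      lmProb n p {F | ¬ ∃ T : SimpleGraph (Fin n), T.IsTree ∧
          (∀ u v : Fin n, (T.dist u v : ℝ) ≤ d) ∧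
          ∃ steps : List (Fin n × Fin n × Fin n),
            IsValidTriadicProcess F T steps ∧ afterGraph T steps = ⊤} ∧
      lmProb n p {F | ¬ ∃ T : SimpleGraph (Fin n), T.IsTree ∧
          (∀ u v : Fin n, (T.dist u v : ℝ) ≤ d) ∧
          ∃ steps : List (Fin n × Fin n × Fin n),
            IsValidTriadicProcess F T steps ∧ afterGraph T steps = ⊤} ≤ 1 := by
  classical
  set A : Set (Finset {t : Finset (Fin n) // t.card = 3}) :=
    {F | ¬ ∃ T : SimpleGraph (Fin n), T.IsTree ∧
          (∀ u v : Fin n, (T.dist u v : ℝ) ≤ d) ∧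
          ∃ steps : List (Fin n × Fin n × Fin n),
            IsValidTriadicProcess F T steps ∧ afterGraph T steps = ⊤} with hA
  have hlm : lmProb n p A = ∑ F, if F ∈ A then wt n p F else 0 := by
    unfold lmProb wt
    refine Finset.sum_congr rfl fun F _ => ?_
    by_cases hF : F ∈ A
    · rw [if_pos hF, if_pos hF]
    · rw [if_neg hF, if_neg hF]
  rw [hlm]
  have hn' : (3 : ℝ) ≤ n := by exact_mod_cast hn
  set Q : ℝ := ((n : ℝ) - 1) * ((n : ℝ) - 2) with hQ
  have hQ0 : 0 < Q := by apply mul_pos <;> linarith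
  let u0 : Fin n := ⟨0, by omega⟩
  constructor
  · have key : ∀ F : Finset {t : Finset (Fin n) // t.card = 3},
        wt n p F - ((∑ u : Fin n, wt n p F * cnt F u (Finset.Ioc L (2 * L + 1)) ⌊d⌋₊) +
          wt n p F * cnt F u0 (Finset.range (3 * L + 1)) 2 / Q)
        ≤ if F ∈ A then wt n p F else 0 := by
      intro F
      have hw := wt_nonneg h0 h1 F
      have hs0 : 0 ≤ ∑ u : Fin n, wt n p F * cnt F u (Finset.Ioc L (2 * L + 1)) ⌊d⌋₊ :=
        Finset.sum_nonneg fun u _ => mul_nonneg hw (cnt_nonneg _ _ _ _)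
      have hs1 : 0 ≤ wt n p F * cnt F u0 (Finset.range (3 * L + 1)) 2 / Q :=
        div_nonneg (mul_nonneg hw (cnt_nonneg _ _ _ _)) hQ0.le
      split_ifs with hF
      · linarith
      · simp only [hA, Set.mem_setOf_eq, not_not] at hF
        obtain ⟨T, hT, hdist, steps, hst, htop⟩ := hF
        rcases dichotomy F T hT ⌊d⌋₊ L (fun a b => Nat.le_floor (hdist a b)) steps hst htop
          (und F) rfl with h | h
        · obtain ⟨u, v, t, hg, hL1, hL2, hodd⟩ := h
          have h2 := cnt_ge_one F u v (Finset.Ioc L (2 * L + 1)) ⌊d⌋₊ t hg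
            (Finset.mem_Ioc.mpr ⟨hL1, hL2⟩) hodd
          have h3 : wt n p F * cnt F u (Finset.Ioc L (2 * L + 1)) ⌊d⌋₊ ≤
              ∑ u : Fin n, wt n p F * cnt F u (Finset.Ioc L (2 * L + 1)) ⌊d⌋₊ :=
            Finset.single_le_sum (f := fun u => wt n p F * cnt F u (Finset.Ioc L (2 * L + 1)) ⌊d⌋₊)
              (fun u _ => mul_nonneg hw (cnt_nonneg _ _ _ _)) (Finset.mem_univ u)
          nlinarith
        · have h2 := cnt_ge_pairs F u0 (3 * L) (fun v y a b c => h u0 v y a b c)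
          have h3 : wt n p F ≤ wt n p F * cnt F u0 (Finset.range (3 * L + 1)) 2 / Q := by
            rw [le_div_iff₀ hQ0]
            exact mul_le_mul_of_nonneg_left h2 hw
          linarith
    have hsum := Finset.sum_le_sum (s := Finset.univ) fun F _ => key F
    rw [Finset.sum_sub_distrib, sum_wt, Finset.sum_add_distrib, Finset.sum_comm,
      ← Finset.sum_div] at hsum
    refine le_trans ?_ hsum
    have b1 : (∑ F : Finset {t : Finset (Fin n) // t.card = 3},
        wt n p F * cnt F u0 (Finset.range (3 * L + 1)) 2) / Q ≤ B1 / Q :=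
      div_le_div_of_nonneg_right ((exp_cnt h0 h1 _ _ _).trans (hB1 u0)) hQ0.le
    have b2 : ∑ u : Fin n, ∑ F : Finset {t : Finset (Fin n) // t.card = 3},
        wt n p F * cnt F u (Finset.Ioc L (2 * L + 1)) ⌊d⌋₊ ≤ n * B2 := by
      refine le_trans (Finset.sum_le_card_nsmul _ _ B2 fun u _ =>
        (exp_cnt h0 h1 _ _ _).trans (hB2 u)) ?_
      rw [Finset.card_univ, Fintype.card_fin, nsmul_eq_mul]
    linarith
  · rw [← sum_wt (n := n) p]
    refine Finset.sum_le_sum fun F _ => ?_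
    split_ifs
    · exact le_refl _
    · exact wt_nonneg h0 h1 F


/-! ### Asymptotics -/

lemma const_bound : (2 : ℝ) ^ (-(7 : ℝ) / 2) ≤ 9 / 100 := by
  have h0 : (0 : ℝ) ≤ (2 : ℝ) ^ (-(7 : ℝ) / 2) := by positivity
  have h1 : ((2 : ℝ) ^ (-(7 : ℝ) / 2)) ^ 2 = 1 / 128 := by
    rw [← Real.rpow_natCast, ← Real.rpow_mul (by norm_num)]
    norm_num
  nlinarith

lemma term_bound {W : Type} [DecidableEq W] [Fintype W] (u : W) (k D : ℕ) (R p : ℝ) (hR : 15 ≤ R)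
    (hRn : R ^ 2 = Fintype.card W) (hk : (k : ℝ) ≤ 3 * R) (hp0 : 0 ≤ p) (hp : R * p ≤ 9 / 100) :
    ((polys u k D).card : ℝ) * p ^ k ≤ 5 / 2 * R ^ (D + 1) * (9 / 10) ^ k := by
  have h := card_polys u k D R (by linarith) hRn (by nlinarith)
  calc ((polys u k D).card : ℝ) * p ^ k ≤ 4 ^ k * R ^ D * (5 / 2 * R) ^ (k + 1) * p ^ k :=
        mul_le_mul_of_nonneg_right h (by positivity)
    _ = 5 / 2 * R ^ (D + 1) * (10 * (R * p)) ^ k := by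
        have : (10 * (R * p)) ^ k = 4 ^ k * (5 / 2 * R) ^ k * p ^ k := by
          rw [← mul_pow, ← mul_pow]; congr 1; ring
        rw [this]; ring
    _ ≤ _ := by
        refine mul_le_mul_of_nonneg_left (pow_le_pow_left₀ ?_ ?_ k) ?_
        · have : 0 ≤ R := by linarith
          positivity
        · linarith
        · have : 0 ≤ R := by linarith
          positivity

lemma final_bound {n : ℕ} {R p d : ℝ} (hR : 15 ≤ R) (hRn : R ^ 2 = n) (hp0 : 0 ≤ p)
    (hp : R * p ≤ 9 / 100) (hd0 : 0 ≤ d) :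
    1 - (n * (5 / 2 * R ^ (⌊d⌋₊ + 1) * (9 / 10) ^ (Nat.sqrt n) * (Nat.sqrt n + 1))
        + 25 * R ^ 3 / (((n : ℝ) - 1) * ((n : ℝ) - 2))) ≤
      lmProb n p {F | ¬ ∃ T : SimpleGraph (Fin n), T.IsTree ∧
          (∀ u v : Fin n, (T.dist u v : ℝ) ≤ d) ∧
          ∃ steps : List (Fin n × Fin n × Fin n),
            IsValidTriadicProcess F T steps ∧ afterGraph T steps = ⊤} ∧
      lmProb n p {F | ¬ ∃ T : SimpleGraph (Fin n), T.IsTree ∧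
          (∀ u v : Fin n, (T.dist u v : ℝ) ≤ d) ∧
          ∃ steps : List (Fin n × Fin n × Fin n),
            IsValidTriadicProcess F T steps ∧ afterGraph T steps = ⊤} ≤ 1 := by
  have hn3 : 3 ≤ n := by
    have : (3 : ℝ) ≤ n := by rw [← hRn]; nlinarith
    exact_mod_cast this
  have hL : ((Nat.sqrt n : ℕ) : ℝ) ≤ R := by
    have h1 : ((Nat.sqrt n : ℕ) : ℝ) ^ 2 ≤ n := by exact_mod_cast Nat.sqrt_le' n
    rw [← hRn] at h1
    exact (pow_le_pow_iff_left₀ (by positivity) (by linarith) (by norm_num)).mp h1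
  have hR0 : 0 ≤ R := by linarith
  have hRc : R ^ 2 = Fintype.card (Fin n) := by rw [hRn, Fintype.card_fin]
  refine prob_bound hn3 hp0 (by nlinarith) d hd0 (Nat.sqrt n) _ _ ?_ ?_
  · intro u
    have hc : (Finset.Ioc (Nat.sqrt n) (2 * Nat.sqrt n + 1)).card = Nat.sqrt n + 1 := by
      rw [Nat.card_Ioc]; omega
    refine (Finset.sum_le_card_nsmul _ _
      (5 / 2 * R ^ (⌊d⌋₊ + 1) * (9 / 10) ^ (Nat.sqrt n)) fun k hk => ?_).trans ?_
    · rw [Finset.mem_Ioc] at hk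
      have hk2 : (k : ℝ) ≤ 2 * (Nat.sqrt n : ℕ) + 1 := by exact_mod_cast hk.2
      refine (term_bound u k _ R p hR hRc (by linarith) hp0 hp).trans ?_
      refine mul_le_mul_of_nonneg_left ?_ (by positivity)
      exact pow_le_pow_of_le_one (by norm_num) (by norm_num) hk.1.le
    · rw [hc, nsmul_eq_mul]; push_cast; exact le_of_eq (by ring)
  · intro u
    have h1 : ∀ k ∈ Finset.range (3 * Nat.sqrt n + 1), ((polys u k 2).card : ℝ) * p ^ k ≤
        5 / 2 * R ^ (2 + 1) * (9 / 10) ^ k := by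
      intro k hk
      rw [Finset.mem_range] at hk
      have hk2 : (k : ℝ) ≤ 3 * (Nat.sqrt n : ℕ) := by exact_mod_cast (by omega : k ≤ 3 * Nat.sqrt n)
      exact term_bound u k 2 R p hR hRc (by linarith) hp0 hp
    refine (Finset.sum_le_sum h1).trans ?_
    rw [← Finset.mul_sum]
    have h2 : ∑ k ∈ Finset.range (3 * Nat.sqrt n + 1), (9 / 10 : ℝ) ^ k ≤ 10 := by
      rw [geom_sum_eq (by norm_num)]
      have : (0 : ℝ) ≤ (9 / 10) ^ (3 * Nat.sqrt n + 1) := by positivity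
      rw [div_le_iff_of_neg (by norm_num)]
      linarith
    have h3 : 0 ≤ R ^ 3 := by positivity
    nlinarith

lemma err_bound {n : ℕ} {R c : ℝ} (D : ℕ) (hR : 15 ≤ R) (hRn : R ^ 2 = n)
    (hc : c = -Real.log (9 / 10)) (hD : (D : ℝ) ≤ R ^ (1 / 2 : ℝ))
    (hlog : 5 * Real.log R ≤ c / 2 * R ^ (1 / 2 : ℝ)) :
    n * (5 / 2 * R ^ (D + 1) * (9 / 10) ^ (Nat.sqrt n) * (Nat.sqrt n + 1))
        + 25 * R ^ 3 / (((n : ℝ) - 1) * ((n : ℝ) - 2)) ≤ 6 * Real.exp (-(c / 2 * R)) + 100 / R := by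
  have hR0 : 0 < R := by linarith
  have hL : ((Nat.sqrt n : ℕ) : ℝ) ≤ R := by
    have h1 : ((Nat.sqrt n : ℕ) : ℝ) ^ 2 ≤ n := by exact_mod_cast Nat.sqrt_le' n
    rw [← hRn] at h1
    exact (pow_le_pow_iff_left₀ (by positivity) (by linarith) (by norm_num)).mp h1
  have hL2 : R - 1 ≤ ((Nat.sqrt n : ℕ) : ℝ) := by
    have h1 : (n : ℝ) ≤ ((Nat.sqrt n : ℕ) + 1 : ℝ) ^ 2 := by
      exact_mod_cast (Nat.lt_succ_sqrt' n).le
    rw [← hRn] at h1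
    have := (pow_le_pow_iff_left₀ hR0.le (by positivity) (by norm_num)).mp h1
    linarith
  have hc0 : 0 < c := by
    rw [hc]
    have := Real.log_neg (x := 9 / 10) (by norm_num) (by norm_num)
    linarith
  have hlR : 0 ≤ Real.log R := Real.log_nonneg (by linarith)
  have hs1 : 1 ≤ R ^ (1 / 2 : ℝ) := Real.one_le_rpow (by linarith) (by norm_num)
  have hss : R ^ (1 / 2 : ℝ) * R ^ (1 / 2 : ℝ) = R := by
    rw [← Real.rpow_add hR0]; norm_num
  refine add_le_add ?_ ?_
  · have e9 : (9 / 10 : ℝ) ^ (Nat.sqrt n) ≤ 10 / 9 * Real.exp (-(c * R)) := by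
      have e1 : (9 / 10 : ℝ) = Real.exp (-c) := by
        rw [hc, neg_neg, Real.exp_log (by norm_num)]
      have e2 : (10 / 9 : ℝ) = Real.exp c := by
        rw [← neg_neg c, Real.exp_neg, ← e1]; norm_num
      rw [e2, e1, ← Real.exp_nat_mul, ← Real.exp_add]
      apply Real.exp_le_exp.mpr
      nlinarith
    have eR : R ^ (D + 4) ≤ Real.exp (c / 2 * R) := by
      rw [← Real.exp_log (pow_pos hR0 (D + 4)), Real.log_pow]
      apply Real.exp_le_exp.mpr
      push_cast
      have a1 : ((D : ℝ) + 4) * Real.log R ≤ (5 * R ^ (1 / 2 : ℝ)) * Real.log R :=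
        mul_le_mul_of_nonneg_right (by linarith) hlR
      have a2 : R ^ (1 / 2 : ℝ) * (5 * Real.log R) ≤
          R ^ (1 / 2 : ℝ) * (c / 2 * R ^ (1 / 2 : ℝ)) :=
        mul_le_mul_of_nonneg_left hlog (by linarith)
      have a3 : R ^ (1 / 2 : ℝ) * (c / 2 * R ^ (1 / 2 : ℝ)) = c / 2 * R := by
        rw [← mul_assoc, mul_comm _ (c / 2), mul_assoc, hss]
      linarith
    have e3 : Real.exp (-(c / 2 * R)) = Real.exp (c / 2 * R) * Real.exp (-(c * R)) := by
      rw [← Real.exp_add]; congr 1; ring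
    calc (n : ℝ) * (5 / 2 * R ^ (D + 1) * (9 / 10) ^ (Nat.sqrt n) * (Nat.sqrt n + 1))
        ≤ R ^ 2 * (5 / 2 * R ^ (D + 1) * (10 / 9 * Real.exp (-(c * R))) * (16 / 15 * R)) := by
          rw [hRn]
          have : ((Nat.sqrt n : ℕ) : ℝ) + 1 ≤ 16 / 15 * R := by linarith
          gcongr
      _ = 80 / 27 * (R ^ (D + 4) * Real.exp (-(c * R))) := by ring
      _ ≤ 6 * (Real.exp (c / 2 * R) * Real.exp (-(c * R))) := by
          have : R ^ (D + 4) * Real.exp (-(c * R)) ≤ Real.exp (c / 2 * R) * Real.exp (-(c * R)) :=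
            mul_le_mul_of_nonneg_right eR (Real.exp_pos _).le
          have : 0 ≤ Real.exp (c / 2 * R) * Real.exp (-(c * R)) := by positivity
          linarith
      _ = _ := by rw [e3]
  · have hn4 : (4 : ℝ) ≤ n := by rw [← hRn]; nlinarith
    have hq : R ^ 4 / 4 ≤ ((n : ℝ) - 1) * ((n : ℝ) - 2) := by
      have : R ^ 4 = (n : ℝ) ^ 2 := by rw [← hRn]; ring
      rw [this]; nlinarith
    have : 25 * R ^ 3 / (((n : ℝ) - 1) * ((n : ℝ) - 2)) ≤ 25 * R ^ 3 / (R ^ 4 / 4) := by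
      gcongr
    refine this.trans (le_of_eq ?_)
    field_simp
    norm_num


/-- If `0 < p ≤ (2^{-7/2} − ε) n^{-1/2}` then w.h.p. there is no tree
`T ⊂ K_n` of diameter at most `n^{1/12-ε}` which triadically activates `K_n` in the
Linial–Meshulam random complex `H ∼ H_{n,p}`. -/
theorem statement6 (ε : ℝ) (hε : 0 < ε) (p : ℕ → ℝ)
    (hp0 : ∀ n : ℕ, 0 < p n)
    (hp : ∀ n : ℕ, 1 ≤ n →
      p n ≤ ((2 : ℝ) ^ (-(7 : ℝ) / 2) - ε) * (n : ℝ) ^ (-(1 : ℝ) / 2)) :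
    Filter.Tendsto
      (fun n => lmProb n (p n)
        {F | ¬ ∃ T : SimpleGraph (Fin n), T.IsTree ∧
          (∀ u v : Fin n, (T.dist u v : ℝ) ≤ (n : ℝ) ^ ((1 : ℝ) / 12 - ε)) ∧
          ∃ steps : List (Fin n × Fin n × Fin n),
            IsValidTriadicProcess F T steps ∧ afterGraph T steps = ⊤})
      Filter.atTop (nhds 1) := by
  set c : ℝ := -Real.log (9 / 10) with hc
  have hc0 : 0 < c := by
    rw [hc]
    have := Real.log_neg (x := 9 / 10) (by norm_num) (by norm_num)
    linarith
  have hsq : Filter.Tendsto (fun n : ℕ => Real.sqrt (n : ℝ)) Filter.atTop Filter.atTop :=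
    Real.tendsto_sqrt_atTop.comp tendsto_natCast_atTop_atTop
  have hlogev : ∀ᶠ R : ℝ in Filter.atTop, 5 * Real.log R ≤ c / 2 * R ^ (1 / 2 : ℝ) := by
    have h := (isLittleO_log_rpow_atTop (r := 1 / 2) (by norm_num)).bound
      (c := c / 10) (by positivity)
    filter_upwards [h, Filter.eventually_ge_atTop (1 : ℝ)] with R hR hR1
    rw [Real.norm_of_nonneg (Real.log_nonneg hR1),
      Real.norm_of_nonneg (Real.rpow_nonneg (by linarith) _)] at hR
    linarith
  have hmain : ∀ᶠ n : ℕ in Filter.atTop,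
      1 - (6 * Real.exp (-(c / 2 * Real.sqrt n)) + 100 / Real.sqrt n) ≤ lmProb n (p n)
        {F | ¬ ∃ T : SimpleGraph (Fin n), T.IsTree ∧
          (∀ u v : Fin n, (T.dist u v : ℝ) ≤ (n : ℝ) ^ ((1 : ℝ) / 12 - ε)) ∧
          ∃ steps : List (Fin n × Fin n × Fin n),
            IsValidTriadicProcess F T steps ∧ afterGraph T steps = ⊤} ∧
      lmProb n (p n)
        {F | ¬ ∃ T : SimpleGraph (Fin n), T.IsTree ∧
          (∀ u v : Fin n, (T.dist u v : ℝ) ≤ (n : ℝ) ^ ((1 : ℝ) / 12 - ε)) ∧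
          ∃ steps : List (Fin n × Fin n × Fin n),
            IsValidTriadicProcess F T steps ∧ afterGraph T steps = ⊤} ≤ 1 := by
    filter_upwards [hsq.eventually hlogev, hsq.eventually_ge_atTop 15,
      Filter.eventually_ge_atTop 1] with n hlog hR hn
    have hn1 : (1 : ℝ) ≤ n := by exact_mod_cast hn
    have hn0 : (0 : ℝ) ≤ n := by linarith
    have hRn : Real.sqrt (n : ℝ) ^ 2 = n := Real.sq_sqrt hn0
    have hR0 : 0 < Real.sqrt (n : ℝ) := by linarith
    have hpR : Real.sqrt (n : ℝ) * p n ≤ 9 / 100 := by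
      have h1 := hp n hn
      have h2 : (n : ℝ) ^ (-(1 : ℝ) / 2) = (Real.sqrt n)⁻¹ := by
        rw [Real.sqrt_eq_rpow, ← Real.rpow_neg hn0]; norm_num
      rw [h2, ← div_eq_mul_inv, le_div_iff₀ hR0] at h1
      have := const_bound
      linarith
    have hb := final_bound (n := n) (d := (n : ℝ) ^ ((1 : ℝ) / 12 - ε)) hR hRn (hp0 n).le hpR
      (Real.rpow_nonneg hn0 _)
    refine ⟨le_trans ?_ hb.1, hb.2⟩
    have hD : ((⌊(n : ℝ) ^ ((1 : ℝ) / 12 - ε)⌋₊ : ℕ) : ℝ) ≤ Real.sqrt n ^ (1 / 2 : ℝ) := by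
      refine (Nat.floor_le (Real.rpow_nonneg hn0 _)).trans ?_
      rw [Real.sqrt_eq_rpow, ← Real.rpow_mul hn0]
      exact Real.rpow_le_rpow_of_exponent_le hn1 (by linarith)
    have := err_bound (n := n) _ hR hRn hc hD hlog
    linarith
  have hlim : Filter.Tendsto (fun n : ℕ =>
      1 - (6 * Real.exp (-(c / 2 * Real.sqrt n)) + 100 / Real.sqrt n)) Filter.atTop (nhds 1) := by
    have h1 : Filter.Tendsto (fun n : ℕ => Real.exp (-(c / 2 * Real.sqrt n))) Filter.atTop
        (nhds 0) :=
      Real.tendsto_exp_neg_atTop_nhds_zero.comp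
        (Filter.Tendsto.const_mul_atTop (by positivity) hsq)
    have h2 : Filter.Tendsto (fun n : ℕ => 100 / Real.sqrt n) Filter.atTop (nhds 0) :=
      Filter.Tendsto.const_div_atTop hsq 100
    have := ((h1.const_mul 6).add h2).const_sub 1
    simpa using this
  exact tendsto_of_tendsto_of_tendsto_of_le_of_le' hlim tendsto_const_nhds
    (hmain.mono fun _ h => h.1) (hmain.mono fun _ h => h.2)


end WSat
end

section
/- Let ℓ = ℓ(n) ≥ 3, v = v(n) ≥ ℓ(n), and w = w(n) ≥ 0 be sequences of integers. Then |P_{v,w}(ℓ,n)| ≤ n^v · (2v)^{4w} · w^w · C(2v+w−2, w) · 2^{7v}, where C(·,·) denotes the binomial coefficient (with the convention 0^0 = 1). -/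
namespace WSat

variable {V : Type} [Fintype V] [DecidableEq V]

/-- The number of (non-isolated) vertices of `G`. -/
noncomputable def supportCard (G : SimpleGraph V) : ℕ := Nat.card G.support

/-- The number of edges of `G`. -/
noncomputable def edgeCard (G : SimpleGraph V) : ℕ := Nat.card G.edgeSet

/-- `con_A(e)`: the number of triangles of the process containing `e` that do not
activate `e`. -/
noncomputable def conA (steps : List (V × V × V)) (e : Sym2 V) : ℕ :=
  Nat.card {i : Fin steps.length //
    e = s((steps.get i).1, (steps.get i).2.2) ∨ e = s((steps.get i).2.1, (steps.get i).2.2)}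

open scoped Classical in
/-- `exc_A(e)` relative to the initial graph `H` and the target graph `C`. -/
noncomputable def excA (H C : SimpleGraph V) (steps : List (V × V × V)) (e : Sym2 V) : ℤ :=
  (conA steps e : ℤ) -
    (if e ∈ C.edgeSet then (if e ∈ H.edgeSet then 1 else 0)
     else (if e ∈ H.edgeSet then 2 else 1))

/-- `exc(A) = Σ_e exc_A(e)`, summed over the edges of `K(A)`. -/
noncomputable def excSum (H C : SimpleGraph V) (steps : List (V × V × V)) : ℤ :=
  ∑ᶠ e ∈ (afterGraph H steps).edgeSet, excA H C steps e

/-- A nice activation process from `H` activating `C` (that is, every edge of the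
activation complex has nonnegative excess). -/
def NiceProcess (H C : SimpleGraph V) (steps : List (V × V × V)) : Prop :=
  IsValidProcess H steps ∧ C ≤ afterGraph H steps ∧
    ∀ e ∈ (afterGraph H steps).edgeSet, 0 ≤ excA H C steps e

/-- A nice activation process from `H` activating `C` inside the ambient graph `G`. -/
def NiceActivation (G H C : SimpleGraph V) (steps : List (V × V × V)) : Prop :=
  NiceProcess H C steps ∧ afterGraph H steps ≤ G

/-- The subgraph consisting of the edges of the walk `w`. -/
def walkEdgeGraph {G : SimpleGraph V} {x y : V} (w : G.Walk x y) : SimpleGraph V :=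
  SimpleGraph.fromEdgeSet {e | e ∈ w.edges}

/-- The complexity `d_H = |E(H)| − |V(H)| + 1` of a graph `H`. -/
noncomputable def complexity (H : SimpleGraph V) : ℤ :=
  (edgeCard H : ℤ) - (supportCard H : ℤ) + 1

/-- The state of a (partially built) activation diagram: vertex identifiers
`0, …, nv - 1`, their labels, the internal boundary (a cyclic list of vertex identifiers),
the set of marked boundary edges, and the list of triangular faces glued so far. -/
structure DiagState (V : Type) where
  nv : ℕ
  label : ℕ → V
  boundary : List ℕ
  marked : Set (Sym2 ℕ)
  faces : List (ℕ × ℕ × ℕ)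

/-- The edges of the cyclic list `B`. -/
def cycEdges (B : List ℕ) : Set (Sym2 ℕ) :=
  {e | e ∈ (B.zip (B.rotate 1)).map fun q => s(q.1, q.2)}

/-- The initial state `D_{s+1} = C` for a cycle whose cyclic list of vertex labels is
`cyc` (with default label `x`): the boundary is the cycle, all of its edges are marked,
and there are no faces. -/
def initState (x : V) (cyc : List V) : DiagState V where
  nv := cyc.length
  label := fun i => cyc.getD i x
  boundary := List.range cyc.length
  marked := cycEdges (List.range cyc.length)
  faces := []

/-- The marked edges after gluing a triangle with apex labelled `c` onto the boundary edge
`{u, v}`: the edge `{u, v}` is unmarked, and each of the two new edges is marked unless a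
marked edge with the same pair of labels already exists. -/
def glueMarked (D : DiagState V) (u v : ℕ) (c : V) : Set (Sym2 ℕ) :=
  (D.marked \ {s(u, v)}) ∪
    {f | (f = s(u, D.nv) ∧ ¬ ∃ e ∈ D.marked, Sym2.map D.label e = s(D.label u, c)) ∨
         (f = s(v, D.nv) ∧ ¬ ∃ e ∈ D.marked, Sym2.map D.label e = s(D.label v, c))}

/-- The state obtained from `D` by gluing a triangle with apex labelled `c` onto the
boundary edge at position `i`. -/
def glueResult (D : DiagState V) (i : ℕ) (c : V) : DiagState V where
  nv := D.nv + 1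
  label := Function.update D.label D.nv c
  boundary := D.boundary.take (i + 1) ++ D.nv :: D.boundary.drop (i + 1)
  marked := glueMarked D (D.boundary.getD i 0)
    (D.boundary.getD ((i + 1) % D.boundary.length) 0) c
  faces := (D.boundary.getD i 0,
    D.boundary.getD ((i + 1) % D.boundary.length) 0, D.nv) :: D.faces

/-- Gluing a triangle labelled `{a, b, c}` (activating the edge labelled `{a, b}`, apex
labelled `c`) onto a marked internal boundary edge whose labels are `{a, b}`. -/
def GlueStep (D D' : DiagState V) (a b c : V) : Prop :=
  ∃ i : ℕ, i < D.boundary.length ∧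
    s(D.boundary.getD i 0, D.boundary.getD ((i + 1) % D.boundary.length) 0) ∈ D.marked ∧
    s(D.label (D.boundary.getD i 0),
      D.label (D.boundary.getD ((i + 1) % D.boundary.length) 0)) = s(a, b) ∧
    D' = glueResult D i c

/-- `DiagReaches steps D D'` holds when `D'` is obtained from `D` by gluing the triangles
of `steps` in reverse order (`Δ_s` first, `Δ₁` last), as in the activation diagram
construction. -/
def DiagReaches : List (V × V × V) → DiagState V → DiagState V → Prop
  | [], D, D' => D' = D
  | st :: rest, D, D' => ∃ Dmid, DiagReaches rest D Dmid ∧ GlueStep Dmid D' st.1 st.2.1 st.2.2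

/-- The set of faces of a diagram state, as 3-element sets of vertex identifiers. -/
def faceSets (D : DiagState V) : Set (Finset ℕ) :=
  {t | ∃ q ∈ D.faces, t = ({q.1, q.2.1, q.2.2} : Finset ℕ)}

/-- Isomorphism of labelled diagrams. -/
def DiagIso (D₁ D₂ : DiagState V) : Prop :=
  ∃ f : ℕ → ℕ,
    D₂.nv = D₁.nv ∧
    Set.InjOn f {i | i < D₁.nv} ∧
    (∀ i < D₁.nv, f i < D₁.nv) ∧
    (∀ i < D₁.nv, D₂.label (f i) = D₁.label i) ∧
    (D₁.boundary.map f).IsRotated D₂.boundary ∧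
    D₂.marked = Sym2.map f '' D₁.marked ∧
    faceSets D₂ = (fun t => t.image f) '' faceSets D₁

/-- `P_{v,w}(ℓ,n)`: the collection of `A`-activation diagrams for nice activation
processes `A = (H; Δ₁, …, Δ_s)` of an `ℓ`-cycle with `V(H) ⊆ [n]`, `|V(H)| = v` and
`2·d_H + exc(A) = w`. -/
def Pvw (n ℓ v w : ℕ) : Set (DiagState (Fin n)) :=
  {D | ∃ (H : SimpleGraph (Fin n)) (steps : List (Fin n × Fin n × Fin n)) (x : Fin n)
        (wk : (afterGraph H steps).Walk x x),
      wk.IsCycle ∧ wk.length = ℓ ∧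
      NiceProcess H (walkEdgeGraph wk) steps ∧
      supportCard H = v ∧
      2 * complexity H + excSum H (walkEdgeGraph wk) steps = (w : ℤ) ∧
      DiagReaches steps (initState x wk.support.dropLast) D}

/-- `|P_{v,w}(ℓ,n)|`: the number of such diagrams, counted up to isomorphism. -/
noncomputable def PvwCard (n ℓ v w : ℕ) : ℕ :=
  Nat.card
    (Quot fun (D₁ D₂ : {D : DiagState (Fin n) // D ∈ Pvw n ℓ v w}) => DiagIso D₁.1 D₂.1)

set_option linter.unusedSectionVars false

section WalkCoding

variable {α : Type} [DecidableEq α]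

/-- The `i`-th edge of the sequence `x`. -/
def wE (x : ℕ → α) (i : ℕ) : Sym2 α := s(x i, x (i + 1))

/-- The vertices visited at times `0, …, i`. -/
def wVis (x : ℕ → α) (i : ℕ) : Finset α := (Finset.range (i + 1)).image x

/-- The indices of the second representatives. -/
def wU (L : ℕ) (B S : Finset ℕ) : Finset ℕ := Finset.range L \ (B ∪ S)

/-- Edges which were traversed (as representatives) exactly once before time `i`. -/
def wUnf (L : ℕ) (x : ℕ → α) (B S : Finset ℕ) (i : ℕ) : Finset (Sym2 α) :=
  ((S.filter (· < i)).image (wE x)) \ (((wU L B S).filter (· < i)).image (wE x))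

/-- Unfinished degree of `y` at time `i`. -/
def wF (L : ℕ) (x : ℕ → α) (B S : Finset ℕ) (i : ℕ) (y : α) : ℕ :=
  ((wUnf L x B S i).filter (y ∈ ·)).card

/-- The second traversals with an ambiguous choice. -/
def wAmb (L : ℕ) (x : ℕ → α) (B S : Finset ℕ) (i : ℕ) : Prop :=
  i ∈ wU L B S ∧ 2 ≤ wF L x B S i (x i)

instance (L : ℕ) (x : ℕ → α) (B S : Finset ℕ) (i : ℕ) : Decidable (wAmb L x B S i) := by
  unfold wAmb; infer_instance

/-- The number of stream symbols read before time `i`. -/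
def wPtr (L : ℕ) (x : ℕ → α) (B S Q : Finset ℕ) (i : ℕ) : ℕ :=
  ((Finset.range i).filter (fun j => j ∈ Q ∨ wAmb L x B S j)).card

structure WGood (L v w : ℕ) (x : ℕ → α) (B S : Finset ℕ) : Prop where
  hL : L = 2 * (v - 1) + w
  hv : 1 ≤ v
  hB : B ⊆ Finset.range L
  hBc : B.card = w
  hS : S ⊆ Finset.range L \ B
  hSc : S.card = v - 1
  hSinj : Set.InjOn (wE x) (S : Set ℕ)
  hUinj : Set.InjOn (wE x) (wU L B S : Set ℕ)
  hpart : ∀ k ∈ wU L B S, ∃ j ∈ S, j < k ∧ wE x j = wE x k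
  hnl : ∀ i < L, x i ≠ x (i + 1)
  hcard : (wVis x L).card = v

structure WSpec (L : ℕ) (x : ℕ → α) (B S Q : Finset ℕ) (lab : ℕ → α) (σ : ℕ → ℕ) : Prop where
  h0 : x 0 = lab 0
  hnew : ∀ i < L, i ∈ B ∪ S → i ∉ Q → x (i + 1) = lab (wVis x i).card
  hstr : ∀ i < L, (i ∈ Q ∨ wAmb L x B S i) → x (i + 1) = lab (σ (wPtr L x B S Q i))

theorem wE_congr {x x' : ℕ → α} {i : ℕ} (h : ∀ j ≤ i, x j = x' j) {j : ℕ} (hj : j < i) :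
    wE x j = wE x' j := by
  simp only [wE]; rw [h j hj.le, h (j+1) hj]

theorem wVis_congr {x x' : ℕ → α} {i : ℕ} (h : ∀ j ≤ i, x j = x' j) : wVis x i = wVis x' i := by
  unfold wVis
  apply Finset.image_congr
  intro j hj
  simp at hj
  exact h j (by omega)

theorem wUnf_congr {L : ℕ} {x x' : ℕ → α} {B S : Finset ℕ} {i : ℕ} (h : ∀ j ≤ i, x j = x' j) :
    wUnf L x B S i = wUnf L x' B S i := by
  unfold wUnf
  congr 1 <;>
  · apply Finset.image_congr
    intro j hj
    simp at hj
    exact wE_congr h hj.2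

theorem wAmb_congr {L : ℕ} {x x' : ℕ → α} {B S : Finset ℕ} {i : ℕ} (h : ∀ j ≤ i, x j = x' j) :
    wAmb L x B S i ↔ wAmb L x' B S i := by
  unfold wAmb wF
  rw [wUnf_congr h, h i le_rfl]

theorem wPtr_congr {L : ℕ} {x x' : ℕ → α} {B S Q : Finset ℕ} {i : ℕ} (h : ∀ j ≤ i, x j = x' j) :
    wPtr L x B S Q i = wPtr L x' B S Q i := by
  unfold wPtr
  congr 1
  apply Finset.filter_congr
  intro j hj
  simp at hj
  rw [wAmb_congr (fun k hk => h k (by omega))]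

theorem wGood_mem_unf {L v w : ℕ} {x : ℕ → α} {B S : Finset ℕ} (g : WGood L v w x B S)
    {i : ℕ} (hi : i ∈ wU L B S) : wE x i ∈ wUnf L x B S i := by
  unfold wUnf
  rw [Finset.mem_sdiff]
  obtain ⟨j, hj, hji, he⟩ := g.hpart i hi
  refine ⟨Finset.mem_image.2 ⟨j, by simp [hj, hji], he⟩, ?_⟩
  intro h
  obtain ⟨k, hk, hke⟩ := Finset.mem_image.1 h
  rw [Finset.mem_filter] at hk
  have := g.hUinj hk.1 hi hke
  omega

theorem wSpec_unique {L v w : ℕ} {x x' : ℕ → α} {B S Q : Finset ℕ} {lab : ℕ → α} {σ : ℕ → ℕ}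
    (g : WGood L v w x B S) (g' : WGood L v w x' B S)
    (h : WSpec L x B S Q lab σ) (h' : WSpec L x' B S Q lab σ) :
    ∀ i ≤ L, ∀ j ≤ i, x j = x' j := by
  intro i
  induction i with
  | zero => intro _ j hj; obtain rfl : j = 0 := by omega
            rw [h.h0, h'.h0]
  | succ i ih =>
    intro hi j hj
    have ih := ih (by omega)
    rcases Nat.lt_or_ge j (i+1) with hlt | hge
    · exact ih j (by omega)
    obtain rfl : j = i + 1 := by omega
    by_cases hA : i ∈ Q ∨ wAmb L x B S i
    · rw [h.hstr i (by omega) hA, h'.hstr i (by omega) (by rwa [← wAmb_congr ih]), wPtr_congr ih]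
    · push Not at hA
      by_cases hBS : i ∈ B ∪ S
      · rw [h.hnew i (by omega) hBS hA.1, h'.hnew i (by omega) hBS hA.1, wVis_congr ih]
      · have hU : i ∈ wU L B S := by
          unfold wU
          rw [Finset.mem_sdiff]; exact ⟨by simp; omega, hBS⟩
        have m1 := wGood_mem_unf g hU
        have m2 := wGood_mem_unf g' hU
        rw [← wUnf_congr ih] at m2
        have hF : wF L x B S i (x i) < 2 := by
          by_contra hh; exact hA.2 ⟨hU, by omega⟩
        have : wE x i = wE x' i := by
          unfold wF at hF
          apply Finset.card_le_one.1 (Nat.le_of_lt_succ hF)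
          · rw [Finset.mem_filter]; exact ⟨m1, by simp [wE]⟩
          · rw [Finset.mem_filter]; refine ⟨m2, ?_⟩
            rw [ih i le_rfl]; simp [wE]
        unfold wE at this
        rw [ih i le_rfl] at this
        exact Sym2.congr_right.1 this

/-- potential -/
def wPhi (L : ℕ) (x : ℕ → α) (B S : Finset ℕ) (V0 : Finset α) (i : ℕ) : ℕ :=
  (∑ y ∈ V0, (wF L x B S i y - 2)) + if 2 ≤ wF L x B S i (x i) then 1 else 0

theorem wUnf_succ_B {L v w : ℕ} {x : ℕ → α} {B S : Finset ℕ} (g : WGood L v w x B S)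
    {i : ℕ} (hi : i ∈ B) : wUnf L x B S (i+1) = wUnf L x B S i := by
  have h1 : S.filter (· < i + 1) = S.filter (· < i) := by
    apply Finset.filter_congr; intro j hj
    have := g.hS hj
    have : j ≠ i := by rintro rfl; simp [hi] at this
    omega
  have h2 : (wU L B S).filter (· < i + 1) = (wU L B S).filter (· < i) := by
    apply Finset.filter_congr; intro j hj
    have : j ≠ i := by rintro rfl; simp [wU, hi] at hj
    omega
  unfold wUnf
  rw [h1, h2]

theorem wUnf_succ_S {L v w : ℕ} {x : ℕ → α} {B S : Finset ℕ} (g : WGood L v w x B S)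
    {i : ℕ} (hi : i ∈ S) : wE x i ∉ wUnf L x B S i ∧
      wUnf L x B S (i+1) = insert (wE x i) (wUnf L x B S i) := by
  have h1 : S.filter (· < i + 1) = insert i (S.filter (· < i)) := by
    ext j; simp only [Finset.mem_filter, Finset.mem_insert]
    constructor
    · rintro ⟨a, b⟩; by_cases j = i <;> [left; right] <;> [assumption; exact ⟨a, by omega⟩]
    · rintro (rfl | ⟨a, b⟩) <;> [exact ⟨hi, by omega⟩; exact ⟨a, by omega⟩]
  have h2 : (wU L B S).filter (· < i + 1) = (wU L B S).filter (· < i) := by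
    apply Finset.filter_congr; intro j hj
    have : j ≠ i := by rintro rfl; simp [wU, hi] at hj
    omega
  constructor
  · intro h
    unfold wUnf at h
    rw [Finset.mem_sdiff] at h
    obtain ⟨j, hj, he⟩ := Finset.mem_image.1 h.1
    rw [Finset.mem_filter] at hj
    have := g.hSinj hj.1 hi he
    omega
  · unfold wUnf
    rw [h1, h2, Finset.image_insert, Finset.insert_sdiff_of_notMem]
    intro h
    obtain ⟨k, hk, he⟩ := Finset.mem_image.1 h
    rw [Finset.mem_filter] at hk
    obtain ⟨j, hj, hjk, he2⟩ := g.hpart k hk.1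
    have := g.hSinj hj hi (he2.trans he)
    omega

theorem wUnf_succ_U {L : ℕ} {x : ℕ → α} {B S : Finset ℕ}
    {i : ℕ} (hi : i ∈ wU L B S) :
      wUnf L x B S (i+1) = (wUnf L x B S i).erase (wE x i) := by
  have h1 : S.filter (· < i + 1) = S.filter (· < i) := by
    apply Finset.filter_congr; intro j hj
    have : j ≠ i := by rintro rfl; simp [wU, hj] at hi
    omega
  have h2 : (wU L B S).filter (· < i + 1) = insert i ((wU L B S).filter (· < i)) := by
    ext j; simp only [Finset.mem_filter, Finset.mem_insert]
    constructor
    · rintro ⟨a, b⟩; by_cases j = i <;> [left; right] <;> [assumption; exact ⟨a, by omega⟩]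
    · rintro (rfl | ⟨a, b⟩) <;> [exact ⟨hi, by omega⟩; exact ⟨a, by omega⟩]
  unfold wUnf
  rw [h1, h2, Finset.image_insert]
  ext e; simp only [Finset.mem_sdiff, Finset.mem_insert, Finset.mem_erase]; tauto

theorem wF_succ_B {L v w : ℕ} {x : ℕ → α} {B S : Finset ℕ} (g : WGood L v w x B S)
    {i : ℕ} (hi : i ∈ B) (y : α) : wF L x B S (i+1) y = wF L x B S i y := by
  unfold wF; rw [wUnf_succ_B g hi]

theorem wF_succ_S {L v w : ℕ} {x : ℕ → α} {B S : Finset ℕ} (g : WGood L v w x B S)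
    {i : ℕ} (hi : i ∈ S) (y : α) : wF L x B S (i+1) y =
      wF L x B S i y + if y ∈ wE x i then 1 else 0 := by
  obtain ⟨h1, h2⟩ := wUnf_succ_S g hi
  unfold wF; rw [h2, Finset.filter_insert]
  split_ifs with h
  · rw [Finset.card_insert_of_notMem]; simp [h1]
  · rfl

theorem wF_succ_U {L v w : ℕ} {x : ℕ → α} {B S : Finset ℕ} (g : WGood L v w x B S)
    {i : ℕ} (hi : i ∈ wU L B S) (y : α) : wF L x B S (i+1) y + (if y ∈ wE x i then 1 else 0) =
      wF L x B S i y := by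
  have h1 := wGood_mem_unf g hi
  have h2 := wUnf_succ_U (x := x) hi
  unfold wF; rw [h2, Finset.filter_erase]
  split_ifs with h
  · rw [Finset.card_erase_add_one]; simp [h1, h]
  · rw [Finset.erase_eq_of_notMem]; rfl
    simp [h]

theorem wF_eq_zero {L : ℕ} {x : ℕ → α} {B S : Finset ℕ} 
    {i : ℕ} {y : α} (hy : y ∉ wVis x i) : wF L x B S i y = 0 := by
  unfold wF
  rw [Finset.card_eq_zero, Finset.filter_eq_empty_iff]
  intro e he hye
  unfold wUnf at he
  obtain ⟨j, hj, rfl⟩ := Finset.mem_image.1 (Finset.mem_sdiff.1 he).1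
  rw [Finset.mem_filter] at hj
  apply hy
  simp only [wE, Sym2.mem_iff] at hye
  unfold wVis
  rcases hye with rfl | rfl
  · exact Finset.mem_image_of_mem _ (by simp; omega)
  · exact Finset.mem_image_of_mem _ (by simp; omega)

theorem sum_two {V0 : Finset α} {a b : α} (ha : a ∈ V0) (hb : b ∈ V0) (hab : a ≠ b) (f : α → ℕ) :
    ∑ y ∈ V0, f y = f a + f b + ∑ y ∈ (V0.erase a).erase b, f y := by
  rw [← Finset.add_sum_erase _ _ ha, ← Finset.add_sum_erase (V0.erase a) _ (a := b)
    (by simp [hb, hab.symm]), add_assoc]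

theorem wPhi_step {L v w : ℕ} {x : ℕ → α} {B S : Finset ℕ} (g : WGood L v w x B S)
    {i : ℕ} (hi : i < L) :
    wPhi L x B S (wVis x L) (i+1) + (if wAmb L x B S i then 1 else 0) ≤
      wPhi L x B S (wVis x L) i + 
        if i ∈ (B ∪ S).filter (fun i => x (i+1) ∈ wVis x i) then 2 else 0 := by
  have ha : x i ∈ wVis x L := Finset.mem_image_of_mem _ (by simp; omega)
  have hb : x (i+1) ∈ wVis x L := Finset.mem_image_of_mem _ (by simp; omega)
  have hab := g.hnl i hi
  unfold wPhi
  rw [sum_two ha hb hab, sum_two ha hb hab]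
  have hrest : ∀ (h : ∀ y, y ≠ x i → y ≠ x (i+1) → wF L x B S (i+1) y = wF L x B S i y),
      ∑ y ∈ ((wVis x L).erase (x i)).erase (x (i+1)), (wF L x B S (i+1) y - 2) = 
      ∑ y ∈ ((wVis x L).erase (x i)).erase (x (i+1)), (wF L x B S i y - 2) := by
    intro h; apply Finset.sum_congr rfl
    intro y hy
    simp at hy
    rw [h y hy.2.1 hy.1]
  have hz : x (i+1) ∉ wVis x i → wF L x B S i (x (i+1)) = 0 := 
    fun h => wF_eq_zero h
  by_cases hB : i ∈ B
  · rw [hrest (fun y _ _ => wF_succ_B g hB y)]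
    have hn : ¬ wAmb L x B S i := fun h => by
      have := h.1; simp [wU, hB] at this
    rw [wF_succ_B g hB, wF_succ_B g hB, if_neg hn]
    by_cases hv : x (i+1) ∈ wVis x i
    · simp only [Finset.mem_filter, Finset.mem_union, hB, hv, true_or, and_self, if_true]
      split_ifs <;> omega
    · rw [hz hv]; rw [if_neg (show ¬ 2 ≤ 0 by omega)]; omega
  by_cases hS : i ∈ S
  · have hn : ¬ wAmb L x B S i := fun h => by
      have := h.1; simp [wU, hS] at this
    rw [hrest (fun y h1 h2 => by rw [wF_succ_S g hS]; simp [wE, h1, h2])]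
    rw [if_neg hn, wF_succ_S g hS, wF_succ_S g hS]
    by_cases hv : x (i+1) ∈ wVis x i
    · simp only [Finset.mem_filter, Finset.mem_union, hS, hv, or_true, and_self, if_true, wE,
        Sym2.mem_iff, true_or]
      split_ifs <;> omega
    · rw [hz hv]
      simp only [Finset.mem_filter, hv, and_false, if_false, wE, Sym2.mem_iff, true_or, or_true,
        if_true]
      split_ifs <;> omega
  · have hU : i ∈ wU L B S := by simp [wU, hi, hB, hS]
    rw [hrest (fun y h1 h2 => by rw [← wF_succ_U g hU]; simp [wE, h1, h2])]
    have e1 := wF_succ_U g hU (x i)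
    have e2 := wF_succ_U g hU (x (i+1))
    simp only [wE, Sym2.mem_iff, true_or, or_true, if_true] at e1 e2
    have : wAmb L x B S i ↔ 2 ≤ wF L x B S i (x i) := by simp [wAmb, hU]
    simp only [this]
    split_ifs <;> omega

theorem wAmb_card {L v w : ℕ} {x : ℕ → α} {B S : Finset ℕ} (g : WGood L v w x B S) :
    ((Finset.range L).filter (fun i => wAmb L x B S i)).card ≤
      2 * ((B ∪ S).filter (fun i => x (i+1) ∈ wVis x i)).card := by
  have key : ∀ m ≤ L, wPhi L x B S (wVis x L) m + ∑ i ∈ Finset.range m, (if wAmb L x B S i then 1 else 0)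
      ≤ ∑ i ∈ Finset.range m, 
        if i ∈ (B ∪ S).filter (fun i => x (i+1) ∈ wVis x i) then 2 else 0 := by
    intro m
    induction m with
    | zero => intro _; simp [wPhi, wF, wUnf]
    | succ m ih =>
      intro hm
      rw [Finset.sum_range_succ, Finset.sum_range_succ]
      have := ih (by omega)
      have := wPhi_step g (i := m) (by omega)
      omega
  have := key L le_rfl
  rw [← Finset.sum_filter, ← Finset.sum_filter] at this
  simp only [Finset.sum_const, smul_eq_mul, mul_one] at this
  have h2 : ((Finset.range L).filter (fun i => i ∈ (B ∪ S).filter (fun i => x (i+1) ∈ wVis x i))).card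
    ≤ ((B ∪ S).filter (fun i => x (i+1) ∈ wVis x i)).card := by
    apply Finset.card_le_card; intro i hi; exact (Finset.mem_filter.1 hi).2
  omega

theorem wVis_succ (x : ℕ → α) (i : ℕ) : wVis x (i+1) = insert (x (i+1)) (wVis x i) := by
  unfold wVis; rw [Finset.range_add_one (n := i+1), Finset.image_insert]

theorem wVis_mono (x : ℕ → α) {i j : ℕ} (h : i ≤ j) : wVis x i ⊆ wVis x j :=
  Finset.image_subset_image (by intro a; simp; omega)

theorem wNew_card (x : ℕ → α) (m : ℕ) :
    (wVis x m).card = 1 + ((Finset.range m).filter (fun i => x (i+1) ∉ wVis x i)).card := by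
  induction m with
  | zero => simp [wVis]
  | succ m ih =>
    rw [wVis_succ, Finset.range_add_one, Finset.filter_insert]
    by_cases h : x (m+1) ∈ wVis x m
    · simp [h, ih]
    · rw [Finset.card_insert_of_notMem h, if_pos h, Finset.card_insert_of_notMem (by simp), ih]
      omega

theorem wQ_card {L v w : ℕ} {x : ℕ → α} {B S : Finset ℕ} (g : WGood L v w x B S) :
    ((B ∪ S).filter (fun i => x (i+1) ∈ wVis x i)).card = w := by
  have h1 := wNew_card x L
  rw [g.hcard] at h1
  have h2 : (Finset.range L).filter (fun i => x (i+1) ∉ wVis x i) =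
      (B ∪ S).filter (fun i => x (i+1) ∉ wVis x i) := by
    ext i
    simp only [Finset.mem_filter, Finset.mem_range]
    constructor
    · rintro ⟨hi, hn⟩
      refine ⟨?_, hn⟩
      by_contra hBS
      have hU : i ∈ wU L B S := by 
        unfold wU; rw [Finset.mem_sdiff]; exact ⟨by simpa using hi, hBS⟩
      obtain ⟨j, hj, hji, he⟩ := g.hpart i hU
      apply hn
      have : x (i+1) ∈ wE x j := by rw [he]; simp [wE]
      simp only [wE, Sym2.mem_iff] at this
      rcases this with h | h <;> rw [h] <;> exact Finset.mem_image_of_mem _ (by simp; omega)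
    · rintro ⟨hi, hn⟩
      refine ⟨?_, hn⟩
      rcases Finset.mem_union.1 hi with h | h
      · simpa using g.hB h
      · have := g.hS h; simp at this; exact this.1
  rw [h2] at h1
  have h3 := Finset.card_filter_add_card_filter_not (s := B ∪ S) (fun i => x (i+1) ∈ wVis x i)
  have h4 : (B ∪ S).card = w + (v - 1) := by
    rw [Finset.card_union_of_disjoint, g.hBc, g.hSc]
    rw [Finset.disjoint_right]; intro a ha; have := g.hS ha; simp at this; exact this.2
  have := g.hv
  omega

/-- Labels in order of first visit. -/
theorem exists_lab (x : ℕ → α) (L v : ℕ) (hc : (wVis x L).card = v) :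
    ∃ lab : ℕ → α, x 0 = lab 0 ∧ (∀ i < L, x (i+1) ∉ wVis x i → x (i+1) = lab (wVis x i).card) ∧
      ∀ i ≤ L, ∃ k < v, x i = lab k := by
  classical
  let lab : ℕ → α := fun k => if h : ∃ i, k < (wVis x i).card then x (Nat.find h) else x 0
  have l0 : x 0 = lab 0 := by
    have h : ∃ i, 0 < (wVis x i).card := ⟨0, by simp [wVis]⟩
    simp only [lab, dif_pos h]
    have : Nat.find h = 0 := by rw [Nat.find_eq_zero]; simp [wVis]
    rw [this]
  have l1 : ∀ i, x (i+1) ∉ wVis x i → x (i+1) = lab (wVis x i).card := by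
    intro i hn
    have h : ∃ j, (wVis x i).card < (wVis x j).card := 
      ⟨i+1, by rw [wVis_succ, Finset.card_insert_of_notMem hn]; omega⟩
    simp only [lab, dif_pos h]
    have : Nat.find h = i + 1 := by
      rw [Nat.find_eq_iff]
      refine ⟨by rw [wVis_succ, Finset.card_insert_of_notMem hn]; omega, ?_⟩
      intro k hk
      have := Finset.card_le_card (wVis_mono x (show k ≤ i by omega))
      omega
    rw [this]
  refine ⟨lab, l0, fun i _ => l1 i, ?_⟩
  intro i
  induction i using Nat.strong_induction_on with
  | _ i ih =>
    intro hi
    rcases i with _ | i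
    · refine ⟨0, ?_, l0⟩
      rw [← hc]; exact Finset.card_pos.2 ⟨x 0, Finset.mem_image_of_mem _ (by simp)⟩
    · by_cases hn : x (i+1) ∈ wVis x i
      · obtain ⟨j, hj, he⟩ := Finset.mem_image.1 hn
        simp at hj
        obtain ⟨k, hk, hk2⟩ := ih j (by omega) (by omega)
        exact ⟨k, hk, by rw [← he, hk2]⟩
      · refine ⟨_, ?_, l1 i hn⟩
        have h1 := Finset.card_le_card (wVis_mono x hi)
        rw [wVis_succ, Finset.card_insert_of_notMem hn] at h1
        omega

theorem exists_code {L v w : ℕ} {x : ℕ → α} {B S : Finset ℕ} (g : WGood L v w x B S) [NeZero v] :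
    ∃ (Q : Finset ℕ) (lab : Fin v → α) (σ : Fin (3 * w) → Fin v), Q ∈ Finset.powersetCard w (Finset.range L) ∧
      WSpec L x B S Q (fun k => lab (Fin.ofNat v k)) 
        (fun k => if h : k < 3 * w then σ ⟨k, h⟩ else 0) := by
  classical
  obtain ⟨lab, h0, h1, h2⟩ := exists_lab x L v g.hcard
  set Q := (B ∪ S).filter (fun i => x (i+1) ∈ wVis x i) with hQ
  have hQc : Q.card = w := wQ_card g
  have hA := wAmb_card g
  rw [← hQ, hQc] at hA
  have hQs : Q ⊆ Finset.range L := by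
    intro i hi
    rcases Finset.mem_union.1 (Finset.mem_filter.1 hi).1 with h | h
    · exact g.hB h
    · exact (Finset.mem_sdiff.1 (g.hS h)).1
  choose! idx hidx hidx2 using h2
  set R := (Finset.range L).filter (fun j => j ∈ Q ∨ wAmb L x B S j) with hR
  have hRc : R.card ≤ 3 * w := by
    have : R ⊆ Q ∪ (Finset.range L).filter (fun i => wAmb L x B S i) := by
      intro i hi
      simp only [hR, Finset.mem_filter] at hi
      simp only [Finset.mem_union, Finset.mem_filter]
      tauto
    have := (Finset.card_le_card this).trans (Finset.card_union_le _ _)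
    omega
  -- pointer is injective on `R`
  have hlt : ∀ i j, i ∈ R → i < j → wPtr L x B S Q i < wPtr L x B S Q j := by
    intro i j hi hij
    unfold wPtr
    apply Finset.card_lt_card
    rw [Finset.ssubset_iff_of_subset]
    · refine ⟨i, ?_, ?_⟩
      · simp only [Finset.mem_filter, Finset.mem_range] at hi ⊢
        rw [hR] at hi
        simp only [Finset.mem_filter, Finset.mem_range] at hi
        exact ⟨hij, hi.2⟩
      · simp
    · intro a ha
      simp only [Finset.mem_filter, Finset.mem_range] at ha ⊢
      exact ⟨by omega, ha.2⟩
  have hptr : ∀ i ∈ R, wPtr L x B S Q i < 3 * w := by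
    intro i hi
    have hiL : i < L := by simpa using (Finset.mem_filter.1 hi).1
    refine lt_of_lt_of_le (hlt i L hi hiL) hRc
  let τ : ℕ → ℕ := fun k => if h : ∃ i ∈ R, wPtr L x B S Q i = k then idx (h.choose + 1) else 0
  have hτ : ∀ i ∈ R, τ (wPtr L x B S Q i) = idx (i+1) := by
    intro i hi
    have h : ∃ j ∈ R, wPtr L x B S Q j = wPtr L x B S Q i := ⟨i, hi, rfl⟩
    simp only [τ, dif_pos h]
    have hs := h.choose_spec
    have : h.choose = i := by
      rcases lt_trichotomy h.choose i with hh | hh | hh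
      · have := hlt _ _ hs.1 hh; omega
      · exact hh
      · have := hlt _ _ hi hh; omega
    rw [this]
  have hvpos : 0 < v := Nat.pos_of_ne_zero (NeZero.ne v)
  refine ⟨Q, fun k => lab k, fun k => Fin.ofNat v (τ k), ?_, ?_, ?_, ?_⟩
  · exact Finset.mem_powersetCard.2 ⟨hQs, hQc⟩
  · simpa using h0
  · intro i hi hBS hiQ
    have hn : x (i+1) ∉ wVis x i := fun h => hiQ (Finset.mem_filter.2 ⟨hBS, h⟩)
    have h1' := Finset.card_le_card (wVis_mono x (show i + 1 ≤ L by omega))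
    rw [wVis_succ, Finset.card_insert_of_notMem hn, g.hcard] at h1'
    rw [h1 i hi hn]
    simp only [Fin.val_ofNat]
    rw [Nat.mod_eq_of_lt (by omega)]
  · intro i hi hQA
    have hiR : i ∈ R := Finset.mem_filter.2 ⟨by simpa using hi, hQA⟩
    have hp := hptr i hiR
    simp only [dif_pos hp, Fin.val_ofNat]
    rw [hτ i hiR, Nat.mod_mod, Nat.mod_eq_of_lt (hidx (i+1) (by omega))]
    exact hidx2 (i+1) (by omega)

end WalkCoding

section Forest

/-- Binary trees: triangulated polygons hanging on an edge. -/
inductive BT : Type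
  | leaf : BT
  | node : BT → BT → BT

namespace BT

def leaves : BT → ℕ
  | leaf => 1
  | node l r => leaves l + leaves r

theorem leaves_pos : ∀ t : BT, 0 < t.leaves
  | leaf => by simp [leaves]
  | node l r => by have := leaves_pos l; simp only [leaves]; omega

def tri : BT → ℕ → List (ℕ × ℕ × ℕ)
  | leaf, _ => []
  | node l r, o => (o, o + l.leaves, o + l.leaves + r.leaves) :: (tri l o ++ tri r (o + l.leaves))

def grow : BT → ℕ → BT
  | leaf, _ => node leaf leaf
  | node l r, i => if i < l.leaves then node (grow l i) r else node l (grow r (i - l.leaves))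

def word : BT → List Bool
  | leaf => [false]
  | node l r => true :: (word l ++ word r)

theorem word_length : ∀ t : BT, t.word.length + 1 = 2 * t.leaves
  | leaf => by simp [leaves, word]
  | node l r => by
    have := word_length l; have := word_length r
    simp only [leaves, word, List.length_cons, List.length_append]; omega

theorem word_inj : ∀ (t t' : BT) (r r' : List Bool), t.word ++ r = t'.word ++ r' → t = t' ∧ r = r'
  | leaf, leaf, r, r', h => by simpa [word] using h
  | leaf, node _ _, r, r', h => by simp [word] at h
  | node _ _, leaf, r, r', h => by simp [word] at h
  | node a b, node a' b', r, r', h => by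
    simp only [word, List.cons_append, List.cons.injEq, true_and, List.append_assoc] at h
    obtain ⟨rfl, h1⟩ := word_inj a a' _ _ h
    obtain ⟨rfl, h2⟩ := word_inj b b' _ _ h1
    exact ⟨rfl, h2⟩

theorem leaves_grow : ∀ (t : BT) (i : ℕ), (t.grow i).leaves = t.leaves + 1
  | leaf, _ => by simp [grow, leaves]
  | node l r, i => by
    have := leaves_grow l i; have := leaves_grow r (i - l.leaves)
    simp only [grow]; split_ifs <;> simp only [leaves] <;> omega

theorem tri_bound : ∀ (t : BT) (o : ℕ) (q : ℕ × ℕ × ℕ), q ∈ t.tri o →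
    o ≤ q.1 ∧ o ≤ q.2.1 ∧ o ≤ q.2.2 ∧ q.1 ≤ o + t.leaves ∧ q.2.1 ≤ o + t.leaves ∧ q.2.2 ≤ o + t.leaves
  | leaf, _, _, h => by simp [tri] at h
  | node l r, o, q, h => by
    simp only [tri, List.mem_cons, List.mem_append] at h
    simp only [leaves]
    rcases h with rfl | h | h
    · simp; omega
    · have := tri_bound l _ _ h; omega
    · have := tri_bound r _ _ h; omega

theorem tri_succ : ∀ (t : BT) (o : ℕ), t.tri (o + 1) = (t.tri o).map (fun q => (q.1 + 1, q.2.1 + 1, q.2.2 + 1))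
  | leaf, _ => by simp [tri]
  | node l r, o => by
    have h1 := tri_succ l o
    have h2 := tri_succ r (o + l.leaves)
    simp only [tri, List.map_cons, List.map_append]
    rw [h1, show o + 1 + l.leaves = o + l.leaves + 1 by ring, h2]
    congr 1
    simp; omega

end BT

/-- Shift of positions when inserting a position after `i`. -/
def sh (i p : ℕ) : ℕ := if p ≤ i then p else p + 1

def sh3 (i : ℕ) (q : ℕ × ℕ × ℕ) : ℕ × ℕ × ℕ := (sh i q.1, sh i q.2.1, sh i q.2.2)

theorem sh_le {i p : ℕ} (h : p ≤ i) : sh i p = p := by simp [sh, h]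
theorem sh_gt {i p : ℕ} (h : i < p) : sh i p = p + 1 := by simp [sh]; omega

theorem map_sh3_le {i : ℕ} {l : List (ℕ × ℕ × ℕ)} (h : ∀ q ∈ l, q.1 ≤ i ∧ q.2.1 ≤ i ∧ q.2.2 ≤ i) :
    l.map (sh3 i) = l := by
  conv_rhs => rw [← List.map_id l]
  apply List.map_congr_left
  intro q hq
  obtain ⟨a, b, c⟩ := h q hq
  simp [sh3, sh_le a, sh_le b, sh_le c]

theorem map_sh3_gt {i : ℕ} {l : List (ℕ × ℕ × ℕ)} (h : ∀ q ∈ l, i < q.1 ∧ i < q.2.1 ∧ i < q.2.2) :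
    l.map (sh3 i) = l.map (fun q => (q.1 + 1, q.2.1 + 1, q.2.2 + 1)) := by
  apply List.map_congr_left
  intro q hq
  obtain ⟨a, b, c⟩ := h q hq
  simp [sh3, sh_gt a, sh_gt b, sh_gt c]

theorem BT.tri_grow : ∀ (t : BT) (o i : ℕ), i < t.leaves → 
    ((t.grow i).tri o).Perm ((o + i, o + i + 1, o + i + 2) :: (t.tri o).map (sh3 (o + i)))
  | leaf, o, i, h => by
    simp only [leaves] at h
    obtain rfl : i = 0 := by omega
    simp [grow, tri, leaves]
  | node l r, o, i, h => by
    simp only [leaves] at h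
    simp only [grow]
    split_ifs with hi
    · have ih := BT.tri_grow l o i hi
      simp only [tri, leaves_grow]
      rw [show o + (l.leaves + 1) = o + l.leaves + 1 by ring, tri_succ]
      rw [List.map_cons, List.map_append, map_sh3_gt (l := r.tri (o + l.leaves))
        (fun q hq => by have := tri_bound r _ _ hq; omega)]
      have e : sh3 (o + i) (o, o + l.leaves, o + l.leaves + r.leaves) =
        (o, o + l.leaves + 1, o + l.leaves + 1 + r.leaves) := by
        have := leaves_pos r
        simp only [sh3]
        rw [sh_le (by omega), sh_gt (by omega), sh_gt (by omega)]
        simp; omega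
      rw [e]
      refine (List.Perm.cons _ (ih.append_right _)).trans ?_
      rw [List.cons_append]
      exact List.Perm.swap _ _ _
    · have ih := BT.tri_grow r (o + l.leaves) (i - l.leaves) (by omega)
      simp only [tri, leaves_grow]
      rw [show o + l.leaves + (i - l.leaves) = o + i by omega] at ih
      rw [List.map_cons, List.map_append, map_sh3_le (l := l.tri o)
        (fun q hq => by have := tri_bound l _ _ hq; omega)]
      have e : sh3 (o + i) (o, o + l.leaves, o + l.leaves + r.leaves) =
        (o, o + l.leaves, o + l.leaves + (r.leaves + 1)) := by
        simp only [sh3]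
        rw [sh_le (by omega), sh_le (by omega), sh_gt (by omega)]
        simp; omega
      rw [e]
      refine (List.Perm.cons _ (ih.append_left _)).trans ?_
      refine (List.Perm.cons _ List.perm_middle).trans ?_
      exact List.Perm.swap _ _ _

def fLeaves : List BT → ℕ
  | [] => 0
  | t :: ts => t.leaves + fLeaves ts

def fTri : List BT → ℕ → List (ℕ × ℕ × ℕ)
  | [], _ => []
  | t :: ts, o => t.tri o ++ fTri ts (o + t.leaves)

def fGrow : List BT → ℕ → List BT
  | [], _ => []
  | t :: ts, i => if i < t.leaves then t.grow i :: ts else t :: fGrow ts (i - t.leaves)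

def fWord : List BT → List Bool
  | [] => []
  | t :: ts => t.word ++ fWord ts

theorem fWord_length : ∀ F : List BT, (fWord F).length + F.length = 2 * fLeaves F
  | [] => by simp [fWord, fLeaves]
  | t :: ts => by
    have := fWord_length ts; have := t.word_length
    simp only [fWord, fLeaves, List.length_append, List.length_cons]; omega

theorem fWord_inj : ∀ F F' : List BT, fWord F = fWord F' → F = F'
  | [], [], _ => rfl
  | [], t :: ts, h => by
    exfalso
    have h1 := congrArg List.length h
    have h2 := t.word_length
    have h3 := t.leaves_pos
    simp only [fWord, List.length_append, List.length_nil] at h1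
    omega
  | t :: ts, [], h => by
    exfalso
    have h1 := congrArg List.length h
    have h2 := t.word_length
    have h3 := t.leaves_pos
    simp only [fWord, List.length_append, List.length_nil] at h1
    omega
  | t :: ts, t' :: ts', h => by
    obtain ⟨rfl, h2⟩ := BT.word_inj _ _ _ _ h
    rw [fWord_inj ts ts' h2]

theorem fGrow_length : ∀ (F : List BT) (i : ℕ), (fGrow F i).length = F.length
  | [], _ => by simp [fGrow]
  | t :: ts, i => by
    have := fGrow_length ts (i - t.leaves)
    simp only [fGrow]; split_ifs <;> simp [this]

theorem fLeaves_grow : ∀ (F : List BT) (i : ℕ), i < fLeaves F → fLeaves (fGrow F i) = fLeaves F + 1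
  | [], _, h => by simp [fLeaves] at h
  | t :: ts, i, h => by
    simp only [fLeaves] at h
    simp only [fGrow]
    split_ifs with hi
    · simp only [fLeaves, BT.leaves_grow]; omega
    · have := fLeaves_grow ts (i - t.leaves) (by omega)
      simp only [fLeaves]; omega

theorem fTri_bound : ∀ (F : List BT) (o : ℕ) (q : ℕ × ℕ × ℕ), q ∈ fTri F o →
    o ≤ q.1 ∧ o ≤ q.2.1 ∧ o ≤ q.2.2 ∧ q.1 ≤ o + fLeaves F ∧ q.2.1 ≤ o + fLeaves F ∧ q.2.2 ≤ o + fLeaves F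
  | [], _, _, h => by simp [fTri] at h
  | t :: ts, o, q, h => by
    simp only [fTri, List.mem_append] at h
    simp only [fLeaves]
    rcases h with h | h
    · have := t.tri_bound _ _ h; omega
    · have := fTri_bound ts _ _ h; omega

theorem fTri_succ : ∀ (F : List BT) (o : ℕ), fTri F (o + 1) = (fTri F o).map (fun q => (q.1 + 1, q.2.1 + 1, q.2.2 + 1))
  | [], _ => by simp [fTri]
  | t :: ts, o => by
    have h2 := fTri_succ ts (o + t.leaves)
    simp only [fTri, List.map_append]
    rw [BT.tri_succ, show o + 1 + t.leaves = o + t.leaves + 1 by ring, h2]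

/-- first vertex of every face of a right tail lies strictly to the right -/
theorem fTri_grow : ∀ (F : List BT) (o i : ℕ), i < fLeaves F →
    (fTri (fGrow F i) o).Perm ((o + i, o + i + 1, o + i + 2) :: (fTri F o).map (sh3 (o + i)))
  | [], _, _, h => by simp [fLeaves] at h
  | t :: ts, o, i, h => by
    simp only [fLeaves] at h
    simp only [fGrow]
    split_ifs with hi
    · have ih := BT.tri_grow t o i hi
      simp only [fTri, BT.leaves_grow]
      rw [show o + (t.leaves + 1) = o + t.leaves + 1 by ring, fTri_succ]
      rw [List.map_append, map_sh3_gt (l := fTri ts (o + t.leaves))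
        (fun q hq => by have := fTri_bound ts _ _ hq; omega)]
      exact ih.append_right _
    · have ih := fTri_grow ts (o + t.leaves) (i - t.leaves) (by omega)
      simp only [fTri]
      rw [show o + t.leaves + (i - t.leaves) = o + i by omega] at ih
      rw [List.map_append, map_sh3_le (l := t.tri o)
        (fun q hq => by have := t.tri_bound _ _ hq; omega)]
      exact (ih.append_left _).trans List.perm_middle

theorem fTri_replicate_leaf (m : ℕ) : ∀ o, fTri (List.replicate m BT.leaf) o = [] := by
  induction m with
  | zero => intro o; simp [fTri]
  | succ m ih => intro o; simp [List.replicate_succ, fTri, BT.tri, ih]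

theorem fLeaves_replicate_leaf (m : ℕ) : fLeaves (List.replicate m BT.leaf) = m := by
  induction m with
  | zero => simp [fLeaves]
  | succ m ih => simp [List.replicate_succ, fLeaves, BT.leaves, ih]; omega

end Forest

section Invariant

/-- The identifier at (cyclic) boundary position `p`. -/
def bp (D : DiagState V) (p : ℕ) : ℕ := D.boundary.getD (p % D.boundary.length) 0

/-- The label edge at boundary position `p`. -/
def posEdge (D : DiagState V) (p : ℕ) : Sym2 V := s(D.label (bp D p), D.label (bp D (p + 1)))

theorem bp_lt {D : DiagState V} (h : ∀ y ∈ D.boundary, y < D.nv) (hpos : 0 < D.boundary.length) (p : ℕ) :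
    bp D p < D.nv := by
  unfold bp
  have : p % D.boundary.length < D.boundary.length := Nat.mod_lt _ hpos
  rw [List.getD_eq_getElem _ _ this]
  exact h _ (List.getElem_mem _)

theorem bp_glue_le {D : DiagState V} {i : ℕ} {c : V} (hi : i < D.boundary.length) {p : ℕ} (hp : p ≤ i) :
    bp (glueResult D i c) p = bp D p := by
  have h1 : (glueResult D i c).boundary.length = D.boundary.length + 1 := by
    simp [glueResult]; omega
  unfold bp
  rw [h1, Nat.mod_eq_of_lt (by omega), Nat.mod_eq_of_lt (by omega)]
  simp only [glueResult]
  rw [List.getD_append _ _ _ _ (by simp; omega)]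
  rw [List.getD_eq_getElem _ _ (by simp; omega), List.getD_eq_getElem _ _ (by omega)]
  simp

theorem bp_glue_mid {D : DiagState V} {i : ℕ} {c : V} (hi : i < D.boundary.length) :
    bp (glueResult D i c) (i + 1) = D.nv := by
  have h1 : (glueResult D i c).boundary.length = D.boundary.length + 1 := by
    simp [glueResult]; omega
  unfold bp
  rw [h1, Nat.mod_eq_of_lt (by omega)]
  simp only [glueResult]
  rw [List.getD_append_right _ _ _ _ (by simp)]
  rw [show i + 1 - (List.take (i+1) D.boundary).length = 0 by simp; omega]
  simp

theorem bp_glue_gt {D : DiagState V} {i : ℕ} {c : V} (hi : i < D.boundary.length) {p : ℕ} (hp : i < p)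
    (hpL : p ≤ D.boundary.length) :
    bp (glueResult D i c) (p + 1) = bp D p := by
  have h1 : (glueResult D i c).boundary.length = D.boundary.length + 1 := by
    simp [glueResult]; omega
  rcases Nat.lt_or_ge p D.boundary.length with h | h
  · unfold bp
    rw [h1, Nat.mod_eq_of_lt (by omega), Nat.mod_eq_of_lt (by omega)]
    simp only [glueResult]
    rw [List.getD_append_right _ _ _ _ (by simp; omega)]
    rw [show p + 1 - (List.take (i+1) D.boundary).length = (p - (i + 1)) + 1 by simp; omega]
    rw [List.getD_cons_succ]
    rw [List.getD_eq_getElem _ _ (by simp; omega), List.getD_eq_getElem _ _ (by omega)]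
    simp only [List.getElem_drop]
    congr 1; omega
  · obtain rfl : p = D.boundary.length := by omega
    have e1 : bp (glueResult D i c) (D.boundary.length + 1) = bp (glueResult D i c) 0 := by
      unfold bp; rw [h1]; simp
    have e2 : bp D D.boundary.length = bp D 0 := by
      unfold bp; simp
    rw [e1, e2]
    exact bp_glue_le hi (Nat.zero_le _)

theorem bp_glue_sh {D : DiagState V} {i : ℕ} {c : V} (hi : i < D.boundary.length) {p : ℕ} 
    (hpL : p ≤ D.boundary.length) :
    bp (glueResult D i c) (sh i p) = bp D p := by
  unfold sh
  split_ifs with h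
  · exact bp_glue_le hi h
  · exact bp_glue_gt hi (by omega) hpL

theorem bp_inj {D : DiagState V} (nd : D.boundary.Nodup) {p q : ℕ} (hp : p < D.boundary.length)
    (hq : q < D.boundary.length) (h : bp D p = bp D q) : p = q := by
  unfold bp at h
  rw [Nat.mod_eq_of_lt hp, Nat.mod_eq_of_lt hq, List.getD_eq_getElem _ _ hp, 
    List.getD_eq_getElem _ _ hq] at h
  exact (List.Nodup.getElem_inj_iff nd).1 h

theorem bp_succ_ne {D : DiagState V} (nd : D.boundary.Nodup) {p : ℕ} (h2 : 2 ≤ D.boundary.length)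
    (hp : p < D.boundary.length) : bp D p ≠ bp D (p+1) := by
  intro h
  rcases Nat.lt_or_ge (p+1) D.boundary.length with h1 | h1
  · have := bp_inj nd hp h1 h; omega
  · have : bp D (p+1) = bp D 0 := by
      unfold bp; rw [show p + 1 = D.boundary.length by omega]; simp
    rw [this] at h
    have := bp_inj nd hp (by omega) h
    omega

theorem bp_edge_inj {D : DiagState V} (nd : D.boundary.Nodup) (h3 : 3 ≤ D.boundary.length) {p q : ℕ} 
    (hp : p < D.boundary.length)
    (hq : q < D.boundary.length) (h : s(bp D p, bp D (p+1)) = s(bp D q, bp D (q+1))) : p = q := by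
  have hw : ∀ r < D.boundary.length, ∃ r' < D.boundary.length, bp D (r+1) = bp D r' ∧
      (r' = r + 1 ∨ (r' = 0 ∧ r + 1 = D.boundary.length)) := by
    intro r hr
    rcases Nat.lt_or_ge (r+1) D.boundary.length with h1 | h1
    · exact ⟨r+1, h1, rfl, Or.inl rfl⟩
    · refine ⟨0, by omega, ?_, Or.inr ⟨rfl, by omega⟩⟩
      unfold bp; rw [show r + 1 = D.boundary.length by omega]; simp
  obtain ⟨p', hp', ep, cp⟩ := hw p hp
  obtain ⟨q', hq', eq, cq⟩ := hw q hq
  rw [ep, eq, Sym2.eq_iff] at h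
  rcases h with ⟨h, _⟩ | ⟨h1, h2⟩
  · exact bp_inj nd hp hq h
  · have := bp_inj nd hp hq' h1
    have := bp_inj nd hp' hq h2
    omega

/-- Number of triangles in the list containing `e` as a non-activated edge. -/
def conL (rest : List (V × V × V)) (e : Sym2 V) : ℕ :=
  rest.countP (fun st => decide (e = s(st.1, st.2.2) ∨ e = s(st.2.1, st.2.2)))

open scoped Classical in
structure DInv (ℓ : ℕ) (H K : Set (Sym2 V)) (C : Set (Sym2 V)) (rest : List (V × V × V)) 
    (D : DiagState V) : Prop where
  len : D.boundary.length = D.nv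
  nd : D.boundary.Nodup
  lt : ∀ y ∈ D.boundary, y < D.nv
  nv : D.nv = ℓ + rest.length
  mkd : ∀ f ∈ D.marked, ∃ p < D.nv, f = s(bp D p, bp D (p+1))
  faces : ∃ F : List BT, F.length = ℓ ∧ fLeaves F = D.nv ∧ 
    faceSets D = {t | ∃ q ∈ fTri F 0, t = ({bp D q.1, bp D q.2.1, bp D q.2.2} : Finset ℕ)}
  inK : ∀ p < D.nv, posEdge D p ∈ K
  uniq : ∀ e ∈ H, ∀ f ∈ D.marked, ∀ g ∈ D.marked, Sym2.map D.label f = e → Sym2.map D.label g = e → f = g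
  ex : ∀ e ∈ H, ∀ p < D.nv, posEdge D p = e → ∃ f ∈ D.marked, Sym2.map D.label f = e
  cnt : ∀ e ∈ H, (if e ∈ C then 1 else 0) + conL rest e ≤ 
    ((Finset.range D.nv).filter (fun p => posEdge D p = e)).card

theorem filter_card_sh {L i : ℕ} (hi : i < L) (P P' : ℕ → Prop) [DecidablePred P] [DecidablePred P']
    (hP : ∀ p < L, p ≠ i → (P' (sh i p) ↔ P p)) (hPi : ¬ P i) :
    ((Finset.range (L + 1)).filter P').card = ((Finset.range L).filter P).card + 
      (if P' i then 1 else 0) + if P' (i+1) then 1 else 0 := by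
  have hinj : Function.Injective (sh i) := by
    intro a b; unfold sh; split_ifs <;> omega
  have h1 : (Finset.range (L + 1)).filter P' = 
      ((Finset.range L).filter P).image (sh i) ∪ ({i, i+1} : Finset ℕ).filter P' := by
    ext p
    simp only [Finset.mem_filter, Finset.mem_range, Finset.mem_union, Finset.mem_image,
      Finset.mem_insert, Finset.mem_singleton]
    constructor
    · rintro ⟨hp, hP'⟩
      by_cases h : p = i ∨ p = i + 1
      · exact Or.inr ⟨h, hP'⟩
      · push Not at h
        left
        rcases Nat.lt_or_ge p i with h2 | h2
        · refine ⟨p, ⟨by omega, (hP p (by omega) (by omega)).1 ?_⟩, sh_le h2.le⟩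
          rwa [sh_le h2.le]
        · have e : sh i (p - 1) = p := by rw [sh_gt (by omega)]; omega
          refine ⟨p - 1, ⟨by omega, (hP (p-1) (by omega) (by omega)).1 ?_⟩, e⟩
          rwa [e]
    · rintro (⟨q, ⟨hq, hPq⟩, rfl⟩ | ⟨h, h'⟩)
      · have hqi : q ≠ i := by rintro rfl; exact hPi hPq
        exact ⟨by unfold sh; split_ifs <;> omega, (hP q hq hqi).2 hPq⟩
      · exact ⟨by omega, h'⟩
  rw [h1, Finset.card_union_of_disjoint, Finset.card_image_of_injective _ hinj, add_assoc]
  · congr 1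
    rw [Finset.card_filter, Finset.sum_pair (by omega)]
  · rw [Finset.disjoint_left]
    intro p hp hp2
    simp only [Finset.mem_filter, Finset.mem_range, Finset.mem_image,
      Finset.mem_insert, Finset.mem_singleton] at hp hp2
    obtain ⟨q, ⟨hq, hPq⟩, rfl⟩ := hp
    have hqi : q ≠ i := by rintro rfl; exact hPi hPq
    have := hp2.1
    unfold sh at this
    split_ifs at this <;> omega

theorem DInv.glue {ℓ : ℕ} {H K C : Set (Sym2 V)} {rest : List (V × V × V)} {D : DiagState V}
    (I : DInv ℓ H K C rest D) (hℓ : 3 ≤ ℓ) {a b c : V} (hab : a ≠ b) (hH : s(a, b) ∉ H)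
    (hac : s(a, c) ∈ K) (hbc : s(b, c) ∈ K) {D' : DiagState V} (hg : GlueStep D D' a b c) :
    DInv ℓ H K C ((a, b, c) :: rest) D' := by
  classical
  obtain ⟨i, hi, hmk, hlab, rfl⟩ := hg
  have hL3 : 3 ≤ D.nv := by have := I.nv; omega
  have hpos : 0 < D.boundary.length := by have := I.len; omega
  have hu : D.boundary.getD i 0 = bp D i := by unfold bp; rw [Nat.mod_eq_of_lt hi]
  have hv : D.boundary.getD ((i + 1) % D.boundary.length) 0 = bp D (i+1) := rfl
  set D' := glueResult D i c with hD'
  have hmarked : D'.marked = glueMarked D (bp D i) (bp D (i+1)) c := by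
    rw [← hu, ← hv]; rfl
  rw [hu, hv] at hmk hlab
  have hnv : D'.nv = D.nv + 1 := rfl
  have hlen : D'.boundary.length = D.boundary.length + 1 := by
    simp [hD', glueResult]; omega
  have iL : i < D.nv := by rw [← I.len]; exact hi
  have hlt := fun p => bp_lt I.lt hpos p
  have lab_old : ∀ y < D.nv, D'.label y = D.label y := by
    intro y hy
    simp only [hD', glueResult]
    rw [Function.update_of_ne (by omega)]
  have lab_new : D'.label D.nv = c := by simp [hD', glueResult]
  have b_le : ∀ {p}, p ≤ i → bp D' p = bp D p := fun h => bp_glue_le hi h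
  have b_mid : bp D' (i+1) = D.nv := bp_glue_mid hi
  have b_gt : ∀ {p}, i < p → p ≤ D.nv → bp D' (p+1) = bp D p := 
    fun h h' => bp_glue_gt hi h (by rw [I.len]; exact h')
  -- edges at old positions
  have old_edge : ∀ p < D.nv, p ≠ i → bp D' (sh i p) = bp D p ∧ bp D' (sh i p + 1) = bp D (p+1) := by
    intro p hp hpi
    refine ⟨bp_glue_sh hi (by rw [I.len]; omega), ?_⟩
    rcases Nat.lt_or_ge p i with h | h
    · rw [sh_le h.le]; exact b_le (by omega)
    · rw [sh_gt (by omega)]; exact b_gt (by omega) (by omega)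
  have old_lab : ∀ p < D.nv, p ≠ i → posEdge D' (sh i p) = posEdge D p := by
    intro p hp hpi
    obtain ⟨h1, h2⟩ := old_edge p hp hpi
    unfold posEdge; rw [h1, h2, lab_old _ (hlt _), lab_old _ (hlt _)]
  have li : posEdge D' i = s(D.label (bp D i), c) := by
    unfold posEdge; rw [b_le le_rfl, b_mid, lab_new, lab_old _ (hlt _)]
  have li1 : posEdge D' (i+1) = s(D.label (bp D (i+1)), c) := by
    unfold posEdge; rw [b_mid, b_gt (by omega) (by omega), lab_new, lab_old _ (hlt _), Sym2.eq_swap]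
  have pos_cases : ∀ q < D.nv + 1, q = i ∨ q = i + 1 ∨ ∃ p < D.nv, p ≠ i ∧ q = sh i p := by
    intro q hq
    rcases lt_trichotomy q i with h | h | h
    · exact Or.inr (Or.inr ⟨q, by omega, by omega, (sh_le h.le).symm⟩)
    · exact Or.inl h
    · by_cases h2 : q = i + 1
      · exact Or.inr (Or.inl h2)
      · exact Or.inr (Or.inr ⟨q - 1, by omega, by omega, by rw [sh_gt (by omega)]; omega⟩)
  have hneq : D.label (bp D i) ≠ D.label (bp D (i+1)) := by
    intro h
    rw [h] at hlab
    rw [Sym2.eq_iff] at hlab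
    rcases hlab with ⟨h1, h2⟩ | ⟨h1, h2⟩
    · exact hab (h1.symm.trans h2)
    · exact hab (h2.symm.trans h1)
  -- label maps on marked edges
  have map_old : ∀ f ∈ D.marked, Sym2.map D'.label f = Sym2.map D.label f := by
    intro f hf
    obtain ⟨p, hp, rfl⟩ := I.mkd f hf
    simp only [Sym2.map_mk]
    rw [lab_old _ (hlt _), lab_old _ (hlt _)]
  have mapn : ∀ p, Sym2.map D'.label s(bp D p, D.nv) = s(D.label (bp D p), c) := by
    intro p; simp only [Sym2.map_mk]; rw [lab_new, lab_old _ (hlt _)]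
  have hmem : ∀ f, f ∈ D'.marked ↔ (f ∈ D.marked ∧ f ≠ s(bp D i, bp D (i+1))) ∨
      (f = s(bp D i, D.nv) ∧ ¬ ∃ e ∈ D.marked, Sym2.map D.label e = s(D.label (bp D i), c)) ∨
      (f = s(bp D (i+1), D.nv) ∧ ¬ ∃ e ∈ D.marked, Sym2.map D.label e = s(D.label (bp D (i+1)), c)) := by
    intro f; rw [hmarked]; simp only [glueMarked, Set.mem_union, Set.mem_sdiff, Set.mem_singleton_iff,
      Set.mem_ofPred_eq, ne_eq]
  refine ⟨?_, ?_, ?_, ?_, ?_, ?_, ?_, ?_, ?_, ?_⟩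
  · rw [hlen, I.len]; rfl
  · have hp : (D.boundary.take (i + 1) ++ D.nv :: D.boundary.drop (i + 1)).Perm (D.nv :: D.boundary) := by
      refine List.perm_middle.trans ?_
      rw [List.take_append_drop]
    show (D.boundary.take (i + 1) ++ D.nv :: D.boundary.drop (i + 1)).Nodup
    rw [hp.nodup_iff, List.nodup_cons]
    exact ⟨fun h => absurd (I.lt _ h) (lt_irrefl _), I.nd⟩
  · intro y hy
    have hy : y ∈ D.boundary.take (i + 1) ++ D.nv :: D.boundary.drop (i + 1) := hy
    rw [hnv]
    rw [List.mem_append, List.mem_cons] at hy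
    rcases hy with h | h | h
    · have := I.lt _ (List.mem_of_mem_take h); omega
    · omega
    · have := I.lt _ (List.mem_of_mem_drop h); omega
  · rw [hnv, I.nv]; simp; omega
  · intro f hf
    rw [hmem] at hf
    rcases hf with ⟨hf, hne⟩ | ⟨rfl, _⟩ | ⟨rfl, _⟩
    · obtain ⟨p, hp, rfl⟩ := I.mkd f hf
      have hpi : p ≠ i := by rintro rfl; exact hne rfl
      obtain ⟨h1, h2⟩ := old_edge p hp hpi
      exact ⟨sh i p, by rw [hnv]; unfold sh; split_ifs <;> omega, by rw [h1, h2]⟩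
    · exact ⟨i, by omega, by rw [b_le le_rfl, b_mid]⟩
    · exact ⟨i+1, by omega, by rw [b_mid, b_gt (by omega) (by omega), Sym2.eq_swap]⟩
  · obtain ⟨F, hF1, hF2, hF3⟩ := I.faces
    refine ⟨fGrow F i, by rw [fGrow_length, hF1], by rw [fLeaves_grow F i (by omega), hF2]; rfl, ?_⟩
    have hp := fTri_grow F 0 i (by omega)
    have e1 : faceSets D' = insert ({bp D i, bp D (i+1), D.nv} : Finset ℕ) (faceSets D) := by
      ext t
      have : D'.faces = (bp D i, bp D (i+1), D.nv) :: D.faces := by rw [← hu, ← hv]; rfl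
      simp only [faceSets, this, List.mem_cons, Set.mem_ofPred_eq, Set.mem_insert_iff]
      constructor
      · rintro ⟨q, rfl | h, rfl⟩
        · exact Or.inl rfl
        · exact Or.inr ⟨q, h, rfl⟩
      · rintro (rfl | ⟨q, h, rfl⟩)
        · exact ⟨_, Or.inl rfl, rfl⟩
        · exact ⟨q, Or.inr h, rfl⟩
    rw [e1, hF3]
    have hs : ∀ q ∈ fTri F 0, bp D' (sh i q.1) = bp D q.1 ∧ bp D' (sh i q.2.1) = bp D q.2.1 ∧ 
        bp D' (sh i q.2.2) = bp D q.2.2 := by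
      intro q hq
      have := fTri_bound F 0 q hq
      have := I.len
      exact ⟨bp_glue_sh hi (by omega), bp_glue_sh hi (by omega), bp_glue_sh hi (by omega)⟩
    have e2 : ({bp D i, bp D (i+1), D.nv} : Finset ℕ) = {bp D' i, bp D' (i+1), bp D' (i+2)} := by
      rw [b_le le_rfl, b_mid, b_gt (p := i+1) (by omega) (by omega)]
      ext y; simp only [Finset.mem_insert, Finset.mem_singleton]; tauto
    ext t
    simp only [Set.mem_insert_iff, Set.mem_ofPred_eq, hp.mem_iff, List.mem_cons, List.mem_map, zero_add]
    constructor
    · rintro (rfl | ⟨q, hq, rfl⟩)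
      · exact ⟨_, Or.inl rfl, e2⟩
      · obtain ⟨h1, h2, h3⟩ := hs q hq
        exact ⟨_, Or.inr ⟨q, hq, rfl⟩, by simp only [sh3]; rw [h1, h2, h3]⟩
    · rintro ⟨_, rfl | ⟨q, hq, rfl⟩, rfl⟩
      · exact Or.inl e2.symm
      · obtain ⟨h1, h2, h3⟩ := hs q hq
        exact Or.inr ⟨q, hq, by simp only [sh3]; rw [h1, h2, h3]⟩
  · intro q hq
    have hac' : s(D.label (bp D i), c) ∈ K ∧ s(D.label (bp D (i+1)), c) ∈ K := by
      rw [Sym2.eq_iff] at hlab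
      rcases hlab with ⟨h1, h2⟩ | ⟨h1, h2⟩ <;> rw [h1, h2] <;> exact ⟨by assumption, by assumption⟩
    rcases pos_cases q hq with rfl | rfl | ⟨p, hp, hpi, rfl⟩
    · rw [li]; exact hac'.1
    · rw [li1]; exact hac'.2
    · rw [old_lab p hp hpi]; exact I.inK p hp
  · intro e he f hf g hg hfe hge
    rw [hmem] at hf hg
    rcases hf with ⟨hf, _⟩ | ⟨rfl, hf⟩ | ⟨rfl, hf⟩ <;> rcases hg with ⟨hg, _⟩ | ⟨rfl, hg⟩ | ⟨rfl, hg⟩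
    · rw [map_old _ hf] at hfe; rw [map_old _ hg] at hge
      exact I.uniq e he f hf g hg hfe hge
    · rw [map_old _ hf] at hfe; rw [mapn] at hge
      exact absurd ⟨f, hf, hfe.trans hge.symm⟩ hg
    · rw [map_old _ hf] at hfe; rw [mapn] at hge
      exact absurd ⟨f, hf, hfe.trans hge.symm⟩ hg
    · rw [map_old _ hg] at hge; rw [mapn] at hfe
      exact absurd ⟨g, hg, hge.trans hfe.symm⟩ hf
    · rfl
    · rw [mapn] at hfe hge
      exact absurd (Sym2.congr_left.1 (hfe.trans hge.symm)) hneq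
    · rw [map_old _ hg] at hge; rw [mapn] at hfe
      exact absurd ⟨g, hg, hge.trans hfe.symm⟩ hf
    · rw [mapn] at hfe hge
      exact absurd (Sym2.congr_left.1 (hge.trans hfe.symm)) hneq
    · rfl
  · intro e he q hq hqe
    have keep : (∃ f ∈ D.marked, Sym2.map D.label f = e) → ∃ f ∈ D'.marked, Sym2.map D'.label f = e := by
      rintro ⟨f, hf, hfe⟩
      refine ⟨f, (hmem f).2 (Or.inl ⟨hf, ?_⟩), by rw [map_old f hf, hfe]⟩
      rintro rfl
      apply hH
      rw [← hlab, ← Sym2.map_mk, hfe]; exact he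
    rcases pos_cases q hq with rfl | rfl | ⟨p, hp, hpi, rfl⟩
    · rw [li] at hqe
      by_cases h : ∃ f ∈ D.marked, Sym2.map D.label f = e
      · exact keep h
      · rw [← hqe] at h
        exact ⟨_, (hmem _).2 (Or.inr (Or.inl ⟨rfl, h⟩)), by rw [mapn, hqe]⟩
    · rw [li1] at hqe
      by_cases h : ∃ f ∈ D.marked, Sym2.map D.label f = e
      · exact keep h
      · rw [← hqe] at h
        exact ⟨_, (hmem _).2 (Or.inr (Or.inr ⟨rfl, h⟩)), by rw [mapn, hqe]⟩
    · rw [old_lab p hp hpi] at hqe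
      exact keep (I.ex e he p hp hqe)
  · intro e he
    have h0 := I.cnt e he
    rw [hnv]
    have h1 := filter_card_sh iL (fun p => posEdge D p = e) (fun p => posEdge D' p = e)
      (fun p hp hpi => by rw [old_lab p hp hpi]) (by
        show ¬ (posEdge D i = e)
        intro h; apply hH; rw [← hlab]
        have : posEdge D i = s(D.label (bp D i), D.label (bp D (i+1))) := rfl
        rw [← this, h]; exact he)
    rw [h1]
    simp only [li, li1]
    have h2 : conL ((a, b, c) :: rest) e = conL rest e + 
        if (e = s(a,c) ∨ e = s(b,c)) then 1 else 0 := by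
      unfold conL; rw [List.countP_cons]; simp
    rw [h2]
    have h3 : (if (e = s(a,c) ∨ e = s(b,c)) then 1 else 0) ≤ 
        (if s(D.label (bp D i), c) = e then 1 else 0) + 
          (if s(D.label (bp D (i+1)), c) = e then 1 else 0) := by
      rw [Sym2.eq_iff] at hlab
      rcases hlab with ⟨h1, h2⟩ | ⟨h1, h2⟩ <;> rw [h1, h2] <;>
        by_cases q : (e = s(a, c) ∨ e = s(b, c))
      · rw [if_pos q]; rcases q with q | q <;> rw [if_pos q.symm] <;> omega
      · rw [if_neg q]; omega
      · rw [if_pos q]; rcases q with q | q <;> rw [if_pos q.symm] <;> omega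
      · rw [if_neg q]; omega
    omega

theorem DInv.reaches {ℓ : ℕ} {H K C : Set (Sym2 V)} {D0 : DiagState V}
    (I : DInv ℓ H K C [] D0) (hℓ : 3 ≤ ℓ) : ∀ (rest : List (V × V × V)) (D : DiagState V)
    (_ : ∀ st ∈ rest, st.1 ≠ st.2.1 ∧ s(st.1, st.2.1) ∉ H ∧ s(st.1, st.2.2) ∈ K ∧ s(st.2.1, st.2.2) ∈ K),
    DiagReaches rest D0 D → DInv ℓ H K C rest D
  | [], D, _, h => by rw [show D = D0 from h]; exact I
  | st :: rest, D, hst, ⟨Dm, h1, h2⟩ => by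
    have ih := DInv.reaches I hℓ rest Dm (fun st h => hst st (List.mem_cons_of_mem _ h)) h1
    obtain ⟨a1, a2, a3, a4⟩ := hst st List.mem_cons_self
    exact ih.glue hℓ a1 a2 a3 a4 h2

end Invariant

section GraphFacts

theorem mem_cycEdges (B : List ℕ) (f : Sym2 ℕ) :
    f ∈ cycEdges B ↔ ∃ p < B.length, f = s(B.getD p 0, B.getD ((p + 1) % B.length) 0) := by
  have hz : f ∈ cycEdges B ↔ ∃ q ∈ B.zip (B.rotate 1), s(q.1, q.2) = f := by
    simp only [cycEdges, Set.mem_ofPred_eq]; rw [List.mem_map]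
  rw [hz]
  simp only [List.mem_iff_getElem, List.length_zip, List.length_rotate, min_self]
  constructor
  · rintro ⟨q, ⟨p, hp, rfl⟩, rfl⟩
    refine ⟨p, hp, ?_⟩
    rw [List.getElem_zip, List.getElem_rotate, List.getD_eq_getElem _ _ hp,
      List.getD_eq_getElem _ _ (Nat.mod_lt _ (by omega))]
  · rintro ⟨p, hp, rfl⟩
    refine ⟨_, ⟨p, hp, rfl⟩, ?_⟩
    rw [List.getElem_zip, List.getElem_rotate, List.getD_eq_getElem _ _ hp,
      List.getD_eq_getElem _ _ (Nat.mod_lt _ (by omega))]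

theorem init_inv {G : SimpleGraph V} {x : V} (wk : G.Walk x x) (hc : wk.IsCycle) (hℓ : 3 ≤ wk.length)
    (H C : Set (Sym2 V)) (hC : ∀ e ∈ C, e ∈ wk.edges) :
    DInv wk.length H G.edgeSet C [] (initState x wk.support.dropLast) := by
  classical
  set D := initState x wk.support.dropLast with hD
  have hcl : wk.support.dropLast.length = wk.length := by simp
  have hnv : D.nv = wk.length := hcl
  have hb : D.boundary = List.range wk.length := by simp [hD, initState]
  have hbl : D.boundary.length = wk.length := by rw [hb]; simp
  have bplt : ∀ p < wk.length, bp D p = p := by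
    intro p hp
    unfold bp
    rw [hbl, Nat.mod_eq_of_lt hp, hb, List.getD_eq_getElem _ _ (by simpa using hp)]; simp
  have bpl : bp D wk.length = 0 := by
    have : bp D wk.length = bp D 0 := by unfold bp; rw [hbl]; simp
    rw [this, bplt 0 (by omega)]
  have lab : ∀ p < wk.length, D.label p = wk.getVert p := by
    intro p hp
    simp only [hD, initState]
    rw [List.getD_eq_getElem _ _ (by rw [hcl]; exact hp), List.getElem_dropLast,
      SimpleGraph.Walk.getVert_eq_support_getElem _ hp.le]
  have lab' : ∀ p ≤ wk.length, D.label (bp D p) = wk.getVert p := by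
    intro p hp
    rcases Nat.lt_or_ge p wk.length with h | h
    · rw [bplt p h, lab p h]
    · obtain rfl : p = wk.length := by omega
      rw [bpl, lab 0 (by omega)]; simp
  have el : ∀ p < wk.length, posEdge D p = s(wk.getVert p, wk.getVert (p+1)) := by
    intro p hp
    unfold posEdge; rw [lab' p hp.le, lab' (p+1) hp]
  have elinj : ∀ p < wk.length, ∀ q < wk.length, posEdge D p = posEdge D q → p = q := by
    intro p hp q hq h
    rw [el p hp, el q hq] at h
    have hp' : p < wk.edges.length := by simpa using hp
    have hq' : q < wk.edges.length := by simpa using hq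
    rw [← SimpleGraph.Walk.getElem_edges hp', ← SimpleGraph.Walk.getElem_edges hq'] at h
    exact (List.Nodup.getElem_inj_iff hc.edges_nodup).1 h
  have hmk : ∀ f, f ∈ D.marked ↔ ∃ p < D.nv, f = s(bp D p, bp D (p+1)) := by
    intro f
    have : D.marked = cycEdges D.boundary := rfl
    rw [this, mem_cycEdges, hbl, hnv]
    constructor
    · rintro ⟨p, hp, rfl⟩
      refine ⟨p, hp, ?_⟩
      unfold bp; rw [hbl, Nat.mod_eq_of_lt hp]
    · rintro ⟨p, hp, rfl⟩
      refine ⟨p, hp, ?_⟩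
      unfold bp; rw [hbl, Nat.mod_eq_of_lt hp]
  have hmap : ∀ p, Sym2.map D.label s(bp D p, bp D (p+1)) = posEdge D p := by
    intro p; rfl
  refine ⟨by rw [hbl, hnv], by rw [hb]; exact List.nodup_range, ?_, by simpa using hnv, ?_, ?_, ?_, ?_, ?_, ?_⟩
  · intro y hy; rw [hb, List.mem_range] at hy; omega
  · intro f hf; exact (hmk f).1 hf
  · refine ⟨List.replicate wk.length BT.leaf, by simp, by rw [fLeaves_replicate_leaf, hnv], ?_⟩
    have : D.faces = [] := rfl
    simp [faceSets, this, fTri_replicate_leaf]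
  · intro p hp
    rw [hnv] at hp
    rw [el p hp]; exact wk.adj_getVert_succ hp
  · intro e _ f hf g hg hfe hge
    obtain ⟨p, hp, rfl⟩ := (hmk f).1 hf
    obtain ⟨q, hq, rfl⟩ := (hmk g).1 hg
    rw [hmap] at hfe hge
    rw [hnv] at hp hq
    rw [elinj p hp q hq (hfe.trans hge.symm)]
  · intro e _ p hp hpe
    exact ⟨_, (hmk _).2 ⟨p, hp, rfl⟩, by rw [hmap, hpe]⟩
  · intro e _
    simp only [conL, List.countP_nil, add_zero]
    split_ifs with h
    · rw [Nat.succ_le_iff, Finset.card_pos]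
      have := hC e h
      rw [List.mem_iff_getElem] at this
      obtain ⟨p, hp, rfl⟩ := this
      have hp' : p < wk.length := by simpa using hp
      refine ⟨p, ?_⟩
      rw [Finset.mem_filter, Finset.mem_range, hnv]
      exact ⟨hp', by rw [el p hp', SimpleGraph.Walk.getElem_edges hp]⟩
    · exact Nat.zero_le _

theorem conA_eq_conL (steps : List (V × V × V)) (e : Sym2 V) : conA steps e = conL steps e := by
  classical
  have key : ∀ (P : V × V × V → Prop) [DecidablePred P] (l : List (V × V × V)), 
      (∑ i : Fin l.length, if P (l.get i) then 1 else 0) = l.countP (fun st => decide (P st)) := by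
    intro P _ l
    induction l with
    | nil => simp
    | cons a l ih =>
      rw [List.countP_cons, ← ih]
      simp only [List.length_cons]
      rw [Fin.sum_univ_succ]
      by_cases hP : P a <;> simp [hP, add_comm]
  unfold conA conL
  rw [← key (fun st => e = s(st.1, st.2.2) ∨ e = s(st.2.1, st.2.2)), Nat.card_eq_fintype_card,
    Fintype.card_subtype, Finset.card_filter]

theorem valid_append {H : SimpleGraph V} {l : List (V × V × V)} {st : V × V × V}
    (h : IsValidProcess H (l ++ [st])) : IsValidProcess H l ∧ st.1 ≠ st.2.1 ∧ 
      ¬ (afterGraph H l).Adj st.1 st.2.1 ∧ (afterGraph H l).Adj st.1 st.2.2 ∧ 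
      (afterGraph H l).Adj st.2.1 st.2.2 := by
  constructor
  · intro i hi
    have := h i (by simp; omega)
    simp only [List.get_eq_getElem] at this ⊢
    rw [List.getElem_append_left hi, List.take_append_of_le_length hi.le] at this
    exact this
  · have := h l.length (by simp)
    simp only [List.get_eq_getElem] at this
    rw [List.getElem_append_right le_rfl, List.take_append_of_le_length le_rfl] at this
    simpa using this

theorem afterGraph_append {H : SimpleGraph V} {l : List (V × V × V)} {st : V × V × V}
    (h : IsValidProcess H (l ++ [st])) :
    (afterGraph H (l ++ [st])).edgeSet = insert s(st.1, st.2.1) (afterGraph H l).edgeSet := by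
  obtain ⟨_, h1, h2, h3, h4⟩ := valid_append h
  have h3' : s(st.1, st.2.2) ∈ (afterGraph H l).edgeSet := h3
  have h4' : s(st.2.1, st.2.2) ∈ (afterGraph H l).edgeSet := h4
  ext e
  have mem : ∀ l e, e ∈ (afterGraph H l).edgeSet ↔ e ∈ H.edgeSet ∨ ((∃ st ∈ l, e ∈ triEdges st) ∧ ¬ e.IsDiag) := by
    intro l e
    simp [afterGraph, SimpleGraph.edgeSet_sup, SimpleGraph.edgeSet_fromEdgeSet]
  rw [Set.mem_insert_iff]
  constructor
  · intro he
    rw [mem] at he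
    rcases he with he | ⟨⟨t, ht, hte⟩, hd⟩
    · exact Or.inr ((mem _ _).2 (Or.inl he))
    · rw [List.mem_append, List.mem_singleton] at ht
      rcases ht with ht | rfl
      · exact Or.inr ((mem _ _).2 (Or.inr ⟨⟨t, ht, hte⟩, hd⟩))
      · simp only [triEdges, Set.mem_insert_iff, Set.mem_singleton_iff] at hte
        rcases hte with rfl | rfl | rfl
        · exact Or.inl rfl
        · exact Or.inr h3'
        · exact Or.inr h4'
  · rintro (rfl | he)
    · refine (mem _ _).2 (Or.inr ⟨⟨st, by simp, by simp [triEdges]⟩, by simpa using h1⟩)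
    · rw [mem] at he ⊢
      rcases he with he | ⟨⟨t, ht, hte⟩, hd⟩
      · exact Or.inl he
      · exact Or.inr ⟨⟨t, List.mem_append_left _ ht, hte⟩, hd⟩

theorem process_facts (H : SimpleGraph V) (l : List (V × V × V)) : IsValidProcess H l → 
    H ≤ afterGraph H l ∧
    edgeCard (afterGraph H l) = edgeCard H + l.length ∧
    (∀ u v, (afterGraph H l).Adj u v → H.Reachable u v) ∧
    (∀ st ∈ l, st.1 ≠ st.2.1 ∧ ¬ H.Adj st.1 st.2.1 ∧ (afterGraph H l).Adj st.1 st.2.2 ∧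
      (afterGraph H l).Adj st.2.1 st.2.2) := by
  induction l using List.reverseRecOn with
  | nil =>
    intro _
    have : afterGraph H [] = H := by
      simp [afterGraph]
    rw [this]
    exact ⟨le_rfl, by simp, fun u v h => h.reachable, by simp⟩
  | append_singleton l st ih =>
    intro h
    obtain ⟨h0, h1, h2, h3, h4⟩ := valid_append h
    obtain ⟨i1, i2, i3, i4⟩ := ih h0
    have hE := afterGraph_append h
    have hle : afterGraph H l ≤ afterGraph H (l ++ [st]) := by
      rw [← SimpleGraph.edgeSet_subset_edgeSet, hE]; exact Set.subset_insert _ _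
    refine ⟨i1.trans hle, ?_, ?_, ?_⟩
    · have h2' : s(st.1, st.2.1) ∉ (afterGraph H l).edgeSet := h2
      unfold edgeCard at i2 ⊢
      rw [Nat.card_coe_set_eq] at i2 ⊢
      rw [hE, Set.ncard_insert_of_notMem h2' (Set.toFinite _), i2]
      simp; ring
    · intro u v huv
      have : s(u, v) ∈ (afterGraph H (l ++ [st])).edgeSet := huv
      rw [hE, Set.mem_insert_iff] at this
      rcases this with h | h
      · have hr := (i3 _ _ h3).trans (i3 _ _ h4).symm
        rw [Sym2.eq_iff] at h
        rcases h with ⟨rfl, rfl⟩ | ⟨rfl, rfl⟩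
        · exact hr
        · exact hr.symm
      · exact i3 u v h
    · intro t ht
      rw [List.mem_append, List.mem_singleton] at ht
      rcases ht with ht | rfl
      · obtain ⟨a, b, c, d⟩ := i4 t ht
        exact ⟨a, b, hle c, hle d⟩
      · exact ⟨h1, fun h => h2 (i1 h), hle h3, hle h4⟩

theorem sum_conL (E : Finset (Sym2 V)) (l : List (V × V × V))
    (h : ∀ st ∈ l, st.1 ≠ st.2.1 ∧ s(st.1, st.2.2) ∈ E ∧ s(st.2.1, st.2.2) ∈ E) :
    ∑ e ∈ E, conL l e = 2 * l.length := by
  induction l with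
  | nil => simp [conL]
  | cons st l ih =>
    have ih := ih (fun t ht => h t (List.mem_cons_of_mem _ ht))
    obtain ⟨h1, h2, h3⟩ := h st List.mem_cons_self
    have e1 : ∀ e, conL (st :: l) e = conL l e + 
        if (e = s(st.1, st.2.2) ∨ e = s(st.2.1, st.2.2)) then 1 else 0 := by
      intro e; unfold conL; rw [List.countP_cons]; simp
    simp only [e1]
    rw [Finset.sum_add_distrib, ih, ← Finset.card_filter]
    have : E.filter (fun e => e = s(st.1, st.2.2) ∨ e = s(st.2.1, st.2.2)) = 
        {s(st.1, st.2.2), s(st.2.1, st.2.2)} := by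
      ext e
      simp only [Finset.mem_filter, Finset.mem_insert, Finset.mem_singleton]
      constructor
      · exact fun h => h.2
      · rintro (rfl | rfl)
        · exact ⟨h2, Or.inl rfl⟩
        · exact ⟨h3, Or.inr rfl⟩
    rw [this, Finset.card_pair, List.length_cons]
    · ring
    · intro h
      exact h1 (Sym2.congr_left.1 h)

theorem excSum_eq {H C : SimpleGraph V} {l : List (V × V × V)} (hv : IsValidProcess H l)
    (hC : C ≤ afterGraph H l) : 
    excSum H C l = l.length + edgeCard C - 2 * edgeCard H := by
  classical
  obtain ⟨i1, i2, i3, i4⟩ := process_facts H l hv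
  set K := afterGraph H l with hK
  unfold excSum
  rw [finsum_mem_eq_finite_toFinset_sum _ (Set.toFinite _)]
  set E := (Set.toFinite K.edgeSet).toFinset with hE
  have mE : ∀ e, e ∈ E ↔ e ∈ K.edgeSet := fun e => Set.Finite.mem_toFinset _
  have h1 : ∀ e ∈ E, excA H C l e = (conL l e : ℤ) - 1 - (if e ∈ H.edgeSet then 1 else 0) + 
      (if e ∈ C.edgeSet then 1 else 0) := by
    intro e _
    unfold excA
    rw [conA_eq_conL]
    split_ifs <;> ring
  have hsub : ∀ G : SimpleGraph V, G ≤ K → ∑ e ∈ E, (if e ∈ G.edgeSet then (1:ℤ) else 0) = edgeCard G := by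
    intro G hG
    rw [← Finset.sum_filter, Finset.sum_const, nsmul_eq_mul, mul_one]
    unfold edgeCard
    rw [Nat.card_coe_set_eq, Set.ncard_eq_toFinset_card _ (Set.toFinite _)]
    congr 2
    ext e
    rw [Finset.mem_filter, mE, Set.Finite.mem_toFinset]
    exact ⟨fun h => h.2, fun h => ⟨SimpleGraph.edgeSet_mono hG h, h⟩⟩
  have hEc : (E.card : ℤ) = edgeCard K := by
    unfold edgeCard
    rw [Nat.card_coe_set_eq, Set.ncard_eq_toFinset_card _ (Set.toFinite _)]
  have hs := sum_conL E l (fun st hst => by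
    obtain ⟨a, _, c, d⟩ := i4 st hst
    exact ⟨a, (mE _).2 c, (mE _).2 d⟩)
  rw [Finset.sum_congr rfl h1, Finset.sum_add_distrib, Finset.sum_sub_distrib, Finset.sum_sub_distrib,
    hsub H i1, hsub C hC, ← Nat.cast_sum, hs, Finset.sum_const, nsmul_eq_mul, mul_one, hEc, i2]
  push_cast; ring

theorem walkEdgeGraph_edgeSet {G : SimpleGraph V} {x y : V} (wk : G.Walk x y) :
    (walkEdgeGraph wk).edgeSet = {e | e ∈ wk.edges} := by
  unfold walkEdgeGraph
  rw [SimpleGraph.edgeSet_fromEdgeSet]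
  ext e
  simp only [Set.mem_sdiff, Set.mem_ofPred_eq]
  constructor
  · exact fun h => h.1
  · intro h
    exact ⟨h, G.not_isDiag_of_mem_edgeSet (wk.edges_subset_edgeSet h)⟩

theorem edgeCard_cycle {G : SimpleGraph V} {x : V} (wk : G.Walk x x) (hc : wk.IsCycle) :
    edgeCard (walkEdgeGraph wk) = wk.length := by
  classical
  unfold edgeCard
  rw [Nat.card_coe_set_eq, walkEdgeGraph_edgeSet]
  have : {e | e ∈ wk.edges} = (wk.edges.toFinset : Set (Sym2 V)) := by ext; simp
  rw [this, Set.ncard_coe_finset, List.toFinset_card_of_nodup hc.edges_nodup, 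
    SimpleGraph.Walk.length_edges]

theorem support_of_reachable {H : SimpleGraph V} {u v : V} (h : H.Reachable u v) (hne : u ≠ v) :
    u ∈ H.support := by
  obtain ⟨p⟩ := h
  cases p with
  | nil => exact absurd rfl hne
  | cons h _ => exact ⟨_, h⟩

theorem card_support_le {H : SimpleGraph V} {x : V} (hx : x ∈ H.support) 
    (h : ∀ y ∈ H.support, H.Reachable x y) : supportCard H ≤ edgeCard H + 1 := by
  classical
  set c := H.connectedComponentMk x with hc
  have h1 := c.connected_toSimpleGraph.card_vert_le_card_edgeSet_add_one
  have hs : H.support = c.supp := by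
    ext y
    rw [SimpleGraph.ConnectedComponent.mem_supp_iff, hc, SimpleGraph.ConnectedComponent.eq]
    constructor
    · intro hy; exact (h y hy).symm
    · intro hy
      by_cases e : y = x
      · rw [e]; exact hx
      · exact support_of_reachable hy e
  have h2 : Nat.card c.toSimpleGraph.edgeSet ≤ Nat.card H.edgeSet := by
    apply Nat.card_le_card_of_injective (c.toSimpleGraph_hom.mapEdgeSet)
    apply SimpleGraph.Hom.mapEdgeSet.injective
    exact Subtype.val_injective
  unfold supportCard edgeCard
  rw [hs]
  exact h1.trans (by omega)

end GraphFacts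

section Package

/-- The data extracted from an activation diagram. -/
structure DFacts (ℓ v w : ℕ) (D : DiagState V) : Prop where
  len : D.boundary.length = D.nv
  nd : D.boundary.Nodup
  lt : ∀ y ∈ D.boundary, y < D.nv
  nv3 : 3 ≤ D.nv
  nv : D.nv + 2 = 2 * v + w
  hv : 1 ≤ v
  mkd : ∀ f ∈ D.marked, ∃ p < D.nv, f = s(bp D p, bp D (p+1))
  faces : ∃ F : List BT, F.length = ℓ ∧ fLeaves F = D.nv ∧ 
    faceSets D = {t | ∃ q ∈ fTri F 0, t = ({bp D q.1, bp D q.2.1, bp D q.2.2} : Finset ℕ)}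
  nl : ∀ p < D.nv, D.label (bp D p) ≠ D.label (bp D (p+1))
  vis : (wVis (fun p => D.label (bp D p)) D.nv).card = v
  tr : ∃ T : Finset (Sym2 V), T.card = v - 1 ∧ ∀ e ∈ T, ∃ p < D.nv, ∃ q < D.nv, 
    posEdge D p = e ∧ posEdge D q = e ∧ s(bp D p, bp D (p+1)) ∈ D.marked ∧ 
      s(bp D q, bp D (q+1)) ∉ D.marked

theorem dfacts {H : SimpleGraph V} {steps : List (V × V × V)} {x : V} {ℓ v w : ℕ} 
    {wk : (afterGraph H steps).Walk x x} (hc : wk.IsCycle) (hl : wk.length = ℓ) (hℓ : 3 ≤ ℓ)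
    (hn : NiceProcess H (walkEdgeGraph wk) steps) (hs : supportCard H = v)
    (hw : 2 * complexity H + excSum H (walkEdgeGraph wk) steps = (w : ℤ)) {D : DiagState V}
    (hD : DiagReaches steps (initState x wk.support.dropLast) D) : DFacts ℓ v w D := by
  classical
  obtain ⟨hval, hCle, hnice⟩ := hn
  obtain ⟨i1, i2, i3, i4⟩ := process_facts H steps hval
  have I : DInv ℓ H.edgeSet (afterGraph H steps).edgeSet (walkEdgeGraph wk).edgeSet steps D := by
    have h0 := init_inv wk hc (by omega) H.edgeSet (walkEdgeGraph wk).edgeSet (by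
      intro e he; rw [walkEdgeGraph_edgeSet] at he; exact he)
    rw [hl] at h0
    exact h0.reaches hℓ steps D (fun st hst => i4 st hst) hD
  have hexc := excSum_eq hval hCle
  rw [edgeCard_cycle wk hc, hl] at hexc
  have hnv : D.nv + 2 = 2 * v + w := by
    have := I.nv
    rw [hexc] at hw
    unfold complexity at hw
    rw [hs] at hw
    omega
  have nv3 : 3 ≤ D.nv := by have := I.nv; omega
  have bpL : bp D D.nv = bp D 0 := by unfold bp; rw [I.len]; simp
  -- count of boundary positions of an edge of `H`
  have cnt2 : ∀ e ∈ H.edgeSet, 2 ≤ ((Finset.range D.nv).filter (fun p => posEdge D p = e)).card := by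
    intro e he
    have h1 := I.cnt e he
    have h2 := hnice e (SimpleGraph.edgeSet_mono i1 he)
    unfold excA at h2
    rw [conA_eq_conL] at h2
    simp only [he, if_true] at h2
    refine le_trans ?_ h1
    split_ifs at h2 ⊢ <;> omega
  have hK : ∀ p < D.nv, (afterGraph H steps).Adj (D.label (bp D p)) (D.label (bp D (p+1))) := 
    fun p hp => I.inK p hp
  have adjsupp : ∀ u v, (afterGraph H steps).Adj u v → u ∈ H.support := 
    fun u v h => support_of_reachable (i3 u v h) h.ne
  have insupp : ∀ p ≤ D.nv, D.label (bp D p) ∈ H.support := by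
    intro p hp
    rcases Nat.lt_or_ge p D.nv with h | h
    · exact adjsupp _ _ (hK p h)
    · obtain rfl : p = D.nv := by omega
      rw [bpL]; exact adjsupp _ _ (hK 0 (by omega))
  have reach : ∀ p ≤ D.nv, H.Reachable (D.label (bp D 0)) (D.label (bp D p)) := by
    intro p
    induction p with
    | zero => intro _; exact SimpleGraph.Reachable.refl _
    | succ p ih => intro hp; exact (ih (by omega)).trans (i3 _ _ (hK p (by omega)))
  have onb : ∀ y ∈ H.support, ∃ p ≤ D.nv, D.label (bp D p) = y := by
    intro y hy
    obtain ⟨z, hz⟩ := hy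
    have h2 := cnt2 s(y, z) hz
    have : ((Finset.range D.nv).filter (fun p => posEdge D p = s(y, z))).Nonempty := by
      rw [← Finset.card_pos]; omega
    obtain ⟨p, hp⟩ := this
    rw [Finset.mem_filter, Finset.mem_range] at hp
    obtain ⟨hp, he⟩ := hp
    unfold posEdge at he
    rw [Sym2.eq_iff] at he
    rcases he with ⟨h, _⟩ | ⟨_, h⟩
    · exact ⟨p, hp.le, h⟩
    · exact ⟨p+1, hp, h⟩
  have hvis : (wVis (fun p => D.label (bp D p)) D.nv).card = v := by
    rw [← hs]
    unfold supportCard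
    rw [Nat.card_coe_set_eq, ← Set.ncard_coe_finset]
    congr 1
    ext y
    simp only [wVis, Finset.coe_image, Finset.coe_range, Set.mem_image, Set.mem_Iio]
    constructor
    · rintro ⟨p, hp, rfl⟩; exact insupp p (by omega)
    · intro hy
      obtain ⟨p, hp, h⟩ := onb y hy
      exact ⟨p, by omega, h⟩
  have hv1 : 1 ≤ v := by
    rw [← hvis]
    exact Finset.card_pos.2 ⟨_, Finset.mem_image_of_mem _ (Finset.mem_range.2 (Nat.succ_pos _))⟩
  have hedge := card_support_le (insupp 0 (by omega)) (fun y hy => by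
    obtain ⟨p, hp, rfl⟩ := onb y hy; exact reach p hp)
  refine ⟨I.len, I.nd, I.lt, nv3, hnv, hv1, I.mkd, I.faces, fun p hp => (hK p hp).ne, hvis, ?_⟩
  have hcard : v - 1 ≤ ((Set.toFinite H.edgeSet).toFinset).card := by
    rw [← Set.ncard_eq_toFinset_card, ← Nat.card_coe_set_eq]
    unfold edgeCard at hedge
    omega
  obtain ⟨T, hT, hTc⟩ := Finset.exists_subset_card_eq hcard
  refine ⟨T, hTc, ?_⟩
  intro e heT
  have he : e ∈ H.edgeSet := by simpa using hT heT
  obtain ⟨p, hp, q, hq, hpq⟩ := Finset.one_lt_card.1 (cnt2 e he)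
  rw [Finset.mem_filter, Finset.mem_range] at hp hq
  obtain ⟨f, hf, hfe⟩ := I.ex e he p hp.1 hp.2
  obtain ⟨r, hr, rfl⟩ := I.mkd f hf
  have hre : posEdge D r = e := hfe
  have main : ∀ q < D.nv, posEdge D q = e → q ≠ r → s(bp D q, bp D (q+1)) ∉ D.marked := by
    intro q hq hqe hne hm
    have := I.uniq e he _ hf _ hm hfe hqe
    exact hne (bp_edge_inj I.nd (by rw [I.len]; omega) (by rw [I.len]; omega) (by rw [I.len]; omega) this).symm
  by_cases h : p = r
  · exact ⟨r, hr, q, hq.1, hre, hq.2, hf, main q hq.1 hq.2 (by omega)⟩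
  · exact ⟨r, hr, p, hp.1, hre, hp.2, hf, main p hp.1 hp.2 h⟩

/-- Marked boundary positions. -/
def isM (D : DiagState V) (p : ℕ) : Prop := s(bp D p, bp D (p+1)) ∈ D.marked

theorem exists_good {ℓ v w : ℕ} {D : DiagState V} (h : DFacts ℓ v w D) :
    ∃ B S : Finset ℕ, WGood D.nv v w (fun p => D.label (bp D p)) B S ∧ 
      ∀ k ∈ wU D.nv B S, ∃ j ∈ S, wE (fun p => D.label (bp D p)) j = wE (fun p => D.label (bp D p)) k ∧
        (isM D k ↔ ¬ isM D j) := by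
  classical
  obtain ⟨T, hTc, hT⟩ := h.tr
  have hT' : ∀ e : Sym2 V, ∃ j k : ℕ, e ∈ T → j < k ∧ k < D.nv ∧ posEdge D j = e ∧ posEdge D k = e ∧ 
      (isM D k ↔ ¬ isM D j) := by
    intro e
    by_cases he : e ∈ T
    · obtain ⟨p, hp, q, hq, h1, h2, h3, h4⟩ := hT e he
      rcases lt_trichotomy p q with hlt | rfl | hlt
      · exact ⟨p, q, fun _ => ⟨hlt, hq, h1, h2, ⟨fun h => absurd h h4, fun h => absurd h3 h⟩⟩⟩
      · exact absurd h3 h4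
      · exact ⟨q, p, fun _ => ⟨hlt, hp, h2, h1, ⟨fun _ => h4, fun _ => h3⟩⟩⟩
    · exact ⟨0, 0, fun h => absurd h he⟩
  choose j k hjk using hT'
  set S := T.image j with hS
  set U := T.image k with hU
  have jinj : Set.InjOn j T := by
    intro e he e' he' hh
    rw [← (hjk e he).2.2.1, ← (hjk e' he').2.2.1, hh]
  have kinj : Set.InjOn k T := by
    intro e he e' he' hh
    rw [← (hjk e he).2.2.2.1, ← (hjk e' he').2.2.2.1, hh]
  have hSc : S.card = v - 1 := by rw [hS, Finset.card_image_of_injOn jinj, hTc]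
  have hUc : U.card = v - 1 := by rw [hU, Finset.card_image_of_injOn kinj, hTc]
  have hdis : Disjoint S U := by
    rw [Finset.disjoint_left]
    intro p hp hp'
    obtain ⟨e, he, rfl⟩ := Finset.mem_image.1 hp
    obtain ⟨e', he', heq⟩ := Finset.mem_image.1 hp'
    have : e = e' := by
      rw [← (hjk e he).2.2.1, ← (hjk e' he').2.2.2.1, heq]
    subst this
    have := (hjk e he).1
    omega
  have hSr : S ⊆ Finset.range D.nv := by
    intro p hp
    obtain ⟨e, he, rfl⟩ := Finset.mem_image.1 hp
    have := hjk e he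
    rw [Finset.mem_range]; omega
  have hUr : U ⊆ Finset.range D.nv := by
    intro p hp
    obtain ⟨e, he, rfl⟩ := Finset.mem_image.1 hp
    have := hjk e he
    rw [Finset.mem_range]; omega
  set B := Finset.range D.nv \ (S ∪ U) with hB
  have hwU : wU D.nv B S = U := by
    ext p
    have := @hUr p
    have hd : p ∈ S → p ∉ U := fun h => Finset.disjoint_left.1 hdis h
    simp only [wU, hB, Finset.mem_sdiff, Finset.mem_union]
    tauto
  have hBc : B.card = w := by
    rw [hB, Finset.card_sdiff_of_subset (Finset.union_subset hSr hUr), 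
      Finset.card_union_of_disjoint hdis, hSc, hUc, Finset.card_range]
    have := h.nv; have := h.hv; omega
  have hpart : ∀ q ∈ U, ∃ p ∈ S, p < q ∧ posEdge D p = posEdge D q ∧ (isM D q ↔ ¬ isM D p) := by
    intro q hq
    obtain ⟨e, he, rfl⟩ := Finset.mem_image.1 hq
    obtain ⟨h1, h2, h3, h4, h5⟩ := hjk e he
    exact ⟨j e, Finset.mem_image_of_mem _ he, h1, h3.trans h4.symm, h5⟩
  refine ⟨B, S, ⟨?_, h.hv, Finset.sdiff_subset, hBc, ?_, hSc, ?_, ?_, ?_, h.nl, h.vis⟩, ?_⟩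
  · have := h.nv; have := h.hv; omega
  · intro p hp
    rw [Finset.mem_sdiff]
    refine ⟨hSr hp, fun h => ?_⟩
    rw [hB, Finset.mem_sdiff, Finset.mem_union] at h
    exact h.2 (Or.inl hp)
  · intro p hp q hq hh
    obtain ⟨e, he, rfl⟩ := Finset.mem_image.1 hp
    obtain ⟨e', he', rfl⟩ := Finset.mem_image.1 hq
    have hh : posEdge D (j e) = posEdge D (j e') := hh
    rw [(hjk e he).2.2.1, (hjk e' he').2.2.1] at hh
    rw [hh]
  · rw [hwU]
    intro p hp q hq hh
    obtain ⟨e, he, rfl⟩ := Finset.mem_image.1 hp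
    obtain ⟨e', he', rfl⟩ := Finset.mem_image.1 hq
    have hh : posEdge D (k e) = posEdge D (k e') := hh
    rw [(hjk e he).2.2.2.1, (hjk e' he').2.2.2.1] at hh
    rw [hh]
  · rw [hwU]
    intro q hq
    obtain ⟨p, hp, h1, h2, _⟩ := hpart q hq
    exact ⟨p, hp, h1, h2⟩
  · rw [hwU]
    intro q hq
    obtain ⟨p, hp, h1, h2, h3⟩ := hpart q hq
    exact ⟨p, hp, h2, h3⟩

end Package

section Final

theorem diagIso_of {ℓ ℓ₂ v w : ℕ} {D₁ D₂ : DiagState V} (h₁ : DFacts ℓ v w D₁) (h₂ : DFacts ℓ₂ v w D₂)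
    {F : List BT}
    (hF : fLeaves F = D₁.nv)
    (hF₁ : faceSets D₁ = {t | ∃ q ∈ fTri F 0, t = ({bp D₁ q.1, bp D₁ q.2.1, bp D₁ q.2.2} : Finset ℕ)})
    (hF₂ : faceSets D₂ = {t | ∃ q ∈ fTri F 0, t = ({bp D₂ q.1, bp D₂ q.2.1, bp D₂ q.2.2} : Finset ℕ)})
    (hx : ∀ p ≤ D₁.nv, D₁.label (bp D₁ p) = D₂.label (bp D₂ p))
    (hM : ∀ p < D₁.nv, isM D₁ p ↔ isM D₂ p) : DiagIso D₁ D₂ := by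
  classical
  have hnv : D₂.nv = D₁.nv := by have := h₁.nv; have := h₂.nv; omega
  have l1 := h₁.len
  have l2 := h₂.len
  have n3 := h₁.nv3
  set f : ℕ → ℕ := fun i => D₂.boundary.getD (D₁.boundary.idxOf i) 0 with hf
  have fbp : ∀ p < D₁.nv, f (bp D₁ p) = bp D₂ p := by
    intro p hp
    have hpl : p < D₁.boundary.length := by omega
    have e : bp D₁ p = D₁.boundary[p] := by
      unfold bp
      rw [Nat.mod_eq_of_lt (by omega), List.getD_eq_getElem _ _ (by omega)]
    simp only [hf]
    rw [e, h₁.nd.idxOf_getElem]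
    unfold bp
    rw [Nat.mod_eq_of_lt (by omega)]
  have fbp' : ∀ p ≤ D₁.nv, f (bp D₁ p) = bp D₂ p := by
    intro p hp
    rcases Nat.lt_or_ge p D₁.nv with h | h
    · exact fbp p h
    · obtain rfl : p = D₁.nv := by omega
      have e1 : bp D₁ D₁.nv = bp D₁ 0 := by unfold bp; rw [l1]; simp
      have e2 : bp D₂ D₁.nv = bp D₂ 0 := by unfold bp; rw [l2, hnv]; simp
      rw [e1, e2]; exact fbp 0 (by omega)
  have surj : ∀ i < D₁.nv, ∃ p < D₁.nv, bp D₁ p = i := by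
    intro i hi
    have hsub : D₁.boundary.toFinset ⊆ Finset.range D₁.nv := by
      intro y hy; rw [List.mem_toFinset] at hy; exact Finset.mem_range.2 (h₁.lt y hy)
    have heq := Finset.eq_of_subset_of_card_le hsub (by
      rw [List.toFinset_card_of_nodup h₁.nd, l1, Finset.card_range])
    have : i ∈ D₁.boundary := by
      rw [← List.mem_toFinset, heq]; exact Finset.mem_range.2 hi
    obtain ⟨p, hp, e⟩ := List.mem_iff_getElem.1 this
    refine ⟨p, by omega, ?_⟩
    unfold bp
    rw [Nat.mod_eq_of_lt hp, List.getD_eq_getElem _ _ hp, e]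
  refine ⟨f, hnv, ?_, ?_, ?_, ?_, ?_, ?_⟩
  · intro i hi j hj hij
    obtain ⟨p, hp, rfl⟩ := surj i hi
    obtain ⟨q, hq, rfl⟩ := surj j hj
    rw [fbp p hp, fbp q hq] at hij
    rw [bp_inj h₂.nd (by omega) (by omega) hij]
  · intro i hi
    obtain ⟨p, hp, rfl⟩ := surj i hi
    rw [fbp p hp, ← hnv]
    exact bp_lt h₂.lt (by omega) p
  · intro i hi
    obtain ⟨p, hp, rfl⟩ := surj i hi
    rw [fbp p hp]; exact (hx p hp.le).symm
  · have : D₁.boundary.map f = D₂.boundary := by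
      apply List.ext_getElem
      · simp; omega
      · intro p hp1 hp2
        rw [List.getElem_map]
        have := fbp p (by omega)
        unfold bp at this
        rwa [Nat.mod_eq_of_lt (by omega), Nat.mod_eq_of_lt (by omega), List.getD_eq_getElem _ _ (by omega),
          List.getD_eq_getElem _ _ (by omega)] at this
    rw [this]
  · ext g
    constructor
    · intro hg
      obtain ⟨p, hp, rfl⟩ := h₂.mkd g hg
      rw [hnv] at hp
      refine ⟨_, (hM p hp).2 hg, ?_⟩
      rw [Sym2.map_mk, fbp' p hp.le, fbp' (p+1) hp]
    · rintro ⟨g, hg, rfl⟩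
      obtain ⟨p, hp, rfl⟩ := h₁.mkd g hg
      rw [Sym2.map_mk, fbp' p hp.le, fbp' (p+1) hp]
      exact (hM p hp).1 hg
  · rw [hF₁, hF₂]
    have him : ∀ q ∈ fTri F 0, Finset.image f ({bp D₁ q.1, bp D₁ q.2.1, bp D₁ q.2.2} : Finset ℕ) = 
        {bp D₂ q.1, bp D₂ q.2.1, bp D₂ q.2.2} := by
      intro q hq
      have := fTri_bound F 0 q hq
      rw [Finset.image_insert, Finset.image_insert, Finset.image_singleton, fbp' _ (by omega), 
        fbp' _ (by omega), fbp' _ (by omega)]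
    ext t
    constructor
    · rintro ⟨q, hq, rfl⟩
      exact ⟨_, ⟨q, hq, rfl⟩, him q hq⟩
    · rintro ⟨_, ⟨q, hq, rfl⟩, rfl⟩
      exact ⟨q, hq, him q hq⟩

/-- The type of codes. -/
abbrev Code (n v w L : ℕ) : Type :=
  (Fin (2 * L) → Bool) × (Fin v → Fin n) × (Fin (3 * w) → Fin v) × Finset ℕ × 
    (Σ _ : Finset ℕ, Σ _ : Finset ℕ, Finset ℕ)

/-- The finite set of admissible codes. -/
def codes (n v w L : ℕ) : Finset (Code n v w L) :=
  Finset.univ ×ˢ Finset.univ ×ˢ Finset.univ ×ˢ Finset.powersetCard w (Finset.range L) ×ˢ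
    ((Finset.powersetCard w (Finset.range L)).sigma fun B =>
      (Finset.powersetCard (v - 1) (Finset.range L \ B)).sigma fun S => (B ∪ S).powerset)

/-- `c` is a code of the diagram `D`. -/
def IsCode (n ℓ v w L : ℕ) [NeZero v] (D : DiagState (Fin n)) (c : Code n v w L) : Prop :=
  D.nv = L ∧
  (∃ F : List BT, F.length = ℓ ∧ fLeaves F = D.nv ∧ 
    faceSets D = {t | ∃ q ∈ fTri F 0, t = ({bp D q.1, bp D q.2.1, bp D q.2.2} : Finset ℕ)} ∧
    c.1 = fun i => (fWord F).getD i.1 false) ∧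
  WGood L v w (fun p => D.label (bp D p)) c.2.2.2.2.1 c.2.2.2.2.2.1 ∧
  WSpec L (fun p => D.label (bp D p)) c.2.2.2.2.1 c.2.2.2.2.2.1 c.2.2.2.1 
    (fun k => c.2.1 (Fin.ofNat v k)) (fun k => if h : k < 3 * w then c.2.2.1 ⟨k, h⟩ else 0) ∧
  (∀ k ∈ wU L c.2.2.2.2.1 c.2.2.2.2.2.1, ∃ j ∈ c.2.2.2.2.2.1, 
    wE (fun p => D.label (bp D p)) j = wE (fun p => D.label (bp D p)) k ∧ (isM D k ↔ ¬ isM D j)) ∧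
  (∀ p ∈ c.2.2.2.2.1 ∪ c.2.2.2.2.2.1, isM D p ↔ p ∈ c.2.2.2.2.2.2)

theorem exists_isCode {n ℓ v w L : ℕ} [NeZero v] {D : DiagState (Fin n)} (h : DFacts ℓ v w D) (hL : D.nv = L) :
    ∃ c ∈ codes n v w L, IsCode n ℓ v w L D c := by
  classical
  subst hL
  obtain ⟨B, S, g, hm⟩ := exists_good h
  obtain ⟨Q, lab, σ, hQ, hsp⟩ := exists_code g
  obtain ⟨F, f1, f2, f3⟩ := h.faces
  refine ⟨⟨fun i => (fWord F).getD i.1 false, lab, σ, Q, B, S, (B ∪ S).filter (isM D)⟩, ?_, rfl, 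
    ⟨F, f1, f2, f3, rfl⟩, g, hsp, hm, ?_⟩
  · simp only [codes, Finset.mem_product, Finset.mem_univ, true_and, Finset.mem_sigma,
      Finset.mem_powerset, Finset.filter_subset, and_true]
    exact ⟨hQ, Finset.mem_powersetCard.2 ⟨g.hB, g.hBc⟩, Finset.mem_powersetCard.2 ⟨g.hS, g.hSc⟩⟩
  · intro p hp
    simp only [Finset.mem_filter]
    exact ⟨fun h => ⟨hp, h⟩, fun h => h.2⟩

theorem iso_of_code {n ℓ v w L : ℕ} [NeZero v] {D₁ D₂ : DiagState (Fin n)} (h₁ : DFacts ℓ v w D₁) 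
    (h₂ : DFacts ℓ v w D₂) {c : Code n v w L} (c₁ : IsCode n ℓ v w L D₁ c) (c₂ : IsCode n ℓ v w L D₂ c) :
    DiagIso D₁ D₂ := by
  obtain ⟨hL, ⟨F, f1, f2, f3, f4⟩, g, sp, mm, mx⟩ := c₁
  obtain ⟨hL', ⟨F', f1', f2', f3', f4'⟩, g', sp', mm', mx'⟩ := c₂
  have hx := wSpec_unique g g' sp sp' L le_rfl
  have hFF : F = F' := by
    have e1 := fWord_length F
    have e2 := fWord_length F'
    apply fWord_inj
    apply List.ext_getElem
    · omega
    · intro i hi hi'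
      have := congrFun (f4.symm.trans f4') ⟨i, by omega⟩
      simp only at this
      rwa [List.getD_eq_getElem _ _ hi, List.getD_eq_getElem _ _ hi'] at this
  subst hFF
  subst hL
  refine diagIso_of h₁ h₂ f2 f3 f3' hx ?_
  intro p hp
  by_cases hBS : p ∈ c.2.2.2.2.1 ∪ c.2.2.2.2.2.1
  · rw [mx p hBS, mx' p hBS]
  · have hU : p ∈ wU D₁.nv c.2.2.2.2.1 c.2.2.2.2.2.1 := by
      rw [wU, Finset.mem_sdiff]; exact ⟨Finset.mem_range.2 hp, hBS⟩
    obtain ⟨j, hj, hje, hjm⟩ := mm p hU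
    obtain ⟨j', hj', hje', hjm'⟩ := mm' p hU
    have hjL : ∀ j ∈ c.2.2.2.2.2.1, j < D₁.nv := by
      intro j hj
      have := g.hS hj
      rw [Finset.mem_sdiff, Finset.mem_range] at this
      exact this.1
    have hw : ∀ i < D₁.nv, wE (fun p => D₁.label (bp D₁ p)) i = wE (fun p => D₂.label (bp D₂ p)) i := 
      fun i hi => wE_congr hx hi
    have : j = j' := by
      apply g.hSinj hj hj'
      rw [hje, hw p hp, ← hje', hw j' (hjL j' hj')]
    subst this
    rw [hjm, hjm', mx j (Finset.mem_union_right _ hj), mx' j (Finset.mem_union_right _ hj)]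

theorem choose_le_pow' (m w : ℕ) : (m + w).choose w ≤ (m + 1) ^ w := by
  induction w with
  | zero => simp
  | succ w ih =>
    have h := Nat.add_one_mul_choose_eq (m + w) w
    have h2 : (m + (w+1)).choose (w+1) * (w + 1) ≤ (m+1)^(w+1) * (w+1) := by
      rw [show m + (w+1) = m + w + 1 by ring, ← h, pow_succ]
      calc (m + w + 1) * (m+w).choose w ≤ ((m+1) * (w+1)) * (m+1)^w := by
            apply Nat.mul_le_mul _ ih; nlinarith
        _ = _ := by ring
    exact Nat.le_of_mul_le_mul_right h2 (Nat.succ_pos _)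

theorem codes_card (n v w L : ℕ) (hv : 1 ≤ v) (hL : L = 2 * (v - 1) + w) : 
    (codes n v w L).card ≤ n ^ v * (2 * v) ^ (4 * w) * (2 * v + w - 2).choose w * 2 ^ (7 * v) := by
  have hin : ((Finset.powersetCard w (Finset.range L)).sigma fun B =>
      (Finset.powersetCard (v - 1) (Finset.range L \ B)).sigma fun S => (B ∪ S).powerset).card ≤ 
      L.choose w * (2 ^ (2 * (v-1)) * 2 ^ (w + (v - 1))) := by
    rw [Finset.card_sigma]
    refine (Finset.sum_le_card_nsmul _ _ (2 ^ (2 * (v-1)) * 2 ^ (w + (v - 1))) ?_).trans ?_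
    · intro B hB
      rw [Finset.mem_powersetCard] at hB
      rw [Finset.card_sigma]
      refine (Finset.sum_le_card_nsmul _ _ (2 ^ (w + (v-1))) ?_).trans ?_
      · intro S hS
        rw [Finset.mem_powersetCard] at hS
        rw [Finset.card_powerset]
        apply Nat.pow_le_pow_right (by norm_num)
        refine (Finset.card_union_le _ _).trans ?_
        omega
      · rw [smul_eq_mul, Finset.card_powersetCard, Finset.card_sdiff_of_subset hB.1, Finset.card_range, hB.2,
          show L - w = 2 * (v-1) by omega]
        exact Nat.mul_le_mul_right _ (Nat.choose_le_two_pow _ _)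
    · rw [smul_eq_mul, Finset.card_powersetCard, Finset.card_range]
  have hQ : L.choose w ≤ (2 * v) ^ w := by
    rw [hL]
    refine (choose_le_pow' _ _).trans (Nat.pow_le_pow_left (by omega) _)
  have hLe : 2 * v + w - 2 = L := by omega
  unfold codes
  rw [Finset.card_product, Finset.card_product, Finset.card_product, Finset.card_product,
    Finset.card_powersetCard, Finset.card_range, Finset.card_univ, Finset.card_univ, Finset.card_univ,
    Fintype.card_fun, Fintype.card_fun, Fintype.card_fun, Fintype.card_fin, Fintype.card_fin, Fintype.card_fin,
    Fintype.card_fin, Fintype.card_bool, hLe]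
  calc 2 ^ (2 * L) * (n ^ v * (v ^ (3 * w) * (L.choose w * _))) 
      ≤ 2 ^ (2 * L) * (n ^ v * (v ^ (3 * w) * ((2 * v) ^ w * (L.choose w * (2 ^ (2 * (v-1)) * 2 ^ (w + (v - 1))))))) := by
        gcongr
    _ = n ^ v * (((2 ^ (3 * w)) * v ^ (3 * w)) * (2 * v) ^ w) * L.choose w * 2 ^ (7 * (v - 1)) := by
        have : 2 ^ (2 * L) * 2 ^ (2 * (v-1)) * 2 ^ (w + (v - 1)) = 2 ^ (3 * w) * 2 ^ (7 * (v-1)) := by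
          rw [← pow_add, ← pow_add, ← pow_add]; congr 1; omega
        linear_combination n ^ v * v ^ (3 * w) * (2 * v) ^ w * L.choose w * this
    _ = n ^ v * (2 * v) ^ (4 * w) * L.choose w * 2 ^ (7 * (v - 1)) := by
        rw [← mul_pow, ← pow_add]; congr 4; ring
    _ ≤ _ := by
        gcongr
        · norm_num
        · omega

theorem pvwCard_le (n ℓ v w : ℕ) (hℓ : 3 ≤ ℓ) (hv : ℓ ≤ v) : 
    PvwCard n ℓ v w ≤ n ^ v * (2 * v) ^ (4 * w) * (2 * v + w - 2).choose w * 2 ^ (7 * v) := by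
  classical
  have : NeZero v := ⟨by omega⟩
  set L := 2 * (v - 1) + w with hL
  have facts : ∀ D : {D : DiagState (Fin n) // D ∈ Pvw n ℓ v w}, DFacts ℓ v w D.1 := by
    rintro ⟨D, H, steps, x, wk, hc, hl, hn, hs, hw, hD⟩
    exact dfacts hc hl hℓ hn hs hw hD
  have hcode : ∀ D : {D : DiagState (Fin n) // D ∈ Pvw n ℓ v w}, 
      ∃ c : {c // c ∈ codes n v w L}, IsCode n ℓ v w L D.1 c.1 := by
    intro D
    obtain ⟨c, hc, h⟩ := exists_isCode (L := L) (facts D) (by have := (facts D).nv; omega)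
    exact ⟨⟨c, hc⟩, h⟩
  choose code hcode using hcode
  refine le_trans ?_ (codes_card n v w L (by omega) hL)
  unfold PvwCard
  rw [← Fintype.card_coe, ← Nat.card_eq_fintype_card]
  apply Nat.card_le_card_of_injective (fun q => code (Quot.out q))
  intro q q' h
  have h : code (Quot.out q) = code (Quot.out q') := h
  rw [← Quot.out_eq q, ← Quot.out_eq q']
  apply Quot.sound
  have h2 := hcode (Quot.out q')
  rw [← h] at h2
  exact iso_of_code (facts _) (facts _) (hcode (Quot.out q)) h2

end Final
/-- `|P_{v,w}(ℓ,n)| ≤ n^v (2v)^{4w} w^w · C(2v+w−2, w) · 2^{7v}`. -/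
theorem statement11 (ℓ v w : ℕ → ℕ)
    (hℓ : ∀ n, 3 ≤ ℓ n) (hv : ∀ n, ℓ n ≤ v n) (n : ℕ) :
    PvwCard n (ℓ n) (v n) (w n) ≤
      n ^ v n * (2 * v n) ^ (4 * w n) * (w n) ^ (w n) *
        (2 * v n + w n - 2).choose (w n) * 2 ^ (7 * v n) := by
  refine (pvwCard_le n (ℓ n) (v n) (w n) (hℓ n) (hv n)).trans ?_
  have hw : 1 ≤ (w n) ^ (w n) := by
    rcases Nat.eq_zero_or_pos (w n) with h | h
    · rw [h]; simp
    · exact Nat.one_le_pow _ _ h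
  have h1 : n ^ v n * (2 * v n) ^ (4 * w n) ≤ n ^ v n * (2 * v n) ^ (4 * w n) * (w n) ^ (w n) :=
    Nat.le_mul_of_pos_right _ hw
  exact Nat.mul_le_mul_right _ (Nat.mul_le_mul_right _ h1)

end WSat
end
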